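/- Let f ∈ L_p^0(T²), 1<p<∞, θ=min(2,p), τ=max(2,p), β₁,β₂>0, 0<α₁<r₁, 0<α₂<r₂, δ₁,δ₂ ∈ (0,1/2). For 1<s<∞ define J(s) = {∫₀¹∫₀¹ t₁^{−(r₁−α₁)s} min(1,δ₁/t₁)^{β₁s} t₂^{−(r₂−α₂)s} min(1,δ₂/t₂)^{β₂s} ω_{r₁+β₁,r₂+β₂}(f,t₁,t₂)_p^s (dt₁/t₁)(dt₂/t₂)}^{1/s}. (A) If ∫₀¹∫₀¹ t₁^{−(r₁−α₁)θ−1} t₂^{−(r₂−α₂)θ−1} ω_{r₁+β₁,r₂+β₂}(f,t₁,t₂)_p^θ dt₁ dt₂ < ∞, then f has a mixed Weyl derivative f^{(r₁−α₁,r₂−α₂)} ∈ L_p^0(T²) and ω_{β₁,β₂}(f^{(r₁−α₁,r₂−α₂)},δ₁,δ₂)_p ≲ J(θ). (B) If f has a mixed Weyl derivative f^{(r₁−α₁,r₂−α₂)} ∈ L_p^0(T²), then ω_{β₁,β₂}(f^{(r₁−α₁,r₂−α₂)},δ₁,δ₂)_p ≳ J(τ). -/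

import Mathlib

open MeasureTheory Real
open scoped ENNReal

noncomputable section

/-- The `L_p` norm of a function of two variables over the period square `(0,2π]²`. -/
def Lp2Norm (p : ℝ) (f : ℝ → ℝ → ℝ) : ℝ≥0∞ :=
  (∫⁻ x in Set.Ioc (0:ℝ) (2*π), ∫⁻ y in Set.Ioc (0:ℝ) (2*π),
      ENNReal.ofReal (|f x y| ^ p)) ^ (1/p)

/-- `f ∈ L_p^0(T²)`: measurable, `2π`-periodic in each variable, finite `L_p` norm,
and zero mean in each variable separately. -/
structure MemLp0 (p : ℝ) (f : ℝ → ℝ → ℝ) : Prop where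
  meas : Measurable (Function.uncurry f)
  periodic_x : ∀ y, Function.Periodic (fun x => f x y) (2*π)
  periodic_y : ∀ x, Function.Periodic (f x) (2*π)
  norm_ne_top : Lp2Norm p f ≠ ⊤
  mean_x : ∀ᵐ (y : ℝ) ∂volume, (∫ x in (0:ℝ)..(2*π), f x y) = 0
  mean_y : ∀ᵐ (x : ℝ) ∂volume, (∫ y in (0:ℝ)..(2*π), f x y) = 0

/-- Generalized (fractional) binomial coefficient `C(α,ν) = α(α-1)⋯(α-ν+1)/ν!`. -/
def fracBinom (α : ℝ) : ℕ → ℝ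
  | 0 => 1
  | n+1 => fracBinom α n * (α - (n : ℝ)) / ((n : ℝ) + 1)

/-- Fractional difference of order `α` with step `h` in the first variable. -/
def diffX (α h : ℝ) (f : ℝ → ℝ → ℝ) : ℝ → ℝ → ℝ :=
  fun x y => ∑' ν : ℕ, (-1 : ℝ) ^ ν * fracBinom α ν * f (x + (α - (ν : ℝ)) * h) y

/-- Fractional difference of order `α` with step `h` in the second variable. -/
def diffY (α h : ℝ) (f : ℝ → ℝ → ℝ) : ℝ → ℝ → ℝ :=
  fun x y => ∑' ν : ℕ, (-1 : ℝ) ^ ν * fracBinom α ν * f x (y + (α - (ν : ℝ)) * h)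

/-- The mixed (fractional) modulus of smoothness `ω_{α₁,α₂}(f, δ₁, δ₂)_p`. -/
def mixedMod (p α₁ α₂ δ₁ δ₂ : ℝ) (f : ℝ → ℝ → ℝ) : ℝ≥0∞ :=
  ⨆ (h₁ : ℝ) (_ : |h₁| ≤ δ₁) (h₂ : ℝ) (_ : |h₂| ≤ δ₂),
    Lp2Norm p (diffX α₁ h₁ (diffY α₂ h₂ f))

/-- Complex Fourier coefficient of a (real-valued) function on `T²`. -/
def fourierCoefZ (f : ℝ → ℝ → ℝ) (m₁ m₂ : ℤ) : ℂ :=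
  (((2*π)^2)⁻¹ : ℝ) * ∫ x in (0:ℝ)..(2*π), ∫ y in (0:ℝ)..(2*π),
    (f x y : ℂ) * Complex.exp (-Complex.I * ((m₁ : ℂ) * (x : ℂ) + (m₂ : ℂ) * (y : ℂ)))

/-- `g` is the mixed Weyl derivative `f^{(ρ₁,ρ₂)}` of `f` (and `g ∈ L_p^0(T²)`):
the Fourier coefficients of `g` arise from those of `f` by multiplication
with `(i m₁)^{ρ₁} (i m₂)^{ρ₂}`. -/
def HasWeylDeriv (p ρ₁ ρ₂ : ℝ) (f g : ℝ → ℝ → ℝ) : Prop :=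
  MemLp0 p g ∧ ∀ m₁ m₂ : ℤ,
    fourierCoefZ g m₁ m₂ =
      (Complex.I * (m₁ : ℂ)) ^ (ρ₁ : ℂ) * (Complex.I * (m₂ : ℂ)) ^ (ρ₂ : ℂ) * fourierCoefZ f m₁ m₂

/-- The quantity `J(s)` of Theorem 8.4 (i). -/
def Jfun (p β₁ β₂ r₁ r₂ α₁ α₂ δ₁ δ₂ s : ℝ) (f : ℝ → ℝ → ℝ) : ℝ≥0∞ :=
  (∫⁻ t₁ in Set.Ioo (0:ℝ) 1, ∫⁻ t₂ in Set.Ioo (0:ℝ) 1,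
      ENNReal.ofReal (t₁ ^ (-(r₁-α₁)*s) * min 1 (δ₁/t₁) ^ (β₁*s) / t₁ *
        (t₂ ^ (-(r₂-α₂)*s) * min 1 (δ₂/t₂) ^ (β₂*s) / t₂)) *
        mixedMod p (r₁+β₁) (r₂+β₂) t₁ t₂ f ^ s) ^ (1/s)

set_option linter.unusedSectionVars false

/-! ### Two-point inequalities -/

lemma rpow_eq_sq_rpow_half {s : ℝ} (hs : 0 ≤ s) (p : ℝ) : s ^ p = (s ^ 2) ^ (p / 2) := by
  rw [← Real.rpow_natCast s 2, ← Real.rpow_mul hs]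
  congr 1
  push_cast
  ring

lemma norm_add_rpow_add_norm_sub_rpow_le {p : ℝ} (hp : 0 < p) (hp2 : p ≤ 2) (x y : ℂ) :
    ‖x + y‖ ^ p + ‖x - y‖ ^ p ≤ 2 * (‖x‖ ^ p + ‖y‖ ^ p) := by
  have hpar := parallelogram_law_with_norm ℝ x y
  have hc := (Real.concaveOn_rpow (p := p / 2) (by linarith) (by linarith)).2
    (Set.mem_Ici.2 (show 0 ≤ ‖x + y‖ ^ 2 by positivity))
    (Set.mem_Ici.2 (show 0 ≤ ‖x - y‖ ^ 2 by positivity))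
    (show (0 : ℝ) ≤ 1 / 2 by norm_num) (show (0 : ℝ) ≤ 1 / 2 by norm_num) (by norm_num)
  have hs := Real.rpow_add_le_add_rpow (p := p / 2) (a := ‖x‖ ^ 2) (b := ‖y‖ ^ 2)
    (by positivity) (by positivity) (by linarith) (by linarith)
  simp only [smul_eq_mul] at hc
  rw [show 1 / 2 * ‖x + y‖ ^ 2 + 1 / 2 * ‖x - y‖ ^ 2 = ‖x‖ ^ 2 + ‖y‖ ^ 2 by linarith] at hc
  simp only [rpow_eq_sq_rpow_half (norm_nonneg _) p]
  linarith

lemma le_norm_add_rpow_add_norm_sub_rpow {p : ℝ} (hp2 : 2 ≤ p) (x y : ℂ) :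
    2 * (‖x‖ ^ p + ‖y‖ ^ p) ≤ ‖x + y‖ ^ p + ‖x - y‖ ^ p := by
  have hpar := parallelogram_law_with_norm ℝ x y
  have hc := (convexOn_rpow (p := p / 2) (by linarith)).2
    (Set.mem_Ici.2 (show 0 ≤ ‖x + y‖ ^ 2 by positivity))
    (Set.mem_Ici.2 (show 0 ≤ ‖x - y‖ ^ 2 by positivity))
    (show (0 : ℝ) ≤ 1 / 2 by norm_num) (show (0 : ℝ) ≤ 1 / 2 by norm_num) (by norm_num)
  have hs := Real.add_rpow_le_rpow_add (p := p / 2) (a := ‖x‖ ^ 2) (b := ‖y‖ ^ 2)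
    (by positivity) (by positivity) (by linarith)
  simp only [smul_eq_mul] at hc
  rw [show 1 / 2 * ‖x + y‖ ^ 2 + 1 / 2 * ‖x - y‖ ^ 2 = ‖x‖ ^ 2 + ‖y‖ ^ 2 by linarith] at hc
  simp only [rpow_eq_sq_rpow_half (norm_nonneg _) p]
  linarith

lemma one_add_rpow_add_one_sub_rpow_le {r t : ℝ} (hr : 1 ≤ r) (ht : |t| ≤ 1) :
    (1 + t) ^ r + (1 - t) ^ r ≤ 2 * (1 + (exp (r / 2) - 1) * t ^ 2) ^ r := by
  obtain ⟨h1, h2⟩ := abs_le.1 ht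
  have a1 : (1 + t) ^ r ≤ exp (r * t) := by
    rw [mul_comm, Real.exp_mul]
    exact Real.rpow_le_rpow (by linarith) (by linarith [Real.add_one_le_exp t]) (by linarith)
  have a2 : (1 - t) ^ r ≤ exp (-(r * t)) := by
    rw [show -(r * t) = (-t) * r by ring, Real.exp_mul]
    exact Real.rpow_le_rpow (by linarith) (by linarith [Real.add_one_le_exp (-t)]) (by linarith)
  have a3 := Real.cosh_le_exp_half_sq (r * t)
  rw [Real.cosh_eq] at a3
  have ht2 : t ^ 2 ≤ 1 := by nlinarith
  have a4 : exp (t ^ 2 * (r / 2)) ≤ 1 + (exp (r / 2) - 1) * t ^ 2 := by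
    have := convexOn_exp.2 (Set.mem_univ (r / 2)) (Set.mem_univ 0)
      (show 0 ≤ t ^ 2 by positivity) (show 0 ≤ 1 - t ^ 2 by linarith) (by ring)
    simp only [smul_eq_mul, mul_zero, add_zero, exp_zero, mul_one] at this
    linarith
  have a5 : exp ((r * t) ^ 2 / 2) ≤ (1 + (exp (r / 2) - 1) * t ^ 2) ^ r := by
    rw [show (r * t) ^ 2 / 2 = (t ^ 2 * (r / 2)) * r by ring, Real.exp_mul]
    exact Real.rpow_le_rpow (exp_pos _).le a4 (by linarith)
  linarith

/-- Two-point 2-uniform smoothness of `ℓ_q`, `q ≥ 2`. -/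
lemma exists_norm_add_rpow_add_norm_sub_rpow_le {q : ℝ} (hq : 2 ≤ q) :
    ∃ C : ℝ, 1 ≤ C ∧ ∀ x y : ℂ,
      ‖x + y‖ ^ q + ‖x - y‖ ^ q ≤ 2 * (‖x‖ ^ 2 + C * ‖y‖ ^ 2) ^ (q / 2) := by
  set K := exp (q / 2 / 2) - 1 with hK
  have hK0 : 0 ≤ K := by linarith [Real.one_le_exp (show 0 ≤ q / 2 / 2 by linarith)]
  refine ⟨1 + 4 * K, by linarith, fun x y => ?_⟩
  simp only [rpow_eq_sq_rpow_half (norm_nonneg _) q]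
  have hpar := parallelogram_law_with_norm ℝ x y
  rcases eq_or_ne y 0 with rfl | hy
  · simp; linarith
  set S := ‖x‖ ^ 2 + ‖y‖ ^ 2 with hS
  have hyp : 0 < ‖y‖ := norm_pos_iff.2 hy
  have hSpos : 0 < S := by positivity
  set t := (‖x + y‖ ^ 2 - S) / S with ht
  have e1 : ‖x + y‖ ^ 2 = S * (1 + t) := by rw [ht]; field_simp; ring
  have e2 : ‖x - y‖ ^ 2 = S * (1 - t) := by rw [ht]; field_simp; linarith
  have hd : |‖x + y‖ ^ 2 - S| ≤ 2 * ‖x‖ * ‖y‖ := by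
    have h1 : ‖x + y‖ ^ 2 ≤ (‖x‖ + ‖y‖) ^ 2 := by gcongr; exact norm_add_le _ _
    have h2 : ‖x - y‖ ^ 2 ≤ (‖x‖ + ‖y‖) ^ 2 := by gcongr; exact norm_sub_le _ _
    rw [abs_le]; constructor <;> nlinarith
  have htS : |t| * S ≤ 2 * ‖x‖ * ‖y‖ := by
    rw [ht, abs_div, abs_of_pos hSpos, div_mul_cancel₀ _ hSpos.ne']; exact hd
  have ht1 : |t| ≤ 1 := by
    by_contra! h
    nlinarith [sq_nonneg (‖x‖ - ‖y‖)]
  have main := one_add_rpow_add_one_sub_rpow_le (r := q / 2) (by linarith) ht1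
  obtain ⟨l1, l2⟩ := abs_le.1 ht1
  rw [e1, e2, Real.mul_rpow hSpos.le (by linarith), Real.mul_rpow hSpos.le (by linarith), ← mul_add]
  calc S ^ (q / 2) * ((1 + t) ^ (q / 2) + (1 - t) ^ (q / 2))
      ≤ S ^ (q / 2) * (2 * (1 + K * t ^ 2) ^ (q / 2)) := by gcongr
    _ = 2 * (S * (1 + K * t ^ 2)) ^ (q / 2) := by
        rw [Real.mul_rpow hSpos.le (by positivity)]; ring
    _ ≤ _ := by
        gcongr
        have h3 : t ^ 2 * S ≤ 4 * ‖y‖ ^ 2 := by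
          have : (|t| * S) ^ 2 ≤ (2 * ‖x‖ * ‖y‖) ^ 2 := by gcongr
          rw [mul_pow, sq_abs] at this
          have h4 : t ^ 2 * S * S ≤ 4 * ‖y‖ ^ 2 * S := by
            nlinarith [mul_nonneg (sq_nonneg ‖y‖) (sq_nonneg ‖y‖)]
          exact le_of_mul_le_mul_right h4 hSpos
        nlinarith

/-- Two-point 2-uniform convexity of `ℓ_p`, `1 < p ≤ 2`. -/
lemma exists_le_norm_add_rpow_add_norm_sub_rpow {p : ℝ} (hp : 1 < p) (hp2 : p ≤ 2) :
    ∃ c : ℝ, 0 < c ∧ c ≤ 1 ∧ ∀ x y : ℂ,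
      2 * (‖x‖ ^ 2 + c * ‖y‖ ^ 2) ^ (p / 2) ≤ ‖x + y‖ ^ p + ‖x - y‖ ^ p := by
  have hpq := Real.HolderConjugate.conjExponent hp
  set q := p.conjExponent with hq
  have hq2 : 2 ≤ q := by
    rw [hq, Real.conjExponent, le_div_iff₀ (by linarith)]; linarith
  obtain ⟨C, hC1, hC⟩ := exists_norm_add_rpow_add_norm_sub_rpow_le hq2
  have hC0 : 0 < C := by linarith
  refine ⟨C⁻¹, by positivity, inv_le_one_of_one_le₀ hC1, fun x y => ?_⟩
  set M := ‖x‖ ^ 2 + C⁻¹ * ‖y‖ ^ 2 with hM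
  have hM0 : 0 ≤ M := by positivity
  set a : ℂ := star x with ha
  set b : ℂ := (C⁻¹ : ℝ) * star y with hb
  set W := ‖x + y‖ ^ p + ‖x - y‖ ^ p with hW
  have hW0 : 0 ≤ W := by positivity
  have h1 : 2 * M ≤ ‖x + y‖ * ‖a + b‖ + ‖x - y‖ * ‖a - b‖ := by
    have e : ((x + y) * (a + b) + (x - y) * (a - b)) = ((2 * M : ℝ) : ℂ) := by
      have hx : x * star x = ((‖x‖ ^ 2 : ℝ) : ℂ) := by
        rw [Complex.star_def, Complex.mul_conj, Complex.normSq_eq_norm_sq]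
      have hy : y * star y = ((‖y‖ ^ 2 : ℝ) : ℂ) := by
        rw [Complex.star_def, Complex.mul_conj, Complex.normSq_eq_norm_sq]
      rw [ha, hb, hM]
      push_cast at hx hy ⊢
      linear_combination 2 * hx + 2 * (C : ℂ)⁻¹ * hy
    calc 2 * M = ‖((2 * M : ℝ) : ℂ)‖ := by
          rw [Complex.norm_real, Real.norm_of_nonneg (by positivity)]
      _ ≤ _ := by
          rw [← e]
          refine (norm_add_le _ _).trans ?_
          rw [norm_mul, norm_mul]
  have h2 : ‖x + y‖ * ‖a + b‖ + ‖x - y‖ * ‖a - b‖ ≤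
      W ^ (1 / p) * (‖a + b‖ ^ q + ‖a - b‖ ^ q) ^ (1 / q) := by
    have := Real.inner_le_Lp_mul_Lq Finset.univ ![‖x + y‖, ‖x - y‖] ![‖a + b‖, ‖a - b‖] hpq
    simpa [Fin.sum_univ_two] using this
  have h3 : ‖a + b‖ ^ q + ‖a - b‖ ^ q ≤ 2 * M ^ (q / 2) := by
    refine (hC a b).trans (le_of_eq ?_)
    congr 2
    rw [ha, hb, norm_mul, norm_star, norm_star, Complex.norm_real,
      Real.norm_of_nonneg (by positivity), hM]
    field_simp
  have hq0 : 0 < q := by linarith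
  have h4 : 2 * M ≤ W ^ (1 / p) * (2 ^ (1 / q) * M ^ (1 / 2 : ℝ)) := by
    refine h1.trans (h2.trans ?_)
    gcongr
    refine (Real.rpow_le_rpow (by positivity) h3 (by positivity)).trans (le_of_eq ?_)
    rw [Real.mul_rpow (by norm_num) (by positivity), ← Real.rpow_mul hM0]
    congr 2
    field_simp
  rcases hM0.eq_or_lt with hM0' | hMpos
  · rw [← hM0', Real.zero_rpow (by linarith)]; simpa using hW0
  have h5 : 2 ^ (1 / p) * M ^ (1 / 2 : ℝ) ≤ W ^ (1 / p) := by
    have e2 : (2 : ℝ) = 2 ^ (1 / p) * 2 ^ (1 / q) := by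
      rw [← Real.rpow_add (by norm_num)]
      have := hpq.inv_add_inv_eq_one
      rw [one_div, one_div, this, Real.rpow_one]
    have eM : M = M ^ (1 / 2 : ℝ) * M ^ (1 / 2 : ℝ) := by
      rw [← Real.rpow_add hMpos]; norm_num
    have hpos : 0 < 2 ^ (1 / q) * M ^ (1 / 2 : ℝ) := by positivity
    refine le_of_mul_le_mul_right ?_ hpos
    calc 2 ^ (1 / p) * M ^ (1 / 2 : ℝ) * (2 ^ (1 / q) * M ^ (1 / 2 : ℝ))
        = (2 ^ (1 / p) * 2 ^ (1 / q)) * (M ^ (1 / 2 : ℝ) * M ^ (1 / 2 : ℝ)) := by ring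
      _ = 2 * M := by rw [← e2, ← eM]
      _ ≤ _ := h4
  have h6 := Real.rpow_le_rpow (by positivity) h5 (show 0 ≤ p by linarith)
  rw [Real.mul_rpow (by positivity) (by positivity), ← Real.rpow_mul (by norm_num),
    ← Real.rpow_mul hM0, ← Real.rpow_mul hW0, one_div_mul_cancel (by linarith), Real.rpow_one,
    Real.rpow_one, show 1 / 2 * p = p / 2 by ring] at h6
  exact h6

/-- A norm is `τ`-convex if `‖x‖^τ + c‖y‖^τ ≤ ‖x ± y‖^τ` whenever both signs give the same norm. -/
def IsotropicConvex (X : Type*) [NormedAddCommGroup X] (τ : ℝ) : Prop :=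
  ∃ c : ℝ, 0 < c ∧ ∀ x y : X, ‖x + y‖ = ‖x - y‖ → ‖x‖ ^ τ + c * ‖y‖ ^ τ ≤ ‖x + y‖ ^ τ

/-- A norm is `θ`-smooth if `‖x ± y‖^θ ≤ ‖x‖^θ + C‖y‖^θ` whenever both signs give the same norm. -/
def IsotropicSmooth (X : Type*) [NormedAddCommGroup X] (θ : ℝ) : Prop :=
  ∃ C : ℝ, 0 < C ∧ ∀ x y : X, ‖x + y‖ = ‖x - y‖ → ‖x + y‖ ^ θ ≤ ‖x‖ ^ θ + C * ‖y‖ ^ θ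

section LpNorm

variable {α : Type*} [MeasurableSpace α] {μ : Measure α} {p : ℝ}

lemma integrable_norm_rpow_Lp (hp : 0 < p) (F : Lp ℂ (ENNReal.ofReal p) μ) :
    Integrable (fun a => ‖F a‖ ^ p) μ := by
  have := (Lp.memLp F).integrable_norm_rpow (by simpa using hp) ENNReal.ofReal_ne_top
  rwa [ENNReal.toReal_ofReal hp.le] at this

lemma norm_rpow_eq_integral_Lp (hp : 0 < p) (F : Lp ℂ (ENNReal.ofReal p) μ) :
    ‖F‖ ^ p = ∫ a, ‖F a‖ ^ p ∂μ := by
  have h0 : 0 ≤ ∫ a, ‖F a‖ ^ p ∂μ := integral_nonneg fun a => by positivity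
  rw [Lp.norm_def, (Lp.memLp F).eLpNorm_eq_integral_rpow_norm (by simpa using hp)
    ENNReal.ofReal_ne_top, ENNReal.toReal_ofReal hp.le, ENNReal.toReal_ofReal (by positivity),
    ← Real.rpow_mul h0, inv_mul_cancel₀ hp.ne', Real.rpow_one]

lemma norm_add_rpow_add_norm_sub_rpow_Lp [Fact (1 ≤ ENNReal.ofReal p)] (hp : 0 < p)
    (F G : Lp ℂ (ENNReal.ofReal p) μ) :
    ‖F + G‖ ^ p + ‖F - G‖ ^ p = ∫ a, (‖F a + G a‖ ^ p + ‖F a - G a‖ ^ p) ∂μ := by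
  rw [norm_rpow_eq_integral_Lp hp, norm_rpow_eq_integral_Lp hp,
    ← integral_add (integrable_norm_rpow_Lp hp _) (integrable_norm_rpow_Lp hp _)]
  refine integral_congr_ae ?_
  filter_upwards [Lp.coeFn_add F G, Lp.coeFn_sub F G] with a h1 h2
  simp only [h1, h2, Pi.add_apply, Pi.sub_apply]

lemma integrable_norm_add_rpow_Lp [Fact (1 ≤ ENNReal.ofReal p)] (hp : 0 < p)
    (F G : Lp ℂ (ENNReal.ofReal p) μ) :
    Integrable (fun a => ‖F a + G a‖ ^ p + ‖F a - G a‖ ^ p) μ := by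
  refine ((integrable_norm_rpow_Lp hp (F + G)).add (integrable_norm_rpow_Lp hp (F - G))).congr ?_
  filter_upwards [Lp.coeFn_add F G, Lp.coeFn_sub F G] with a h1 h2
  simp only [h1, h2, Pi.add_apply, Pi.sub_apply]

lemma integral_const_mul_norm_rpow_add_Lp (hp : 0 < p) (F G : Lp ℂ (ENNReal.ofReal p) μ) (a b : ℝ) :
    ∫ x, (a * ‖F x‖ ^ p + b * ‖G x‖ ^ p) ∂μ = a * ‖F‖ ^ p + b * ‖G‖ ^ p := by
  rw [integral_add ((integrable_norm_rpow_Lp hp F).const_mul a)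
    ((integrable_norm_rpow_Lp hp G).const_mul b), integral_const_mul, integral_const_mul,
    norm_rpow_eq_integral_Lp hp, norm_rpow_eq_integral_Lp hp]

lemma isotropicSmooth_Lp_of_le_two (hp : 1 < p) (hp2 : p ≤ 2) [Fact (1 ≤ ENNReal.ofReal p)] :
    IsotropicSmooth (Lp ℂ (ENNReal.ofReal p) μ) p := by
  refine ⟨1, one_pos, fun F G h => ?_⟩
  have hp0 : 0 < p := by linarith
  have h1 := norm_add_rpow_add_norm_sub_rpow_Lp hp0 F G
  have h2 := integral_mono (integrable_norm_add_rpow_Lp hp0 F G)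
    (((integrable_norm_rpow_Lp hp0 F).const_mul 2).add ((integrable_norm_rpow_Lp hp0 G).const_mul
        2))
    fun a => (norm_add_rpow_add_norm_sub_rpow_le hp0 hp2 (F a) (G a)).trans_eq (mul_add _ _ _)
  have h3 := integral_const_mul_norm_rpow_add_Lp hp0 F G 2 2
  simp only [Pi.add_apply] at h2
  rw [← h] at h1
  linarith

lemma isotropicConvex_Lp_of_two_le (hp2 : 2 ≤ p) [Fact (1 ≤ ENNReal.ofReal p)] :
    IsotropicConvex (Lp ℂ (ENNReal.ofReal p) μ) p := by
  refine ⟨1, one_pos, fun F G h => ?_⟩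
  have hp0 : 0 < p := by linarith
  have h1 := norm_add_rpow_add_norm_sub_rpow_Lp hp0 F G
  have h2 := integral_mono
    (((integrable_norm_rpow_Lp hp0 F).const_mul 2).add ((integrable_norm_rpow_Lp hp0 G).const_mul
        2))
    (integrable_norm_add_rpow_Lp hp0 F G)
    fun a => (mul_add _ _ _).symm.trans_le (le_norm_add_rpow_add_norm_sub_rpow hp2 (F a) (G a))
  have h3 := integral_const_mul_norm_rpow_add_Lp hp0 F G 2 2
  simp only [Pi.add_apply] at h2
  rw [← h] at h1
  linarith

/-- Rewriting `(u² + c v²)^r` in the weighted form to which Jensen's inequality applies. -/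
lemma weighted_rpow_eq {A B c : ℝ} (hA : 0 < A) (hB : 0 < B) (hc : 0 < c) (r : ℝ) {u v : ℝ}
    (hu : 0 ≤ u) (hv : 0 ≤ v) (p : ℝ) (hr : r = p / 2) :
    (A ^ 2 / (A ^ 2 + c * B ^ 2)) * ((A ^ 2 + c * B ^ 2) / A ^ 2 * u ^ 2) ^ r +
      (c * B ^ 2 / (A ^ 2 + c * B ^ 2)) * ((A ^ 2 + c * B ^ 2) / (c * B ^ 2) * (c * v ^ 2)) ^ r =
    (A ^ 2 / (A ^ 2 + c * B ^ 2)) * (A ^ 2 + c * B ^ 2) ^ r / A ^ p * u ^ p +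
      (c * B ^ 2 / (A ^ 2 + c * B ^ 2)) * (A ^ 2 + c * B ^ 2) ^ r / B ^ p * v ^ p := by
  have hS : 0 < A ^ 2 + c * B ^ 2 := by positivity
  rw [show (A ^ 2 + c * B ^ 2) / (c * B ^ 2) * (c * v ^ 2) = (A ^ 2 + c * B ^ 2) / B ^ 2 * v ^ 2 by
    field_simp]
  rw [Real.mul_rpow (by positivity) (by positivity), Real.mul_rpow (by positivity) (by positivity),
    Real.div_rpow hS.le (by positivity), Real.div_rpow hS.le (by positivity), hr,
    ← rpow_eq_sq_rpow_half hA.le, ← rpow_eq_sq_rpow_half hB.le, ← rpow_eq_sq_rpow_half hu,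
    ← rpow_eq_sq_rpow_half hv]
  ring

lemma rpow_half_rpow_two {R : ℝ} (hR : 0 ≤ R) (hp : 0 < p) {S : ℝ} (hS : 0 ≤ S) :
    S ^ (p / 2) ≤ R ^ p ↔ S ≤ R ^ (2 : ℝ) := by
  rw [rpow_eq_sq_rpow_half hR p, Real.rpow_le_rpow_iff hS (by positivity) (by positivity)]
  norm_num

lemma isotropicConvex_Lp_of_le_two (hp : 1 < p) (hp2 : p ≤ 2) [Fact (1 ≤ ENNReal.ofReal p)] :
    IsotropicConvex (Lp ℂ (ENNReal.ofReal p) μ) 2 := by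
  obtain ⟨c, hc0, hc1, hc⟩ := exists_le_norm_add_rpow_add_norm_sub_rpow hp hp2
  refine ⟨c, hc0, fun F G h => ?_⟩
  have hp0 : 0 < p := by linarith
  rcases eq_or_ne F 0 with rfl | hF
  · simp only [norm_zero, zero_add, Real.rpow_two]; nlinarith [sq_nonneg ‖G‖]
  rcases eq_or_ne G 0 with rfl | hG
  · simp
  have hF' := norm_pos_iff.2 hF
  have hG' := norm_pos_iff.2 hG
  have h1 := norm_add_rpow_add_norm_sub_rpow_Lp hp0 F G
  set A := ‖F‖ with hA
  set D := ‖G‖ with hD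
  set S := A ^ 2 + c * D ^ 2 with hS
  have hS0 : 0 < S := by positivity
  set r := p / 2 with hr
  have key : ∀ a, 2 * ((A ^ 2 / S) * S ^ r / A ^ p) * ‖F a‖ ^ p +
      2 * ((c * D ^ 2 / S) * S ^ r / D ^ p) * ‖G a‖ ^ p ≤ ‖F a + G a‖ ^ p + ‖F a - G a‖ ^ p := by
    intro a
    refine le_trans ?_ (hc (F a) (G a))
    have e := weighted_rpow_eq hF' hG' hc0 r (norm_nonneg (F a)) (norm_nonneg (G a)) p rfl
    have hcc := (Real.concaveOn_rpow (p := p / 2) (by linarith) (by linarith)).2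
      (Set.mem_Ici.2 (show 0 ≤ S / A ^ 2 * ‖F a‖ ^ 2 by positivity))
      (Set.mem_Ici.2 (show 0 ≤ S / (c * D ^ 2) * (c * ‖G a‖ ^ 2) by positivity))
      (show 0 ≤ A ^ 2 / S by positivity) (show 0 ≤ c * D ^ 2 / S by positivity)
      (by rw [← add_div, div_self hS0.ne'])
    simp only [smul_eq_mul] at hcc
    rw [show A ^ 2 / S * (S / A ^ 2 * ‖F a‖ ^ 2) + c * D ^ 2 / S * (S / (c * D ^ 2) *
        (c * ‖G a‖ ^ 2))
      = ‖F a‖ ^ 2 + c * ‖G a‖ ^ 2 by field_simp] at hcc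
    rw [← hr] at hcc
    linarith
  have h2 := integral_mono
    (((integrable_norm_rpow_Lp hp0 F).const_mul _).add ((integrable_norm_rpow_Lp hp0 G).const_mul
        _))
    (integrable_norm_add_rpow_Lp hp0 F G) key
  have h3 := integral_const_mul_norm_rpow_add_Lp hp0 F G (2 * ((A ^ 2 / S) * S ^ r / A ^ p))
    (2 * ((c * D ^ 2 / S) * S ^ r / D ^ p))
  simp only [Pi.add_apply] at h2
  rw [h3, ← h1, ← h] at h2
  have hAp : 0 < A ^ p := by positivity
  have hDp : 0 < D ^ p := by positivity
  have e : 2 * (A ^ 2 / S * S ^ r / A ^ p) * ‖F‖ ^ p + 2 * (c * D ^ 2 / S * S ^ r / D ^ p) * ‖G‖ ^ p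
      = 2 * S ^ r := by
    rw [← hA, ← hD]
    field_simp
    rw [hS]
  have h4 : S ^ (p / 2) ≤ ‖F + G‖ ^ p := by rw [e] at h2; linarith
  rw [rpow_half_rpow_two (norm_nonneg _) hp0 hS0.le] at h4
  simpa [hS] using h4

lemma isotropicSmooth_Lp_of_two_le (hp2 : 2 ≤ p) [Fact (1 ≤ ENNReal.ofReal p)] :
    IsotropicSmooth (Lp ℂ (ENNReal.ofReal p) μ) 2 := by
  obtain ⟨c, hc1, hc⟩ := exists_norm_add_rpow_add_norm_sub_rpow_le hp2
  have hc0 : 0 < c := by linarith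
  refine ⟨c, hc0, fun F G h => ?_⟩
  have hp0 : 0 < p := by linarith
  rcases eq_or_ne F 0 with rfl | hF
  · simp only [norm_zero, zero_add, Real.rpow_two]; nlinarith [sq_nonneg ‖G‖]
  rcases eq_or_ne G 0 with rfl | hG
  · simp
  have hF' := norm_pos_iff.2 hF
  have hG' := norm_pos_iff.2 hG
  have h1 := norm_add_rpow_add_norm_sub_rpow_Lp hp0 F G
  set A := ‖F‖ with hA
  set D := ‖G‖ with hD
  set S := A ^ 2 + c * D ^ 2 with hS
  have hS0 : 0 < S := by positivity
  set r := p / 2 with hr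
  have key : ∀ a, ‖F a + G a‖ ^ p + ‖F a - G a‖ ^ p ≤ 2 *
      ((A ^ 2 / S) * S ^ r / A ^ p) * ‖F a‖ ^ p +
      2 * ((c * D ^ 2 / S) * S ^ r / D ^ p) * ‖G a‖ ^ p := by
    intro a
    refine (hc (F a) (G a)).trans ?_
    have e := weighted_rpow_eq hF' hG' hc0 r (norm_nonneg (F a)) (norm_nonneg (G a)) p rfl
    have hcc := (convexOn_rpow (p := p / 2) (by linarith)).2
      (Set.mem_Ici.2 (show 0 ≤ S / A ^ 2 * ‖F a‖ ^ 2 by positivity))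
      (Set.mem_Ici.2 (show 0 ≤ S / (c * D ^ 2) * (c * ‖G a‖ ^ 2) by positivity))
      (show 0 ≤ A ^ 2 / S by positivity) (show 0 ≤ c * D ^ 2 / S by positivity)
      (by rw [← add_div, div_self hS0.ne'])
    simp only [smul_eq_mul] at hcc
    rw [show A ^ 2 / S * (S / A ^ 2 * ‖F a‖ ^ 2) + c * D ^ 2 / S * (S / (c * D ^ 2) *
        (c * ‖G a‖ ^ 2))
      = ‖F a‖ ^ 2 + c * ‖G a‖ ^ 2 by field_simp] at hcc
    rw [← hr] at hcc
    linarith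
  have h2 := integral_mono (integrable_norm_add_rpow_Lp hp0 F G)
    (((integrable_norm_rpow_Lp hp0 F).const_mul _).add ((integrable_norm_rpow_Lp hp0 G).const_mul
        _))
    key
  have h3 := integral_const_mul_norm_rpow_add_Lp hp0 F G (2 * ((A ^ 2 / S) * S ^ r / A ^ p))
    (2 * ((c * D ^ 2 / S) * S ^ r / D ^ p))
  simp only [Pi.add_apply] at h2
  rw [h3, ← h1, ← h] at h2
  have hAp : 0 < A ^ p := by positivity
  have hDp : 0 < D ^ p := by positivity
  have e : 2 * (A ^ 2 / S * S ^ r / A ^ p) * ‖F‖ ^ p + 2 * (c * D ^ 2 / S * S ^ r / D ^ p) * ‖G‖ ^ p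
      = 2 * S ^ r := by
    rw [← hA, ← hD]
    field_simp
    rw [hS]
  have h4 : ‖F + G‖ ^ p ≤ S ^ (p / 2) := by rw [e] at h2; linarith
  rw [rpow_eq_sq_rpow_half (norm_nonneg _) p, Real.rpow_le_rpow_iff (by positivity) hS0.le
    (by positivity)] at h4
  simpa [hS] using h4

lemma isotropicConvex_Lp (hp : 1 < p) [Fact (1 ≤ ENNReal.ofReal p)] :
    IsotropicConvex (Lp ℂ (ENNReal.ofReal p) μ) (max 2 p) := by
  rcases le_total p 2 with h | h
  · rw [max_eq_left h]; exact isotropicConvex_Lp_of_le_two hp h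
  · rw [max_eq_right h]; exact isotropicConvex_Lp_of_two_le h

lemma isotropicSmooth_Lp (hp : 1 < p) [Fact (1 ≤ ENNReal.ofReal p)] :
    IsotropicSmooth (Lp ℂ (ENNReal.ofReal p) μ) (min 2 p) := by
  rcases le_total p 2 with h | h
  · rw [min_eq_right h]; exact isotropicSmooth_Lp_of_le_two hp h
  · rw [min_eq_left h]; exact isotropicSmooth_Lp_of_two_le h

end LpNorm

/-- A strongly continuous, `2π`-periodic one-parameter group of isometries. -/
structure PeriodicGroup (X : Type*) [NormedAddCommGroup X] [NormedSpace ℂ X] where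
  op : ℝ → X →L[ℂ] X
  op_zero : op 0 = 1
  op_add : ∀ s t x, op (s + t) x = op s (op t x)
  norm_op : ∀ s x, ‖op s x‖ = ‖x‖
  op_periodic : ∀ s, op (s + 2 * π) = op s
  continuous_op : ∀ x, Continuous fun s => op s x

section IntOp

variable {X : Type*} [NormedAddCommGroup X] [NormedSpace ℂ X]

/-- A strongly continuous uniformly bounded family of operators. -/
def StrongCont (W : ℝ → X →L[ℂ] X) : Prop :=
  (∀ x, Continuous fun s => W s x) ∧ ∃ C, ∀ s, ‖W s‖ ≤ C

/-- The strong integral of a family of operators. -/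
def intOp (W : ℝ → X →L[ℂ] X) (hW : StrongCont W) (a b : ℝ) : X →L[ℂ] X :=
  LinearMap.mkContinuousOfExistsBound
    { toFun := fun x => ∫ s in a..b, W s x
      map_add' := fun x y => by
        simp only [map_add]
        exact intervalIntegral.integral_add ((hW.1 x).intervalIntegrable _ _)
          ((hW.1 y).intervalIntegrable _ _)
      map_smul' := fun c x => by
        simp only [map_smul, RingHom.id_apply]
        exact intervalIntegral.integral_smul c _ }
    (by
      obtain ⟨C, hC⟩ := hW.2
      refine ⟨C * |b - a|, fun x => ?_⟩
      refine (intervalIntegral.norm_integral_le_of_norm_le_const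
        fun s _ => (W s).le_of_opNorm_le (hC s) x).trans_eq ?_
      ring)

lemma intOp_apply (W : ℝ → X →L[ℂ] X) (hW : StrongCont W) (a b : ℝ) (x : X) :
    intOp W hW a b x = ∫ s in a..b, W s x := rfl

end IntOp

lemma integral_exp_int (m : ℤ) : (∫ s in (-π)..π, Complex.exp (Complex.I * m * s)) =
    if m = 0 then 2 * (π : ℂ) else 0 := by
  split_ifs with h
  · subst h; simp; ring
  · have hm : Complex.I * (m : ℂ) ≠ 0 := by simp [h]
    have := integral_exp_mul_complex (a := -π) (b := π) hm
    rw [this]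
    have : Complex.exp (Complex.I * m * π) = Complex.exp (Complex.I * m * (-π : ℝ)) := by
      rw [Complex.exp_eq_exp_iff_exists_int]
      exact ⟨m, by push_cast; ring⟩
    rw [this]; simp

namespace PeriodicGroup

variable {X : Type*} [NormedAddCommGroup X] [NormedSpace ℂ X] (G : PeriodicGroup X)

lemma norm_op_le (s : ℝ) : ‖G.op s‖ ≤ 1 :=
  ContinuousLinearMap.opNorm_le_bound _ zero_le_one fun x => by rw [G.norm_op, one_mul]

lemma strongCont_mul {K : ℝ → ℂ} (hK : Continuous K) (C : ℝ) (hC : ∀ s, ‖K s‖ ≤ C) :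
    StrongCont fun s => K s • G.op s := by
  refine ⟨fun x => hK.smul (G.continuous_op x), C, fun s => ?_⟩
  rw [norm_smul]
  exact (mul_le_of_le_one_right (norm_nonneg _) (G.norm_op_le s)).trans (hC s)

lemma strongCont : StrongCont G.op := ⟨G.continuous_op, 1, G.norm_op_le⟩

lemma strongCont_exp (m : ℤ) :
    StrongCont fun s : ℝ => Complex.exp (-(Complex.I * m * s)) • G.op s := by
  refine G.strongCont_mul (by fun_prop) 1 fun s => ?_
  rw [show -(Complex.I * m * s) = ((-(m * s) : ℝ) : ℂ) * Complex.I by push_cast; ring,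
    Complex.norm_exp_ofReal_mul_I]

/-- The spectral projection onto frequency `m`. -/
def proj (m : ℤ) : X →L[ℂ] X := (2 * (π : ℂ))⁻¹ • intOp _ (G.strongCont_exp m) (-π) π

lemma proj_apply (m : ℤ) (x : X) : G.proj m x =
    (2 * (π : ℂ))⁻¹ • ∫ s in (-π)..π, Complex.exp (-(Complex.I * m * s)) • G.op s x := rfl

lemma commute_proj {A : X →L[ℂ] X} (hA : ∀ s x, A (G.op s x) = G.op s (A x)) [CompleteSpace X]
    (m : ℤ) (x : X) : A (G.proj m x) = G.proj m (A x) := by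
  rw [proj_apply, proj_apply, map_smul, ← ContinuousLinearMap.intervalIntegral_comp_comm]
  · simp only [map_smul, hA]
  · exact ((G.strongCont_exp m).1 x).intervalIntegrable _ _

variable [CompleteSpace X]

lemma proj_op (m : ℤ) (t : ℝ) (x : X) :
    G.proj m (G.op t x) = Complex.exp (Complex.I * m * t) • G.proj m x := by
  rw [proj_apply, proj_apply, smul_comm]
  congr 1
  have hper : Function.Periodic
      (fun s : ℝ => Complex.exp (-(Complex.I * m * s)) • G.op s x) (2 * π) := fun s => by
    simp only [G.op_periodic]
    congr 1
    rw [Complex.exp_eq_exp_iff_exists_int]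
    exact ⟨-m, by push_cast; ring⟩
  calc ∫ s in (-π)..π, Complex.exp (-(Complex.I * m * s)) • G.op s (G.op t x)
      = ∫ s in (-π)..π, Complex.exp (Complex.I * m * t) •
          (Complex.exp (-(Complex.I * m * ((s + t : ℝ) : ℂ))) • G.op (s + t) x) := by
        refine intervalIntegral.integral_congr fun s _ => ?_
        simp only [G.op_add, smul_smul, ← Complex.exp_add]
        congr 2; push_cast; ring
    _ = Complex.exp (Complex.I * m * t) •
          ∫ s in (-π + t)..(-π + t + 2 * π), Complex.exp (-(Complex.I * m * s)) • G.op s x := by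
        rw [intervalIntegral.integral_smul, intervalIntegral.integral_comp_add_right
          (fun s : ℝ => Complex.exp (-(Complex.I * m * s)) • G.op s x)]
        congr 2; ring
    _ = _ := by
        rw [hper.intervalIntegral_add_eq (-π + t) (-π), show -π + 2 * π = π by ring]

lemma op_proj (m : ℤ) (t : ℝ) (x : X) :
    G.op t (G.proj m x) = Complex.exp (Complex.I * m * t) • G.proj m x := by
  rw [← proj_op]
  exact G.commute_proj (A := G.op t) (fun s x => by rw [← G.op_add, ← G.op_add, add_comm]) m x

lemma proj_proj (m n : ℤ) (x : X) : G.proj m (G.proj n x) = if m = n then G.proj n x else 0 := by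
  rw [proj_apply]
  simp only [op_proj, smul_smul, ← Complex.exp_add]
  have : ∀ s : ℝ, Complex.exp (-(Complex.I * m * s) + Complex.I * n * s) =
      Complex.exp (Complex.I * (n - m : ℤ) * s) := fun s => by congr 1; push_cast; ring
  simp only [this]
  rw [intervalIntegral.integral_smul_const, integral_exp_int, smul_smul]
  have hpi : (π : ℂ) ≠ 0 := by exact_mod_cast pi_ne_zero
  by_cases h : m = n
  · subst h
    rw [if_pos rfl, if_pos (sub_self _), inv_mul_cancel₀ (by simp), one_smul]
  · rw [if_neg h, if_neg (by omega)]; simp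

lemma eq_zero_of_proj_eq_zero (x : X) (h : ∀ m, G.proj m x = 0) : x = 0 := by
  have : Fact (0 < 2 * π) := ⟨by positivity⟩
  refine SeparatingDual.eq_zero_of_forall_dual_eq_zero (R := ℂ) fun l => ?_
  have hper : Function.Periodic (fun s => l (G.op s x)) (2 * π) := fun s => by
    simp only [G.op_periodic]
  have hcont : Continuous fun s => l (G.op s x) := l.continuous.comp (G.continuous_op x)
  let φ : C(AddCircle (2 * π), ℂ) := ⟨hper.lift, continuous_coinduced_dom.2 hcont⟩
  have hφ : ∀ s : ℝ, φ (s : AddCircle (2 * π)) = l (G.op s x) := fun s => rfl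
  have hcoef : fourierCoeff φ = 0 := by
    funext n
    rw [fourierCoeff_eq_intervalIntegral _ n (-π), show -π + 2 * π = π by ring]
    have h1 := congrArg l (h n)
    rw [proj_apply, map_smul, ← ContinuousLinearMap.intervalIntegral_comp_comm, map_zero] at h1
    · rcases smul_eq_zero.1 h1 with h2 | h2
      · simp [pi_ne_zero] at h2
      · refine smul_eq_zero_of_right _ (Eq.trans ?_ h2)
        refine intervalIntegral.integral_congr fun s _ => ?_
        simp only [hφ, map_smul, fourier_coe_apply]
        congr 2
        have hpi : (π : ℂ) ≠ 0 := by exact_mod_cast pi_ne_zero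
        push_cast
        field_simp
    · exact ((G.strongCont_exp n).1 x).intervalIntegrable _ _
  have h2 := has_pointwise_sum_fourier_series_of_summable (f := φ)
    (by rw [hcoef]; exact summable_zero) ((0 : ℝ) : AddCircle (2 * π))
  rw [hcoef, hφ, G.op_zero] at h2
  simp only [Pi.zero_apply, zero_smul] at h2
  exact (h2.unique hasSum_zero)

lemma ext_proj {x y : X} (h : ∀ m, G.proj m x = G.proj m y) : x = y :=
  sub_eq_zero.1 (G.eq_zero_of_proj_eq_zero _ fun m => by rw [map_sub, h, sub_self])

/-- `A` acts as the Fourier multiplier with symbol `a`. -/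
def HasSymbol (A : X →L[ℂ] X) (a : ℤ → ℂ) : Prop := ∀ m x, G.proj m (A x) = a m • G.proj m x

variable {G} {A B : X →L[ℂ] X} {a b : ℤ → ℂ}

namespace HasSymbol

lemma ext (hA : G.HasSymbol A a) (hB : G.HasSymbol B a) : A = B :=
  ContinuousLinearMap.ext fun x => G.ext_proj fun m => by rw [hA, hB]

lemma comp (hA : G.HasSymbol A a) (hB : G.HasSymbol B b) : G.HasSymbol (A * B) (a * b) :=
  fun m x => by
    show G.proj m (A (B x)) = _
    rw [hA, hB, smul_smul]; rfl

lemma smul (c : ℂ) (hA : G.HasSymbol A a) : G.HasSymbol (c • A) (c • a) :=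
  fun m x => by
    rw [smul_apply, map_smul, hA, smul_smul]; rfl

lemma sub (hA : G.HasSymbol A a) (hB : G.HasSymbol B b) : G.HasSymbol (A - B) (a - b) :=
  fun m x => by
    rw [sub_apply, map_sub, hA, hB, Pi.sub_apply, sub_smul]

lemma congr (hA : G.HasSymbol A a) (h : ∀ m, a m = b m) : G.HasSymbol A b := by
  rwa [← funext h]

lemma sum {ι : Type*} (s : Finset ι) {A : ι → X →L[ℂ] X} {a : ι → ℤ → ℂ}
    (h : ∀ i ∈ s, G.HasSymbol (A i) (a i)) :
    G.HasSymbol (∑ i ∈ s, A i) (fun m => ∑ i ∈ s, a i m) := fun m x => by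
  rw [sum_apply, map_sum, Finset.sum_smul]
  exact Finset.sum_congr rfl fun i hi => h i hi m x

lemma op (t : ℝ) : G.HasSymbol (G.op t) fun m => Complex.exp (Complex.I * m * t) :=
  fun m x => G.proj_op m t x

lemma proj (n : ℤ) : G.HasSymbol (G.proj n) fun m => if m = n then 1 else 0 := fun m x => by
  rw [proj_proj]; split_ifs with h <;> simp [h]

lemma intOp {W : ℝ → X →L[ℂ] X} (hW : StrongCont W) {w : ℝ → ℤ → ℂ}
    (h : ∀ s, G.HasSymbol (W s) (w s)) (a b : ℝ) :
    G.HasSymbol (intOp W hW a b) fun m => ∫ s in a..b, w s m := fun m x => by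
  rw [intOp_apply, ← ContinuousLinearMap.intervalIntegral_comp_comm]
  · simp only [h _ m x]
    rw [intervalIntegral.integral_smul_const]
  · exact (hW.1 x).intervalIntegrable _ _

lemma commute (hA : G.HasSymbol A a) (hB : ∀ s x, B (G.op s x) = G.op s (B x)) (x : X) :
    A (B x) = B (A x) := G.ext_proj fun m => by
  rw [hA, ← G.commute_proj hB, ← G.commute_proj hB, hA, map_smul]

lemma commute_op (hA : G.HasSymbol A a) (s : ℝ) (x : X) : A (G.op s x) = G.op s (A x) :=
  hA.commute (fun s x => by rw [← G.op_add, ← G.op_add, add_comm]) x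

end HasSymbol
end PeriodicGroup

lemma integral_norm_sq_trigPoly (S : Finset ℤ) (a : ℤ → ℂ) :
    (∫ s in (-π)..π, ‖∑ m ∈ S, a m * Complex.exp (-(Complex.I * m * s))‖ ^ 2) =
      2 * π * ∑ m ∈ S, ‖a m‖ ^ 2 := by
  have h1 : ∀ s : ℝ, ((‖∑ m ∈ S, a m * Complex.exp (-(Complex.I * m * s))‖ ^ 2 : ℝ) : ℂ) =
      ∑ m ∈ S, ∑ n ∈ S, a m * starRingEnd ℂ (a n) *
        Complex.exp (Complex.I * (n - m : ℤ) * s) := fun s => by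
    rw [Complex.ofReal_pow, ← Complex.mul_conj', map_sum, Finset.sum_mul_sum]
    refine Finset.sum_congr rfl fun m _ => Finset.sum_congr rfl fun n _ => ?_
    rw [map_mul, ← Complex.exp_conj, mul_mul_mul_comm, ← Complex.exp_add]
    congr 2
    simp only [map_neg, map_mul, Complex.conj_I, Complex.conj_ofReal, map_intCast]
    push_cast
    ring
  have h2 : (((∫ s in (-π)..π, ‖∑ m ∈ S, a m * Complex.exp (-(Complex.I * m * s))‖ ^ 2) : ℝ) : ℂ) =
      ((2 * π * ∑ m ∈ S, ‖a m‖ ^ 2 : ℝ) : ℂ) := by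
    rw [← intervalIntegral.integral_ofReal]
    simp only [h1]
    rw [intervalIntegral.integral_finsetSum
      fun m _ => Continuous.intervalIntegrable (by fun_prop) _ _]
    rw [Complex.ofReal_mul, Complex.ofReal_sum, Finset.mul_sum]
    refine Finset.sum_congr rfl fun m hm => ?_
    rw [intervalIntegral.integral_finsetSum
      fun n _ => Continuous.intervalIntegrable (by fun_prop) _ _]
    rw [Finset.sum_eq_single m]
    · rw [intervalIntegral.integral_const_mul, integral_exp_int, sub_self, if_pos rfl,
        Complex.mul_conj']
      push_cast
      ring
    · intro n _ hn
      rw [intervalIntegral.integral_const_mul, integral_exp_int, if_neg (by omega), mul_zero]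
    · exact fun h => absurd hm h
  exact_mod_cast h2

lemma abs_half_le_norm_exp_sub_one {s : ℝ} (hs : |s| ≤ π) :
    |s| / 2 ≤ ‖Complex.exp (-(Complex.I * s)) - 1‖ := by
  have h0 : -(Complex.I * s) = Complex.I * ((-s : ℝ) : ℂ) := by push_cast; ring
  rw [h0, Complex.norm_exp_I_mul_ofReal_sub_one, norm_mul, Real.norm_eq_abs, Real.norm_eq_abs,
    neg_div, Real.sin_neg, abs_neg, abs_two]
  wlog h : 0 ≤ s generalizing s
  · have := this (s := -s) (by rwa [abs_neg]) (by push_cast; ring) (by linarith)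
    rwa [abs_neg, neg_div, Real.sin_neg, abs_neg] at this
  rw [abs_of_nonneg h] at *
  have h1 := Real.mul_le_sin (x := s / 2) (by linarith) (by linarith)
  have h2 : (1 : ℝ) / 4 ≤ 2 / π / 2 := by
    rw [div_div, div_le_div_iff₀ (by norm_num) (by positivity)]
    linarith [Real.pi_le_four]
  have h3 : 2 / π * (s / 2) = 2 / π / 2 * s := by ring
  have h4 : 1 / 4 * s ≤ 2 / π / 2 * s := mul_le_mul_of_nonneg_right h2 h
  have := le_abs_self (sin (s / 2))
  linarith

lemma integral_inv_one_add_sq_le {N : ℝ} (hN : 0 < N) :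
    (∫ s in (-π)..π, (1 + N ^ 2 * ‖Complex.exp (-(Complex.I * s)) - 1‖ ^ 2)⁻¹) ≤ 2 * π / N := by
  have hpi := pi_pos
  calc (∫ s in (-π)..π, (1 + N ^ 2 * ‖Complex.exp (-(Complex.I * s)) - 1‖ ^ 2)⁻¹)
      ≤ ∫ s in (-π)..π, (1 + (N / 2 * s) ^ 2)⁻¹ := by
        refine intervalIntegral.integral_mono_on (by linarith) ?_ ?_ fun s hs => ?_
        · refine Continuous.intervalIntegrable ?_ _ _
          exact Continuous.inv₀ (by fun_prop) fun s => by positivity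
        · refine Continuous.intervalIntegrable ?_ _ _
          exact Continuous.inv₀ (by fun_prop) fun s => by positivity
        · have h := abs_half_le_norm_exp_sub_one (abs_le.2 hs)
          have h2 := pow_le_pow_left₀ (by positivity) h 2
          rw [div_pow, sq_abs] at h2
          gcongr
          nlinarith [sq_nonneg N]
    _ = (N / 2)⁻¹ * (arctan (N / 2 * π) - arctan (N / 2 * -π)) := by
        rw [intervalIntegral.integral_comp_mul_left (fun s => (1 + s ^ 2)⁻¹) (by positivity),
          integral_inv_one_add_sq, smul_eq_mul]
    _ ≤ (N / 2)⁻¹ * π := by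
        gcongr
        linarith [arctan_lt_pi_div_two (N / 2 * π), neg_pi_div_two_lt_arctan (N / 2 * -π)]
    _ = 2 * π / N := by field_simp

/-- Kernel estimate: a Lipschitz finitely supported symbol has an integrable kernel. -/
lemma integral_norm_trigPoly_le {N : ℕ} (hN : 1 ≤ N) {A : ℝ} (hA : 0 < A) {a : ℤ → ℂ}
    (h1 : ∀ m, ‖a m‖ ≤ A) (h2 : ∀ m, ‖a (m + 1) - a m‖ ≤ A / N)
    (h3 : ∀ m : ℤ, 4 * (N : ℤ) < |m| → a m = 0) :
    (∫ s in (-π)..π,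
      ‖∑ m ∈ Finset.Icc (-(4 * N : ℤ)) (4 * N), a m * Complex.exp (-(Complex.I * m * s))‖) ≤
      2 * π * (10 * A) := by
  have hpi := pi_pos
  have hN0 : (0 : ℝ) < N := by exact_mod_cast hN
  have hN1 : (1 : ℝ) ≤ N := by exact_mod_cast hN
  set K : ℝ → ℂ := fun s =>
    ∑ m ∈ Finset.Icc (-(4 * N : ℤ)) (4 * N), a m * Complex.exp (-(Complex.I * m * s)) with hK
  have hKc : Continuous K := by fun_prop
  set w : ℝ → ℝ := fun s => 1 + (N : ℝ) ^ 2 * ‖Complex.exp (-(Complex.I * s)) - 1‖ ^ 2 with hw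
  have hw0 : ∀ s, 0 < w s := fun s => by positivity
  have hwc : Continuous w := by fun_prop
  have hshift : ∀ s : ℝ, (Complex.exp (-(Complex.I * s)) - 1) * K s =
      ∑ m ∈ Finset.Icc (-(4 * N : ℤ)) (4 * N + 1),
        (a (m - 1) - a m) * Complex.exp (-(Complex.I * m * s)) := fun s => by
    simp only [sub_mul, Finset.sum_sub_distrib, one_mul]
    congr 1
    · rw [hK, Finset.mul_sum]
      have e : ∀ m : ℤ, Complex.exp (-(Complex.I * s)) * (a m * Complex.exp (-(Complex.I * m * s)))
          = a (m + 1 - 1) * Complex.exp (-(Complex.I * (m + 1 : ℤ) * s)) := fun m => by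
        rw [add_sub_cancel_right, mul_left_comm, ← Complex.exp_add]
        congr 2; push_cast; ring
      rw [Finset.sum_congr rfl fun m _ => e m]
      rw [← Finset.sum_image (f := fun m : ℤ => a (m - 1) * Complex.exp (-(Complex.I * m * s)))
        (g := fun m : ℤ => m + 1) (s := Finset.Icc (-(4 * N : ℤ)) (4 * N))
        (by intro x _ y _ h; simpa using h)]
      refine Finset.sum_subset ?_ ?_
      · intro m hm
        simp only [Finset.mem_image, Finset.mem_Icc] at hm ⊢
        omega
      · intro m hm hm'
        have : m = -(4 * N : ℤ) := by
          by_contra hne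
          refine hm' ?_
          simp only [Finset.mem_image, Finset.mem_Icc] at hm ⊢
          exact ⟨m - 1, by omega, by omega⟩
        rw [h3 (m - 1) (by rw [this, abs_of_nonpos] <;> omega), zero_mul]
    · refine Finset.sum_subset (Finset.Icc_subset_Icc_right (by omega)) ?_
      intro m hm hm'
      rw [h3 m ?_, zero_mul]
      simp only [Finset.mem_Icc] at hm hm'
      rw [abs_of_nonneg] <;> omega
  have hI1 : (∫ s in (-π)..π, ‖K s‖ ^ 2) ≤ 2 * π * (9 * N * A ^ 2) := by
    rw [integral_norm_sq_trigPoly]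
    gcongr
    refine (Finset.sum_le_card_nsmul _ _ (A ^ 2) fun m _ =>
      pow_le_pow_left₀ (norm_nonneg _) (h1 m) 2).trans ?_
    rw [Int.card_Icc, nsmul_eq_mul]
    gcongr
    rw [show (4 * N + 1 - -(4 * N : ℤ)).toNat = 8 * N + 1 by omega]
    push_cast; linarith
  have hI2 : (∫ s in (-π)..π, ‖(Complex.exp (-(Complex.I * s)) - 1) * K s‖ ^ 2) ≤
      2 * π * (10 * N * (A / N) ^ 2) := by
    simp only [hshift]
    rw [integral_norm_sq_trigPoly]
    gcongr
    refine (Finset.sum_le_card_nsmul _ _ ((A / N) ^ 2) fun m _ => ?_).trans ?_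
    · refine pow_le_pow_left₀ (norm_nonneg _) ?_ 2
      have := h2 (m - 1)
      rwa [sub_add_cancel, norm_sub_rev] at this
    rw [Int.card_Icc, nsmul_eq_mul]
    gcongr
    rw [show (4 * N + 1 + 1 - -(4 * N : ℤ)).toNat = 8 * N + 2 by omega]
    push_cast; linarith
  have hpt : ∀ s, ‖K s‖ ≤ (2 * N * A)⁻¹ * (‖K s‖ ^ 2 +
      N ^ 2 * ‖(Complex.exp (-(Complex.I * s)) - 1) * K s‖ ^ 2) + (N * A / 2) * (w s)⁻¹ := by
    intro s
    have e : ‖K s‖ ^ 2 + N ^ 2 * ‖(Complex.exp (-(Complex.I * s)) - 1) * K s‖ ^ 2 =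
        w s * ‖K s‖ ^ 2 := by rw [norm_mul, mul_pow]; simp only [hw]; ring
    rw [e]
    have hNA : 0 < N * A := by positivity
    have : 0 ≤ (w s * ‖K s‖ - N * A) ^ 2 / (2 * (N * A) * w s) := by
      have := hw0 s; positivity
    have e2 : (2 * N * A)⁻¹ * (w s * ‖K s‖ ^ 2) + (N * A / 2) * (w s)⁻¹ - ‖K s‖ =
        (w s * ‖K s‖ - N * A) ^ 2 / (2 * (N * A) * w s) := by
      have := (hw0 s).ne'
      field_simp
      ring
    linarith
  have hwi : IntervalIntegrable (fun s => (w s)⁻¹) volume (-π) π :=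
    (hwc.inv₀ fun s => (hw0 s).ne').intervalIntegrable _ _
  have hc1 : Continuous fun s => ‖K s‖ ^ 2 := by fun_prop
  have hc2 : Continuous fun s : ℝ => (N : ℝ) ^ 2 * ‖(Complex.exp
      (-(Complex.I * s)) - 1) * K s‖ ^ 2 := by
    fun_prop
  calc (∫ s in (-π)..π, ‖K s‖)
      ≤ ∫ s in (-π)..π, ((2 * N * A)⁻¹ * (‖K s‖ ^ 2 +
        N ^ 2 * ‖(Complex.exp (-(Complex.I * s)) - 1) * K s‖ ^ 2) + (N * A / 2) * (w s)⁻¹) := by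
        refine intervalIntegral.integral_mono_on (by linarith)
          (hKc.norm.intervalIntegrable _ _) ?_ fun s _ => hpt s
        exact ((continuous_const.mul (hc1.add hc2)).intervalIntegrable _ _).add (hwi.const_mul _)
    _ = (2 * N * A)⁻¹ * ((∫ s in (-π)..π, ‖K s‖ ^ 2) +
        N ^ 2 * ∫ s in (-π)..π, ‖(Complex.exp (-(Complex.I * s)) - 1) * K s‖ ^ 2) +
        (N * A / 2) * ∫ s in (-π)..π, (w s)⁻¹ := by
        rw [intervalIntegral.integral_add
          (Continuous.intervalIntegrable (by fun_prop) _ _) (hwi.const_mul _),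
          intervalIntegral.integral_const_mul, intervalIntegral.integral_const_mul,
          intervalIntegral.integral_add (hc1.intervalIntegrable _ _) (hc2.intervalIntegrable _ _),
          intervalIntegral.integral_const_mul]
    _ ≤ (2 * N * A)⁻¹ * (2 * π * (9 * N * A ^ 2) + N ^ 2 * (2 * π * (10 * N * (A / N) ^ 2))) +
        (N * A / 2) * (2 * π / N) := by
        gcongr
        exact integral_inv_one_add_sq_le hN0
    _ = 2 * π * (10 * A) := by field_simp; ring

/-- A bounded Lipschitz symbol supported in `[-4, 4]`. -/
structure IsMult (Φ : ℝ → ℂ) (A : ℝ) : Prop where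
  bound : ∀ u, ‖Φ u‖ ≤ A
  lip : ∀ u v, ‖Φ u - Φ v‖ ≤ A * |u - v|
  supp : ∀ u, 4 < |u| → Φ u = 0

namespace PeriodicGroup

variable {X : Type*} [NormedAddCommGroup X] [NormedSpace ℂ X] (G : PeriodicGroup X)

/-- The Fourier multiplier with symbol `Φ(2^{-j} m)`, `|m| ≤ 4·2^j`. -/
def mult (Φ : ℝ → ℂ) (j : ℕ) : X →L[ℂ] X :=
  ∑ m ∈ Finset.Icc (-(4 * (2 ^ j : ℕ) : ℤ)) (4 * (2 ^ j : ℕ)), Φ (m / 2 ^ j) • G.proj m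

lemma supp_of_isMult {Φ : ℝ → ℂ} {A : ℝ} (h : IsMult Φ A) (j : ℕ) (m : ℤ)
    (hm : 4 * ((2 ^ j : ℕ) : ℤ) < |m|) : Φ (m / 2 ^ j) = 0 := by
  refine h.supp _ ?_
  have h2 : (0 : ℝ) < 2 ^ j := by positivity
  rw [abs_div, abs_of_pos h2, lt_div_iff₀ h2]
  have : ((4 * ((2 ^ j : ℕ) : ℤ) : ℤ) : ℝ) < ((|m| : ℤ) : ℝ) := Int.cast_lt.2 hm
  push_cast at this
  exact this

variable [CompleteSpace X]

lemma hasSymbol_mult {Φ : ℝ → ℂ} {A : ℝ} (h : IsMult Φ A) (j : ℕ) :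
    G.HasSymbol (G.mult Φ j) fun m => Φ (m / 2 ^ j) := by
  refine (HasSymbol.sum _ fun n _ => (HasSymbol.proj n).smul _).congr fun m => ?_
  simp only [Pi.smul_apply, smul_eq_mul, mul_ite, mul_one, mul_zero, Finset.sum_ite_eq]
  split_ifs with hm
  · rfl
  · refine (supp_of_isMult h j m ?_).symm
    simp only [Finset.mem_Icc] at hm
    rw [lt_abs]
    omega

lemma norm_mult_le {Φ : ℝ → ℂ} {A : ℝ} (h : IsMult Φ A) (j : ℕ) : ‖G.mult Φ j‖ ≤ 10 * A := by
  have hA0 : 0 ≤ A := (norm_nonneg _).trans (h.bound 0)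
  refine le_of_forall_gt_imp_ge_of_dense fun A' hA' => ?_
  obtain ⟨B, rfl⟩ : ∃ B, A' = 10 * B := ⟨A' / 10, by ring⟩
  have hB : A < B := by linarith
  refine ContinuousLinearMap.opNorm_le_bound _ (by linarith) fun x => ?_
  have key := integral_norm_trigPoly_le (N := 2 ^ j) (A := B) Nat.one_le_two_pow (by linarith)
    (a := fun m => Φ (m / 2 ^ j)) (fun m => (h.bound _).trans hB.le)
    (fun m => (h.lip _ _).trans ?_) (supp_of_isMult h j)
  · have e : G.mult Φ j x = (2 * (π : ℂ))⁻¹ • ∫ s in (-π)..π,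
        (∑ m ∈ Finset.Icc (-(4 * (2 ^ j : ℕ) : ℤ)) (4 * (2 ^ j : ℕ)),
          Φ (m / 2 ^ j) * Complex.exp (-(Complex.I * m * s))) • G.op s x := by
      simp only [Finset.sum_smul]
      rw [intervalIntegral.integral_finsetSum]
      · simp only [mul_smul, intervalIntegral.integral_smul]
        rw [Finset.smul_sum, mult, sum_apply]
        refine Finset.sum_congr rfl fun m _ => ?_
        rw [smul_apply, proj_apply, smul_comm]
      · intro m _
        exact Continuous.intervalIntegrable
          (Continuous.smul (by fun_prop) (G.continuous_op x)) _ _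
    rw [e, norm_smul]
    have hn : ‖(2 * (π : ℂ))⁻¹‖ = (2 * π)⁻¹ := by
      simp [abs_of_pos pi_pos]
    rw [hn]
    calc _ ≤ (2 * π)⁻¹ * ∫ s in (-π)..π,
        ‖(∑ m ∈ Finset.Icc (-(4 * (2 ^ j : ℕ) : ℤ)) (4 * (2 ^ j : ℕ)),
          Φ (m / 2 ^ j) * Complex.exp (-(Complex.I * m * s))) • G.op s x‖ := by
          gcongr
          exact intervalIntegral.norm_integral_le_integral_norm (by linarith [pi_pos])
      _ = (2 * π)⁻¹ * ((∫ s in (-π)..π,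
        ‖∑ m ∈ Finset.Icc (-(4 * (2 ^ j : ℕ) : ℤ)) (4 * (2 ^ j : ℕ)),
          Φ (m / 2 ^ j) * Complex.exp (-(Complex.I * m * s))‖) * ‖x‖) := by
          simp only [norm_smul, G.norm_op]
          rw [intervalIntegral.integral_mul_const]
      _ ≤ (2 * π)⁻¹ * ((2 * π * (10 * B)) * ‖x‖) := by
          gcongr
      _ = 10 * B * ‖x‖ := by
          have := pi_pos
          field_simp
  · have h2 : (0 : ℝ) < 2 ^ j := by positivity
    rw [show (((m + 1 : ℤ) : ℝ) / 2 ^ j - m / 2 ^ j) = 1 / 2 ^ j by push_cast; ring,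
      abs_of_pos (by positivity)]
    push_cast
    rw [mul_one_div]
    gcongr

end PeriodicGroup

/-- The piecewise linear bump equal to `1` on `[-1, 1]` and to `0` off `[-2, 2]`. -/
def bump (u : ℝ) : ℝ := max 0 (min 1 (2 - |u|))

lemma bump_nonneg (u : ℝ) : 0 ≤ bump u := le_max_left _ _

lemma bump_le_one (u : ℝ) : bump u ≤ 1 := max_le zero_le_one (min_le_left _ _)

lemma bump_eq_one {u : ℝ} (h : |u| ≤ 1) : bump u = 1 := by
  rw [bump, min_eq_left (by linarith), max_eq_right zero_le_one]

lemma bump_eq_zero {u : ℝ} (h : 2 ≤ |u|) : bump u = 0 := by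
  rw [bump, max_eq_left]
  exact (min_le_right _ _).trans (by linarith)

lemma abs_bump_sub_le (u v : ℝ) : |bump u - bump v| ≤ |u - v| := by
  rw [bump, bump]
  refine (abs_max_sub_max_le_max _ _ _ _).trans (max_le (by simp) ?_)
  refine (abs_min_sub_min_le_max _ _ _ _).trans (max_le (by simp) ?_)
  rw [show 2 - |u| - (2 - |v|) = -(|u| - |v|) by ring, abs_neg]
  exact abs_abs_sub_abs_le u v

/-- Lipschitz cutoff functions supported in the annulus `1/4 ≤ |u| ≤ 4`. -/
structure IsCutoff (ψ : ℝ → ℝ) : Prop where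
  bound : ∀ u, |ψ u| ≤ 1
  lip : ∀ u v, |ψ u - ψ v| ≤ 5 * |u - v|
  supp : ∀ u, ¬ (1 / 4 ≤ |u| ∧ |u| ≤ 4) → ψ u = 0

/-- The dyadic block cutoff. -/
def cutQ (u : ℝ) : ℝ := bump u - bump (2 * u)

/-- A fattened block cutoff, equal to `1` on the support of `cutQ`. -/
def cutF (u : ℝ) : ℝ := bump (u / 2) - bump (4 * u)

lemma cutQ_eq_zero {u : ℝ} (h : ¬ (1 / 2 ≤ |u| ∧ |u| ≤ 2)) : cutQ u = 0 := by
  rw [cutQ]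
  rcases not_and_or.1 h with h | h <;> rw [not_le] at h
  · rw [bump_eq_one (by linarith), bump_eq_one (by rw [abs_mul, abs_two]; linarith), sub_self]
  · rw [bump_eq_zero (by linarith), bump_eq_zero (by rw [abs_mul, abs_two]; linarith), sub_self]

lemma isCutoff_cutQ : IsCutoff cutQ where
  bound u := abs_le.2 ⟨by linarith [bump_nonneg u, bump_le_one (2 * u), cutQ.eq_1 u],
    by linarith [bump_le_one u, bump_nonneg (2 * u), cutQ.eq_1 u]⟩
  lip u v := by
    have h1 := abs_bump_sub_le u v
    have h2 := abs_bump_sub_le (2 * u) (2 * v)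
    rw [← mul_sub, abs_mul, abs_two] at h2
    have h3 := abs_sub (bump u - bump v) (bump (2 * u) - bump (2 * v))
    rw [cutQ, cutQ, show bump u - bump (2 * u) - (bump v - bump (2 * v)) =
      bump u - bump v - (bump (2 * u) - bump (2 * v)) by ring]
    linarith [abs_nonneg (u - v)]
  supp u h := cutQ_eq_zero fun h' => h ⟨by linarith, by linarith⟩

lemma isCutoff_cutF : IsCutoff cutF where
  bound u := abs_le.2 ⟨by linarith [bump_nonneg (u / 2), bump_le_one (4 * u), cutF.eq_1 u],
    by linarith [bump_le_one (u / 2), bump_nonneg (4 * u), cutF.eq_1 u]⟩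
  lip u v := by
    have h1 := abs_bump_sub_le (u / 2) (v / 2)
    have h2 := abs_bump_sub_le (4 * u) (4 * v)
    rw [← mul_sub, abs_mul, abs_of_pos (by norm_num : (0 : ℝ) < 4)] at h2
    rw [← sub_div, abs_div, abs_two] at h1
    have h3 := abs_sub (bump (u / 2) - bump (v / 2)) (bump (4 * u) - bump (4 * v))
    rw [cutF, cutF, show bump (u / 2) - bump (4 * u) - (bump (v / 2) - bump (4 * v)) =
      bump (u / 2) - bump (v / 2) - (bump (4 * u) - bump (4 * v)) by ring]
    linarith [abs_nonneg (u - v)]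
  supp u h := by
    rw [cutF]
    rcases not_and_or.1 h with h | h <;> rw [not_le] at h
    · rw [bump_eq_one (by rw [abs_div, abs_two]; linarith),
        bump_eq_one (by rw [abs_mul, abs_of_pos (by norm_num : (0 : ℝ) < 4)]; linarith), sub_self]
    · rw [bump_eq_zero (by rw [abs_div, abs_two]; linarith),
        bump_eq_zero (by rw [abs_mul, abs_of_pos (by norm_num : (0 : ℝ) < 4)]; linarith), sub_self]

lemma cutF_eq_one {u : ℝ} (h : 1 / 2 ≤ |u|) (h' : |u| ≤ 2) : cutF u = 1 := by
  rw [cutF, bump_eq_one (by rw [abs_div, abs_two]; linarith),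
    bump_eq_zero (by rw [abs_mul, abs_of_pos (by norm_num : (0 : ℝ) < 4)]; linarith), sub_zero]

lemma cutF_mul_cutQ (u : ℝ) : cutF u * cutQ u = cutQ u := by
  by_cases h : 1 / 2 ≤ |u| ∧ |u| ≤ 2
  · rw [cutF_eq_one h.1 h.2, one_mul]
  · rw [cutQ_eq_zero h, mul_zero]

lemma cutQ_zero : cutQ 0 = 0 := cutQ_eq_zero (by norm_num)

lemma cutF_zero : cutF 0 = 0 := isCutoff_cutF.supp 0 (by norm_num)

lemma sum_cutQ {m : ℤ} (hm : m ≠ 0) (N : ℕ) :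
    ∑ j ∈ Finset.range (N + 1), cutQ (m / 2 ^ j) = bump (m / 2 ^ N) := by
  induction N with
  | zero =>
    have : (1 : ℝ) ≤ |(m : ℝ)| := by exact_mod_cast Int.one_le_abs hm
    rw [zero_add, Finset.sum_range_one, pow_zero, div_one, cutQ,
      bump_eq_zero (u := 2 * m) (by rw [abs_mul, abs_two]; linarith), sub_zero]
  | succ N ih =>
    rw [Finset.sum_range_succ, ih, cutQ,
      show 2 * ((m : ℝ) / 2 ^ (N + 1)) = m / 2 ^ N by rw [pow_succ]; field_simp]
    ring

lemma IsCutoff.isMult_mul {ψ : ℝ → ℝ} (hψ : IsCutoff ψ) {F : ℝ → ℂ} {A : ℝ}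
    (hb : ∀ u, 1 / 4 ≤ |u| → |u| ≤ 4 → ‖F u‖ ≤ A)
    (hl : ∀ u v, 1 / 4 ≤ |u| → |u| ≤ 4 → 1 / 4 ≤ |v| → |v| ≤ 4 → 0 < u * v →
      ‖F u - F v‖ ≤ A * |u - v|) :
    IsMult (fun u => ψ u * F u) (10 * A) := by
  have hA : 0 ≤ A := (norm_nonneg _).trans (hb 1 (by norm_num) (by norm_num))
  have hb1 : ∀ u, ‖(ψ u : ℂ) * F u‖ ≤ A := fun u => by
    by_cases h : 1 / 4 ≤ |u| ∧ |u| ≤ 4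
    · rw [norm_mul, Complex.norm_real, Real.norm_eq_abs]
      exact (mul_le_of_le_one_left (norm_nonneg _) (hψ.bound u)).trans (hb u h.1 h.2)
    · simpa [hψ.supp u h] using hA
  have hout : ∀ u v, ψ v = 0 → ‖(ψ u : ℂ) * F u‖ ≤ 5 * A * |u - v| := fun u v hv => by
    by_cases h : 1 / 4 ≤ |u| ∧ |u| ≤ 4
    · have h1 := hψ.lip u v
      rw [hv, sub_zero] at h1
      rw [norm_mul, Complex.norm_real, Real.norm_eq_abs]
      calc |ψ u| * ‖F u‖ ≤ (5 * |u - v|) * A := by gcongr; exact hb u h.1 h.2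
        _ = _ := by ring
    · rw [hψ.supp u h]; simp; positivity
  refine ⟨fun u => (hb1 u).trans (by linarith), fun u v => ?_, fun u hu => ?_⟩
  · by_cases hv : 1 / 4 ≤ |v| ∧ |v| ≤ 4
    · by_cases hu : 1 / 4 ≤ |u| ∧ |u| ≤ 4
      · by_cases huv : 0 < u * v
        · have e : (ψ u : ℂ) * F u - ψ v * F v =
              ψ u * (F u - F v) + ((ψ u - ψ v : ℝ) : ℂ) * F v := by push_cast; ring
          rw [e]
          refine (norm_add_le _ _).trans ?_
          rw [norm_mul, norm_mul, Complex.norm_real, Complex.norm_real, Real.norm_eq_abs,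
            Real.norm_eq_abs]
          calc |ψ u| * ‖F u - F v‖ + |ψ u - ψ v| * ‖F v‖
              ≤ 1 * (A * |u - v|) + (5 * |u - v|) * A := by
                gcongr
                · exact hψ.bound u
                · exact hl u v hu.1 hu.2 hv.1 hv.2 huv
                · exact hψ.lip u v
                · exact hb v hv.1 hv.2
            _ ≤ 10 * A * |u - v| := by nlinarith [mul_nonneg hA (abs_nonneg (u - v))]
        · have h1 : 1 / 2 ≤ |u - v| := by
            rw [not_lt] at huv
            rcases le_total 0 u with h | h <;> rcases le_total 0 v with h' | h'
            all_goals
              simp only [abs_of_nonneg, abs_of_nonpos, h, h'] at hu hv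
              first
                | (exfalso; nlinarith [hu.1, hv.1])
                | (rw [le_abs]; first | (left; linarith) | (right; linarith))
          refine (norm_sub_le _ _).trans ?_
          nlinarith [hb1 u, hb1 v]
      · rw [hψ.supp u hu]
        have := hout v u (hψ.supp u hu)
        rw [abs_sub_comm] at this
        simp only [Complex.ofReal_zero, zero_mul, zero_sub, norm_neg]
        nlinarith [mul_nonneg hA (abs_nonneg (u - v))]
    · have := hout u v (hψ.supp v hv)
      simp only [hψ.supp v hv, Complex.ofReal_zero, zero_mul, sub_zero]
      nlinarith [mul_nonneg hA (abs_nonneg (u - v))]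
  · simp only [hψ.supp u (fun h => by linarith [h.2]), Complex.ofReal_zero, zero_mul]

lemma IsCutoff.isMult {ψ : ℝ → ℝ} (hψ : IsCutoff ψ) : IsMult (fun u => ψ u) 10 := by
  have := hψ.isMult_mul (F := fun _ => 1) (A := 1) (by simp) (by intros; simp)
  simpa using this

lemma rpow_le_add_of_mem {c B x : ℝ} (hc : 0 < c) (h1 : c ≤ x) (h2 : x ≤ B) (γ : ℝ) :
    x ^ γ ≤ c ^ γ + B ^ γ := by
  have hx : 0 < x := hc.trans_le h1
  have hB : 0 < B := hx.trans_le h2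
  rcases le_total 0 γ with h | h
  · linarith [Real.rpow_le_rpow hx.le h2 h, Real.rpow_pos_of_pos hc γ]
  · linarith [Real.rpow_le_rpow_of_nonpos hc h1 h, Real.rpow_pos_of_pos hB γ]

lemma norm_cpow_ofReal {z : ℂ} (hz : z ≠ 0) (γ : ℝ) : ‖z ^ (γ : ℂ)‖ = ‖z‖ ^ γ := by
  rw [Complex.norm_cpow_of_ne_zero hz]; simp

/-- Powers of a curve that stays in a compact part of the slit plane give bounded multipliers. -/
lemma exists_isMult_cpow (γ : ℝ) {c B D : ℝ} (hc : 0 < c) (hB : c ≤ B) (hD : 0 ≤ D) :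
    ∃ A : ℝ, 0 < A ∧ ∀ (ψ : ℝ → ℝ) (g g' : ℝ → ℂ), IsCutoff ψ →
      (∀ u, 1 / 4 ≤ |u| → |u| ≤ 4 → HasDerivAt g (g' u) u ∧ g u ∈ Complex.slitPlane ∧
        c ≤ ‖g u‖ ∧ ‖g u‖ ≤ B ∧ ‖g' u‖ ≤ D) →
      IsMult (fun u => ψ u * g u ^ (γ : ℂ)) A := by
  have hB0 : 0 < B := hc.trans_le hB
  set A := c ^ γ + B ^ γ + |γ| * (c ^ (γ - 1) + B ^ (γ - 1)) * D with hA
  have h1 : 0 < c ^ γ + B ^ γ := by positivity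
  have h2 : 0 ≤ |γ| * (c ^ (γ - 1) + B ^ (γ - 1)) * D := by positivity
  refine ⟨10 * A, by linarith, fun ψ g g' hψ hg => hψ.isMult_mul (fun u hu hu' => ?_) ?_⟩
  · obtain ⟨-, hs, hcu, hBu, -⟩ := hg u hu hu'
    rw [norm_cpow_ofReal (Complex.slitPlane_ne_zero hs)]
    linarith [rpow_le_add_of_mem hc hcu hBu γ]
  · have key : ∀ s : Set ℝ, Convex ℝ s → (∀ u ∈ s, 1 / 4 ≤ |u| ∧ |u| ≤ 4) → ∀ u ∈ s, ∀ v ∈ s,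
        ‖g u ^ (γ : ℂ) - g v ^ (γ : ℂ)‖ ≤ A * |u - v| := by
      intro s hs hmem u hu v hv
      have := hs.norm_image_sub_le_of_norm_hasDerivWithin_le
        (f := fun u => g u ^ (γ : ℂ)) (f' := fun u => g' u • (γ * g u ^ ((γ : ℂ) - 1))) (C := A)
        (fun x hx => ?_) (fun x hx => ?_) hv hu
      · rwa [Real.norm_eq_abs] at this
      · obtain ⟨hd, hsl, -⟩ := hg x (hmem x hx).1 (hmem x hx).2
        exact (((Complex.hasStrictDerivAt_cpow_const hsl).hasDerivAt).scomp x hd).hasDerivWithinAt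
      · obtain ⟨-, hsl, hcu, hBu, hDu⟩ := hg x (hmem x hx).1 (hmem x hx).2
        rw [norm_smul, norm_mul, show (γ : ℂ) - 1 = ((γ - 1 : ℝ) : ℂ) by push_cast; ring,
          norm_cpow_ofReal (Complex.slitPlane_ne_zero hsl), Complex.norm_real, Real.norm_eq_abs]
        have h3 := rpow_le_add_of_mem hc hcu hBu (γ - 1)
        calc ‖g' x‖ * (|γ| * ‖g x‖ ^ (γ - 1)) ≤ D * (|γ| * (c ^ (γ - 1) + B ^ (γ - 1))) := by
              gcongr
          _ ≤ A := by rw [hA]; linarith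
    intro u v hu hu' hv hv' huv
    rcases pos_and_pos_or_neg_and_neg_of_mul_pos huv with ⟨h, h'⟩ | ⟨h, h'⟩
    · rw [abs_of_pos h] at hu hu'
      rw [abs_of_pos h'] at hv hv'
      refine key (Set.Icc (1 / 4) 4) (convex_Icc _ _) (fun x hx => ?_) u ⟨hu, hu'⟩ v ⟨hv, hv'⟩
      rw [abs_of_pos (by linarith [hx.1])]; exact hx
    · rw [abs_of_neg h] at hu hu'
      rw [abs_of_neg h'] at hv hv'
      refine key (Set.Icc (-4) (-(1 / 4))) (convex_Icc _ _) (fun x hx => ?_)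
        u ⟨by linarith, by linarith⟩ v ⟨by linarith, by linarith⟩
      rw [abs_of_neg (by linarith [hx.2])]
      exact ⟨by linarith [hx.2], by linarith [hx.1]⟩

/-- Symbols of fractional derivatives. -/
lemma exists_isMult_deriv (γ : ℝ) : ∃ A : ℝ, 0 < A ∧ ∀ ψ : ℝ → ℝ, IsCutoff ψ →
    IsMult (fun u => ψ u * (Complex.I * u) ^ (γ : ℂ)) A := by
  obtain ⟨A, hA, h⟩ := exists_isMult_cpow γ (c := 1 / 4) (B := 4) (D := 1) (by norm_num)
    (by norm_num) (by norm_num)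
  refine ⟨A, hA, fun ψ hψ => h ψ (fun u => Complex.I * u) (fun _ => Complex.I) hψ fun u hu hu' =>
      ?_⟩
  have hu0 : u ≠ 0 := by rintro rfl; norm_num at hu
  refine ⟨?_, ?_, ?_, ?_, by simp⟩
  · simpa using (Complex.ofRealCLM.hasDerivAt (x := u)).const_mul Complex.I
  · rw [Complex.mem_slitPlane_iff]; right; simpa using hu0
  · simpa using hu
  · simpa using hu'

/-- Symbols of rescaled fractional differences, uniformly in the step. -/
lemma exists_isMult_diff (γ : ℝ) : ∃ A : ℝ, 0 < A ∧ ∀ ψ : ℝ → ℝ, IsCutoff ψ →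
    ∀ η : ℝ, η ≠ 0 → |η| ≤ 1 / 4 → IsMult (fun u => ψ u *
      (((|η|⁻¹ : ℝ) : ℂ) * (1 - Complex.exp (-(Complex.I * (η * u : ℝ))))) ^ (γ : ℂ)) A := by
  obtain ⟨A, hA, h⟩ := exists_isMult_cpow γ (c := 1 / 8) (B := 4) (D := 1) (by norm_num)
    (by norm_num) (by norm_num)
  refine ⟨A, hA, fun ψ hψ η hη hη' => h ψ
    (fun u => ((|η|⁻¹ : ℝ) : ℂ) * (1 - Complex.exp (-(Complex.I * (η * u : ℝ)))))
    (fun u => ((|η|⁻¹ : ℝ) : ℂ) *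
      (Complex.exp (-(Complex.I * (η * u : ℝ))) * (Complex.I * η))) hψ fun u hu hu' => ?_⟩
  have hu0 : u ≠ 0 := by rintro rfl; norm_num at hu
  have hη0 : 0 < |η| := abs_pos.2 hη
  have hv : |η * u| ≤ 1 := by
    rw [abs_mul]; calc |η| * |u| ≤ 1 / 4 * 4 := by gcongr
      _ = 1 := by norm_num
  have hnorm : ‖((|η|⁻¹ : ℝ) : ℂ)‖ = |η|⁻¹ := by
    rw [Complex.norm_real, Real.norm_eq_abs, abs_of_pos (by positivity)]
  refine ⟨?_, ?_, ?_, ?_, ?_⟩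
  · refine HasDerivAt.const_mul _ ?_
    have h1 : HasDerivAt (fun u : ℝ => -(Complex.I * ((η * u : ℝ) : ℂ))) (-(Complex.I * η)) u := by
      have := ((Complex.ofRealCLM.hasDerivAt (x := u)).const_mul (-(Complex.I * η)))
      simp only [Complex.ofRealCLM_apply, Complex.ofReal_one, mul_one] at this
      refine this.congr_of_eventuallyEq (Filter.Eventually.of_forall fun x => ?_)
      simp only
      push_cast; ring
    have h2 := (h1.cexp).const_sub 1
    refine h2.congr_deriv ?_
    ring
  · rw [Complex.mem_slitPlane_iff]; left
    rw [Complex.re_ofReal_mul]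
    refine mul_pos (by positivity) ?_
    rw [show -(Complex.I * ((η * u : ℝ) : ℂ)) = ((-(η * u) : ℝ) : ℂ) * Complex.I by push_cast; ring,
      Complex.sub_re, Complex.exp_ofReal_mul_I_re, Complex.one_re, Real.cos_neg, sub_pos]
    obtain ⟨hv1, hv2⟩ := abs_le.1 hv
    refine lt_of_le_of_ne (Real.cos_le_one _) fun h => mul_ne_zero hη hu0 ?_
    exact (Real.cos_eq_one_iff_of_lt_of_lt (by linarith [Real.pi_gt_three])
      (by linarith [Real.pi_gt_three])).1 h
  · rw [norm_mul, hnorm, norm_sub_rev]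
    have h1 := abs_half_le_norm_exp_sub_one (s := η * u) (by linarith [Real.pi_gt_three])
    calc (1 : ℝ) / 8 ≤ |η|⁻¹ * (|η * u| / 2) := by
          rw [abs_mul]; field_simp; linarith
      _ ≤ _ := by gcongr
  · rw [norm_mul, hnorm, norm_sub_rev]
    have h1 := Real.norm_exp_I_mul_ofReal_sub_one_le (x := -(η * u))
    rw [show Complex.I * ((-(η * u) : ℝ) : ℂ) = -(Complex.I * ((η * u : ℝ) : ℂ)) by push_cast; ring,
      Real.norm_eq_abs, abs_neg, abs_mul] at h1
    calc |η|⁻¹ * _ ≤ |η|⁻¹ * (|η| * |u|) := by gcongr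
      _ = |u| := by field_simp
      _ ≤ 4 := hu'
  · rw [norm_mul, hnorm, norm_mul,
      show -(Complex.I * ((η * u : ℝ) : ℂ)) = ((-(η * u) : ℝ) : ℂ) * Complex.I by push_cast; ring,
      Complex.norm_exp_ofReal_mul_I, norm_mul, Complex.norm_I, Complex.norm_real, Real.norm_eq_abs,
      one_mul, one_mul, inv_mul_cancel₀ hη0.ne']

/-- The symbol used to invert the square of a difference. -/
lemma exists_isMult_inv_sin_sq : ∃ A : ℝ, 0 < A ∧
    IsMult (fun u => cutF u * ((Real.sin (π * u / 8) ^ 2 : ℝ) : ℂ)⁻¹) A := by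
  obtain ⟨A, hA, h⟩ := exists_isMult_cpow (-1) (c := 1 / 256) (B := 1) (D := 1) (by norm_num)
    (by norm_num) (by norm_num)
  refine ⟨A, hA, ?_⟩
  have := h cutF (fun u => ((Real.sin (π * u / 8) ^ 2 : ℝ) : ℂ))
    (fun u => ((2 * Real.sin (π * u / 8) * (Real.cos (π * u / 8) * (π / 8)) : ℝ) : ℂ))
    isCutoff_cutF fun u hu hu' => ?_
  · simpa [Complex.cpow_neg_one] using this
  have hsin : 1 / 16 ≤ |Real.sin (π * u / 8)| := by
    have h1 := Real.mul_abs_le_abs_sin (x := π * u / 8) (by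
      rw [abs_div, abs_mul, abs_of_pos pi_pos, abs_of_pos (by norm_num : (0 : ℝ) < 8)]
      nlinarith [pi_pos])
    rw [abs_div, abs_mul, abs_of_pos pi_pos, abs_of_pos (by norm_num : (0 : ℝ) < 8)] at h1
    have h2 : 2 / π * (π * |u| / 8) = |u| / 4 := by field_simp; ring
    linarith
  have hsq : 1 / 256 ≤ Real.sin (π * u / 8) ^ 2 := by
    rw [← sq_abs]; nlinarith
  have hn : ‖((Real.sin (π * u / 8) ^ 2 : ℝ) : ℂ)‖ = Real.sin (π * u / 8) ^ 2 := by
    rw [Complex.norm_real, Real.norm_eq_abs, abs_of_nonneg (sq_nonneg _)]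
  refine ⟨?_, ?_, by rwa [hn], by rw [hn]; exact Real.sin_sq_le_one _, ?_⟩
  · refine HasDerivAt.ofReal_comp ?_
    have h1 : HasDerivAt (fun u : ℝ => π * u / 8) (π / 8) u := by
      simpa using ((hasDerivAt_id u).const_mul π).div_const 8
    simpa using! (h1.sin).pow 2
  · rw [Complex.mem_slitPlane_iff]; left
    rw [Complex.ofReal_re]; linarith
  · rw [Complex.norm_real, Real.norm_eq_abs]
    have h1 : π / 8 ≤ 1 / 2 := by linarith [Real.pi_le_four]
    rw [abs_mul, abs_mul, abs_mul, abs_two, abs_of_pos (by positivity : 0 < π / 8)]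
    have h2 := Real.abs_sin_le_one (π * u / 8)
    have h3 := Real.abs_cos_le_one (π * u / 8)
    calc 2 * |Real.sin (π * u / 8)| * (|Real.cos (π * u / 8)| * (π / 8)) ≤
        2 * 1 * (1 * (1 / 2)) := by
          gcongr
      _ = 1 := by norm_num

lemma ENNReal.rpow_tsum_mul_le {ι : Type*} (w a : ι → ℝ≥0∞) {s : ℝ} (hs : 1 ≤ s) :
    (∑' j, w j * a j) ^ s ≤ (∑' j, w j) ^ (s - 1) * ∑' j, w j * a j ^ s := by
  have hs0 : 0 < s := by linarith
  have h : ∑' j, w j * a j ≤ (∑' j, w j) ^ (1 - s⁻¹) * (∑' j, w j * a j ^ s) ^ s⁻¹ := by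
    rw [ENNReal.tsum_eq_iSup_sum]
    refine iSup_le fun S => ?_
    refine (ENNReal.inner_le_weight_mul_Lp_of_nonneg S hs w a).trans ?_
    have : 0 ≤ 1 - s⁻¹ := by rw [sub_nonneg]; exact inv_le_one_of_one_le₀ hs
    gcongr <;> exact ENNReal.sum_le_tsum S
  calc (∑' j, w j * a j) ^ s
      ≤ ((∑' j, w j) ^ (1 - s⁻¹) * (∑' j, w j * a j ^ s) ^ s⁻¹) ^ s := by gcongr
    _ = _ := by
        rw [ENNReal.mul_rpow_of_nonneg _ _ hs0.le, ← ENNReal.rpow_mul, ← ENNReal.rpow_mul,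
          inv_mul_cancel₀ hs0.ne', ENNReal.rpow_one]
        congr 2
        field_simp

/-- Schur's test. -/
lemma ENNReal.tsum_rpow_tsum_mul_le {ι κ : Type*} (M : κ → ι → ℝ≥0∞) (a : ι → ℝ≥0∞) {s : ℝ}
    (hs : 1 ≤ s) {B : ℝ≥0∞} (hrow : ∀ k, ∑' j, M k j ≤ B) (hcol : ∀ j, ∑' k, M k j ≤ B) :
    ∑' k, (∑' j, M k j * a j) ^ s ≤ B ^ s * ∑' j, a j ^ s := by
  have hs1 : 0 ≤ s - 1 := by linarith
  calc ∑' k, (∑' j, M k j * a j) ^ s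
      ≤ ∑' k, B ^ (s - 1) * ∑' j, M k j * a j ^ s := by
        refine ENNReal.tsum_le_tsum fun k => (ENNReal.rpow_tsum_mul_le _ _ hs).trans ?_
        gcongr
        exact hrow k
    _ = B ^ (s - 1) * ∑' j, (∑' k, M k j) * a j ^ s := by
        rw [ENNReal.tsum_mul_left, ENNReal.tsum_comm]
        simp only [ENNReal.tsum_mul_right]
    _ ≤ B ^ (s - 1) * ∑' j, B * a j ^ s := by
        gcongr with j
        exact hcol j
    _ = B ^ s * ∑' j, a j ^ s := by
        rw [ENNReal.tsum_mul_left, ← mul_assoc]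
        congr 1
        nth_rw 2 [← ENNReal.rpow_one B]
        rw [← ENNReal.rpow_add_of_nonneg _ _ hs1 zero_le_one, sub_add_cancel]

/-- Schur's test for the geometric kernel `r^{|k-j|}`. -/
lemma exists_tsum_geom_schur {r : NNReal} (hr : r < 1) : ∃ B : NNReal, ∀ (s : ℝ), 1 ≤ s →
    ∀ a : ℕ → ℝ≥0∞,
    ∑' k : ℕ, (∑' j : ℕ, (r : ℝ≥0∞) ^ ((k : ℤ) - j).natAbs * a j) ^ s ≤
      (B : ℝ≥0∞) ^ s * ∑' j, a j ^ s := by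
  have hsum : Summable fun n : ℤ => r ^ n.natAbs := by
    rw [← NNReal.summable_coe]
    refine Summable.of_nat_of_neg ?_ ?_ <;>
    · simp only [Int.natAbs_neg, Int.natAbs_natCast, NNReal.coe_pow]
      exact summable_geometric_of_lt_one r.2 (by exact_mod_cast hr)
  refine ⟨∑' n : ℤ, r ^ n.natAbs, fun s hs a => ENNReal.tsum_rpow_tsum_mul_le _ a hs ?_ ?_⟩
  · intro k
    rw [ENNReal.coe_tsum hsum]
    simp only [ENNReal.coe_pow]
    exact ENNReal.tsum_comp_le_tsum_of_injective (f := fun j : ℕ => (k : ℤ) - j)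
      (by intro x y h; simpa using h) fun n : ℤ => (r : ℝ≥0∞) ^ n.natAbs
  · intro j
    rw [ENNReal.coe_tsum hsum]
    simp only [ENNReal.coe_pow]
    exact ENNReal.tsum_comp_le_tsum_of_injective (f := fun k : ℕ => (k : ℤ) - j)
      (by intro x y h; simpa using h) fun n : ℤ => (r : ℝ≥0∞) ^ n.natAbs

namespace PeriodicGroup

variable {X : Type*} [NormedAddCommGroup X] [NormedSpace ℂ X] (G : PeriodicGroup X)

lemma norm_intOp_op_apply_le (a b : ℝ) (x : X) : ‖intOp G.op G.strongCont a b x‖ ≤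
    |b - a| * ‖x‖ := by
  rw [intOp_apply]
  refine (intervalIntegral.norm_integral_le_of_norm_le_const
    fun s _ => (G.norm_op s x).le).trans_eq (mul_comm _ _)

/-- Averages over `[-π 2^{-k}, π 2^{-k}]`. -/
def avg (k : ℕ) : X →L[ℂ] X :=
  ((2 * (π / 2 ^ k) : ℝ) : ℂ)⁻¹ • intOp G.op G.strongCont (-(π / 2 ^ k)) (π / 2 ^ k)

/-- Martingale-type differences of the averages. -/
def mdiff (k : ℕ) : X →L[ℂ] X :=
  (2 : ℂ)⁻¹ • ((G.op (π / 2 ^ (k + 1)) - G.op (-(π / 2 ^ (k + 1)))) * G.avg (k + 1))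

lemma norm_avg_apply_le (k : ℕ) (x : X) : ‖G.avg k x‖ ≤ ‖x‖ := by
  have h : 0 < π / 2 ^ k := by positivity
  rw [avg, smul_apply, norm_smul, norm_inv, Complex.norm_real, Real.norm_eq_abs,
    abs_of_pos (by positivity)]
  have := G.norm_intOp_op_apply_le (-(π / 2 ^ k)) (π / 2 ^ k) x
  rw [sub_neg_eq_add, ← two_mul, abs_of_pos (by positivity)] at this
  rwa [inv_mul_le_iff₀ (by positivity)]

variable [CompleteSpace X]

lemma op_intOp (h a b : ℝ) (x : X) : G.op h (intOp G.op G.strongCont a b x) =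
    intOp G.op G.strongCont (a + h) (b + h) x := by
  rw [intOp_apply, intOp_apply, ← ContinuousLinearMap.intervalIntegral_comp_comm]
  · simp only [← G.op_add]
    rw [← intervalIntegral.integral_comp_add_right (fun s => G.op s x)]
    simp only [add_comm]
  · exact (G.continuous_op x).intervalIntegrable _ _

lemma two_smul_avg (k : ℕ) (x : X) : G.op (π / 2 ^ (k + 1)) (G.avg (k + 1) x) +
    G.op (-(π / 2 ^ (k + 1))) (G.avg (k + 1) x) = (2 : ℂ) • G.avg k x := by
  set h := π / 2 ^ (k + 1) with hh
  have h2 : π / 2 ^ k = 2 * h := by rw [hh, pow_succ]; field_simp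
  have h0 : h ≠ 0 := by rw [hh]; positivity
  simp only [avg, smul_apply, map_smul, op_intOp, ← hh]
  rw [← smul_add, h2, add_comm (intOp _ _ _ _ _)]
  simp only [intOp_apply]
  rw [add_neg_cancel, neg_add_cancel, intervalIntegral.integral_add_adjacent_intervals
    ((G.continuous_op x).intervalIntegrable _ _) ((G.continuous_op x).intervalIntegrable _ _),
    smul_smul]
  congr 1
  · push_cast
    have : (h : ℂ) ≠ 0 := by exact_mod_cast h0
    field_simp
  · congr 1 <;> ring

lemma op_avg_succ (k : ℕ) (x : X) :
    G.op (π / 2 ^ (k + 1)) (G.avg (k + 1) x) = G.avg k x + G.mdiff k x := by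
  have h := G.two_smul_avg k x
  have h2 : G.avg k x = (2 : ℂ)⁻¹ • ((2 : ℂ) • G.avg k x) := by simp [smul_smul]
  rw [h2, ← h, mdiff, smul_apply, mul_apply_eq_comp, sub_apply]
  module

lemma op_neg_avg_succ (k : ℕ) (x : X) :
    G.op (-(π / 2 ^ (k + 1))) (G.avg (k + 1) x) = G.avg k x - G.mdiff k x := by
  have h := G.two_smul_avg k x
  have h2 : G.avg k x = (2 : ℂ)⁻¹ • ((2 : ℂ) • G.avg k x) := by simp [smul_smul]
  rw [h2, ← h, mdiff, smul_apply, mul_apply_eq_comp, sub_apply]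
  module

lemma norm_avg_add_mdiff (k : ℕ) (x : X) : ‖G.avg k x + G.mdiff k x‖ = ‖G.avg (k + 1) x‖ := by
  rw [← op_avg_succ, G.norm_op]

lemma norm_avg_sub_mdiff (k : ℕ) (x : X) : ‖G.avg k x - G.mdiff k x‖ = ‖G.avg (k + 1) x‖ := by
  rw [← op_neg_avg_succ, G.norm_op]

lemma sum_norm_mdiff_le {τ c : ℝ} (hc : ∀ x y : X, ‖x + y‖ = ‖x - y‖ →
    ‖x‖ ^ τ + c * ‖y‖ ^ τ ≤ ‖x + y‖ ^ τ) (N : ℕ) (x : X) :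
    ‖G.avg 0 x‖ ^ τ + c * ∑ k ∈ Finset.range N, ‖G.mdiff k x‖ ^ τ ≤ ‖G.avg N x‖ ^ τ := by
  induction N with
  | zero => simp
  | succ N ih =>
    have := hc (G.avg N x) (G.mdiff N x) (by rw [norm_avg_add_mdiff, norm_avg_sub_mdiff])
    rw [norm_avg_add_mdiff] at this
    rw [Finset.sum_range_succ]
    linarith

lemma norm_avg_le_sum {θ C : ℝ} (hC : ∀ x y : X, ‖x + y‖ = ‖x - y‖ →
    ‖x + y‖ ^ θ ≤ ‖x‖ ^ θ + C * ‖y‖ ^ θ) (N : ℕ) (x : X) :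
    ‖G.avg N x‖ ^ θ ≤ ‖G.avg 0 x‖ ^ θ + C * ∑ k ∈ Finset.range N, ‖G.mdiff k x‖ ^ θ := by
  induction N with
  | zero => simp
  | succ N ih =>
    have := hC (G.avg N x) (G.mdiff N x) (by rw [norm_avg_add_mdiff, norm_avg_sub_mdiff])
    rw [norm_avg_add_mdiff] at this
    rw [Finset.sum_range_succ]
    linarith

lemma avg_zero : G.avg 0 = G.proj 0 := by
  ext x
  rw [avg, smul_apply, proj_apply, intOp_apply]
  simp

lemma tendsto_avg (x : X) : Filter.Tendsto (fun k => G.avg k x) Filter.atTop (nhds x) := by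
  rw [Metric.tendsto_atTop]
  intro ε hε
  have h0 : Filter.Tendsto (fun s => G.op s x) (nhds 0) (nhds x) := by
    have := (G.continuous_op x).tendsto 0
    rwa [G.op_zero] at this
  obtain ⟨δ, hδ, hd⟩ := Metric.tendsto_nhds_nhds.1 h0 (ε / 2) (by positivity)
  have ht : Filter.Tendsto (fun k : ℕ => π / 2 ^ k) Filter.atTop (nhds 0) :=
    Filter.Tendsto.const_div_atTop (tendsto_pow_atTop_atTop_of_one_lt one_lt_two) π
  obtain ⟨K, hK⟩ := (Metric.tendsto_atTop.1 ht δ hδ)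
  refine ⟨K, fun k hk => ?_⟩
  have hpos : 0 < π / 2 ^ k := by positivity
  have hk' := hK k hk
  rw [dist_zero_right, Real.norm_eq_abs, abs_of_pos hpos] at hk'
  set h := π / 2 ^ k with hh
  have e : G.avg k x - x = ((2 * h : ℝ) : ℂ)⁻¹ • ∫ s in (-h)..h, (G.op s x - x) := by
    rw [intervalIntegral.integral_sub ((G.continuous_op x).intervalIntegrable _ _)
      (continuous_const.intervalIntegrable _ _), intervalIntegral.integral_const, smul_sub,
      sub_neg_eq_add, ← two_mul, ← Complex.coe_smul, inv_smul_smul₀ (by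
        exact_mod_cast (by positivity : (2 * h) ≠ 0))]
    rfl
  rw [dist_eq_norm, e, norm_smul, norm_inv, Complex.norm_real, Real.norm_eq_abs,
    abs_of_pos (by positivity : 0 < 2 * h), inv_mul_lt_iff₀ (by positivity)]
  have hb := intervalIntegral.norm_integral_le_of_norm_le_const (a := -h) (b := h)
    (f := fun s => G.op s x - x) (C := ε / 2) fun s hs => by
      rw [Set.uIoc_of_le (by linarith)] at hs
      rw [← dist_eq_norm]
      refine (hd ?_).le
      rw [dist_zero_right, Real.norm_eq_abs]
      exact (abs_le.2 ⟨hs.1.le, hs.2⟩).trans_lt hk'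
  rw [sub_neg_eq_add, ← two_mul, abs_of_pos (by positivity : 0 < 2 * h)] at hb
  nlinarith

variable {G}

lemma HasSymbol.intOp_op (a b : ℝ) : G.HasSymbol (_root_.intOp G.op G.strongCont a b)
    fun m => ∫ s in a..b, Complex.exp (Complex.I * m * s) :=
  HasSymbol.intOp G.strongCont HasSymbol.op a b

lemma integral_exp_mul_eq {m : ℤ} (hm : m ≠ 0) (a b : ℝ) :
    (∫ s in a..b, Complex.exp (Complex.I * m * s)) * (Complex.I * m) =
      Complex.exp (Complex.I * m * b) - Complex.exp (Complex.I * m * a) := by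
  have h : Complex.I * (m : ℂ) ≠ 0 := by simp [hm]
  rw [integral_exp_mul_complex h, div_mul_cancel₀ _ h]

lemma HasSymbol.mdiff (k : ℕ) : G.HasSymbol (G.mdiff k) fun m =>
    if m = 0 then 0 else Complex.I * (Real.sin (π / 2 ^ (k + 1) * m) ^ 2 : ℝ) /
      (π / 2 ^ (k + 1) * m : ℝ) := by
  refine (HasSymbol.smul _ ((HasSymbol.sub (.op _) (.op _)).comp (.smul _ (.intOp_op _ _)))).congr
    fun m => ?_
  set h := π / 2 ^ (k + 1) with hh
  have h0 : h ≠ 0 := by rw [hh]; positivity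
  have h0' : (h : ℂ) ≠ 0 := by exact_mod_cast h0
  simp only [Pi.smul_apply, Pi.mul_apply, Pi.sub_apply, smul_eq_mul]
  split_ifs with hm
  · subst hm; simp
  · have hm' : (m : ℂ) ≠ 0 := by exact_mod_cast hm
    have e := integral_exp_mul_eq hm (-h) h
    have e1 : Complex.exp (Complex.I * m * h) - Complex.exp (Complex.I * m * (-h : ℝ)) =
        2 * Complex.I * Complex.sin (h * m) := by
      rw [Complex.sin, show -(h * m : ℂ) * Complex.I = Complex.I * m * (-h : ℝ) by push_cast; ring,
        show (h * m : ℂ) * Complex.I = Complex.I * m * h by ring]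
      linear_combination (Complex.exp (Complex.I * m * h) - Complex.exp (Complex.I * m * (-h : ℝ)))
        * Complex.I_sq
    rw [e1] at e ⊢
    have e2 : (∫ s in (-h)..h, Complex.exp (Complex.I * m * s)) = 2 * Complex.sin (h * m) / m := by
      rw [eq_div_iff hm']
      refine mul_left_cancel₀ Complex.I_ne_zero ?_
      linear_combination e
    rw [e2]
    push_cast
    field_simp

variable (G)

/-- Dyadic blocks. -/
def blockQ (j : ℕ) : X →L[ℂ] X := G.mult (fun u => cutQ u) j

/-- Fattened dyadic blocks. -/
def blockF (j : ℕ) : X →L[ℂ] X := G.mult (fun u => cutF u) j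

variable {G}

lemma HasSymbol.blockQ (j : ℕ) : G.HasSymbol (G.blockQ j) fun m => cutQ (m / 2 ^ j) :=
  G.hasSymbol_mult isCutoff_cutQ.isMult j

lemma HasSymbol.blockF (j : ℕ) : G.HasSymbol (G.blockF j) fun m => cutF (m / 2 ^ j) :=
  G.hasSymbol_mult isCutoff_cutF.isMult j

variable (G)

lemma norm_blockQ_le (j : ℕ) : ‖G.blockQ j‖ ≤ 100 :=
  (G.norm_mult_le isCutoff_cutQ.isMult j).trans (by norm_num)

lemma norm_blockF_le (j : ℕ) : ‖G.blockF j‖ ≤ 100 :=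
  (G.norm_mult_le isCutoff_cutF.isMult j).trans (by norm_num)

lemma blockF_mul_blockQ (j : ℕ) : G.blockF j * G.blockQ j = G.blockQ j :=
  (((HasSymbol.blockF j).comp (.blockQ j)).congr fun m => by
    rw [Pi.mul_apply, ← Complex.ofReal_mul, cutF_mul_cutQ]).ext (.blockQ j)

end PeriodicGroup

/-- Analysis half of the Littlewood–Paley inequality. -/
lemma exists_tsum_blockQ_le {X : Type*} [NormedAddCommGroup X] [NormedSpace ℂ X] [CompleteSpace X]
    {τ : ℝ} (hτ : 1 ≤ τ) (hX : IsotropicConvex X τ) :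
    ∃ C : NNReal, ∀ (G : PeriodicGroup X) (x : X), ∑' j, ‖G.blockQ j x‖ₑ ^ τ ≤ C * ‖x‖ₑ ^ τ := by
  obtain ⟨c, hc0, hc⟩ := hX
  obtain ⟨A, hA, hA'⟩ := exists_isMult_deriv 1
  obtain ⟨B, hB, hB'⟩ := exists_isMult_inv_sin_sq
  have hτ0 : 0 < τ := by linarith
  have hpi := Real.pi_pos
  set D : ℝ := π / 8 * (10 * A * (10 * B)) with hD
  have hD0 : 0 < D := by positivity
  refine ⟨(D ^ τ / c).toNNReal, fun G x => ?_⟩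
  have hfac : ∀ j, G.blockQ j = (-(π / 8 : ℝ) : ℂ) • (G.mult (fun u => cutQ u *
      (Complex.I * u) ^ ((1 : ℝ) : ℂ)) j * (G.mult (fun u => cutF u *
        ((Real.sin (π * u / 8) ^ 2 : ℝ) : ℂ)⁻¹) j * G.mdiff (j + 2))) := fun j => by
    refine PeriodicGroup.HasSymbol.ext (.blockQ j) (((.smul _ ((G.hasSymbol_mult
      (hA' _ isCutoff_cutQ) j).comp ((G.hasSymbol_mult hB' j).comp (.mdiff _)))) :
        G.HasSymbol _ _).congr fun m => ?_)
    simp only [Pi.smul_apply, Pi.mul_apply, smul_eq_mul]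
    by_cases hm : m = 0
    · subst hm; simp [cutQ_zero]
    rw [if_neg hm]
    by_cases hq : 1 / 2 ≤ |(m / 2 ^ j : ℝ)| ∧ |(m / 2 ^ j : ℝ)| ≤ 2
    swap
    · simp [cutQ_eq_zero hq]
    rw [cutF_eq_one hq.1 hq.2]
    have hv : π / 2 ^ (j + 2 + 1) * m = π * (m / 2 ^ j) / 8 := by
      rw [pow_add, pow_add]; field_simp; norm_num
    rw [hv]
    set u : ℝ := m / 2 ^ j with hu
    have hu0 : u ≠ 0 := by intro h; rw [h] at hq; norm_num at hq
    have hs : Real.sin (π * u / 8) ≠ 0 := by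
      have h1 := Real.mul_abs_le_abs_sin (x := π * u / 8) (by
        rw [abs_div, abs_mul, abs_of_pos pi_pos, abs_of_pos (by norm_num : (0 : ℝ) < 8)]
        nlinarith [hq.2])
      have h2 : π * u / 8 ≠ 0 := by positivity
      exact abs_pos.1 (lt_of_lt_of_le (mul_pos (by positivity) (abs_pos.2 h2)) h1)
    have hs' : ((Real.sin (π * u / 8) ^ 2 : ℝ) : ℂ) ≠ 0 := by exact_mod_cast pow_ne_zero 2 hs
    have hu0' : (u : ℂ) ≠ 0 := by exact_mod_cast hu0
    have hpi' : (π : ℂ) ≠ 0 := by exact_mod_cast hpi.ne'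
    rw [Complex.ofReal_one, Complex.cpow_one]
    generalize ((Real.sin (π * u / 8) ^ 2 : ℝ) : ℂ) = S at hs'
    push_cast
    field_simp
    linear_combination (-(cutQ u : ℂ)) * Complex.I_sq
  have hle : ∀ j, ‖G.blockQ j x‖ ≤ D * ‖G.mdiff (j + 2) x‖ := fun j => by
    rw [hfac, smul_apply, norm_smul, norm_neg, Complex.norm_real, Real.norm_eq_abs,
      abs_of_pos (by positivity), mul_apply_eq_comp, mul_apply_eq_comp, hD]
    have h1 := (G.mult (fun u => cutQ u * (Complex.I * u) ^ ((1 : ℝ) : ℂ)) j).le_of_opNorm_le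
      (G.norm_mult_le (hA' _ isCutoff_cutQ) j) (G.mult (fun u => cutF u *
        ((Real.sin (π * u / 8) ^ 2 : ℝ) : ℂ)⁻¹) j (G.mdiff (j + 2) x))
    have h2 := (G.mult (fun u => cutF u * ((Real.sin (π * u / 8) ^ 2 : ℝ) : ℂ)⁻¹) j).le_of_opNorm_le
      (G.norm_mult_le hB' j) (G.mdiff (j + 2) x)
    calc _ ≤ π / 8 * (10 * A * (10 * B * ‖G.mdiff (j + 2) x‖)) := by
          gcongr
          exact h1.trans (by gcongr)
      _ = _ := by ring
  have hfin : ∀ N, ∑ j ∈ Finset.range N, ‖G.blockQ j x‖ ^ τ ≤ D ^ τ / c * ‖x‖ ^ τ := fun N => by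
    have h1 := G.sum_norm_mdiff_le hc (N + 2) x
    have h2 : ‖G.avg (N + 2) x‖ ^ τ ≤ ‖x‖ ^ τ :=
      Real.rpow_le_rpow (norm_nonneg _) (G.norm_avg_apply_le _ _) hτ0.le
    have h3 : 0 ≤ ‖G.avg 0 x‖ ^ τ := by positivity
    have h4 : ∑ j ∈ Finset.range N, ‖G.mdiff (j + 2) x‖ ^ τ ≤
        ∑ k ∈ Finset.range (N + 2), ‖G.mdiff k x‖ ^ τ := by
      rw [Finset.sum_range_succ', Finset.sum_range_succ']
      have : 0 ≤ ‖G.mdiff (0 + 1) x‖ ^ τ := by positivity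
      have : 0 ≤ ‖G.mdiff 0 x‖ ^ τ := by positivity
      linarith
    have h5 : ∑ j ∈ Finset.range N, ‖G.mdiff (j + 2) x‖ ^ τ ≤ ‖x‖ ^ τ / c := by
      rw [le_div_iff₀ hc0]
      nlinarith
    calc _ ≤ ∑ j ∈ Finset.range N, D ^ τ * ‖G.mdiff (j + 2) x‖ ^ τ := by
          refine Finset.sum_le_sum fun j _ => ?_
          rw [← Real.mul_rpow hD0.le (norm_nonneg _)]
          exact Real.rpow_le_rpow (norm_nonneg _) (hle j) hτ0.le
      _ = D ^ τ * ∑ j ∈ Finset.range N, ‖G.mdiff (j + 2) x‖ ^ τ := by rw [Finset.mul_sum]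
      _ ≤ D ^ τ * (‖x‖ ^ τ / c) := by gcongr
      _ = _ := by ring
  refine ENNReal.tsum_le_of_sum_range_le fun N => ?_
  have e : ∀ y : X, ‖y‖ₑ ^ τ = ENNReal.ofReal (‖y‖ ^ τ) := fun y => by
    rw [← ofReal_norm, ENNReal.ofReal_rpow_of_nonneg (norm_nonneg _) hτ0.le]
  simp only [e]
  rw [← ENNReal.ofReal_sum_of_nonneg fun j _ => by positivity]
  change _ ≤ ENNReal.ofReal _ * _
  rw [← ENNReal.ofReal_mul (by positivity)]
  exact ENNReal.ofReal_le_ofReal (hfin N)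

namespace PeriodicGroup

section Synthesis

variable {X : Type*} [NormedAddCommGroup X] [NormedSpace ℂ X] [CompleteSpace X]

lemma intOp_mul_blockF {A : ℝ} (G : PeriodicGroup X)
    (h : IsMult (fun u => cutF u * (Complex.I * u) ^ ((-1 : ℝ) : ℂ)) A) (j : ℕ) (a b : ℝ) :
    intOp G.op G.strongCont a b * G.blockF j = (((2 ^ j)⁻¹ : ℝ) : ℂ) •
      ((G.op b - G.op a) * G.mult (fun u => cutF u * (Complex.I * u) ^ ((-1 : ℝ) : ℂ)) j) := by
  refine ((HasSymbol.intOp_op a b).comp (.blockF j)).ext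
    (((((HasSymbol.op b).sub (.op a)).comp (G.hasSymbol_mult h j)).smul _).congr fun m => ?_)
  simp only [Pi.smul_apply, Pi.mul_apply, Pi.sub_apply, smul_eq_mul]
  by_cases hm : m = 0
  · subst hm; simp [cutF_zero]
  have hm' : (m : ℂ) ≠ 0 := by exact_mod_cast hm
  rw [← integral_exp_mul_eq hm a b, Complex.ofReal_neg, Complex.ofReal_one, Complex.cpow_neg_one]
  push_cast
  have := Complex.I_ne_zero
  field_simp

lemma op_sub_mul_blockF {A : ℝ} (G : PeriodicGroup X)
    (h : IsMult (fun u => cutF u * (Complex.I * u) ^ ((1 : ℝ) : ℂ)) A) (j : ℕ) (a b : ℝ) :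
    (G.op b - G.op a) * G.blockF j = ((2 ^ j : ℝ) : ℂ) • (intOp G.op G.strongCont a b *
      G.mult (fun u => cutF u * (Complex.I * u) ^ ((1 : ℝ) : ℂ)) j) := by
  refine (((HasSymbol.op b).sub (.op a)).comp (.blockF j)).ext
    ((((HasSymbol.intOp_op a b).comp (G.hasSymbol_mult h j)).smul _).congr fun m => ?_)
  simp only [Pi.smul_apply, Pi.mul_apply, Pi.sub_apply, smul_eq_mul]
  by_cases hm : m = 0
  · subst hm; simp [cutF_zero]
  rw [← integral_exp_mul_eq hm a b, Complex.ofReal_one, Complex.cpow_one]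
  push_cast
  field_simp

lemma norm_op_sub_op_apply_le (G : PeriodicGroup X) (a b : ℝ) (x : X) :
    ‖(G.op b - G.op a) x‖ ≤ 2 * ‖x‖ := by
  rw [sub_apply]
  refine (norm_sub_le _ _).trans_eq ?_
  rw [G.norm_op, G.norm_op, two_mul]

variable (X) in
lemma exists_norm_intOp_blockF_le : ∃ C : ℝ, 0 < C ∧ ∀ (G : PeriodicGroup X) (j : ℕ) (a b : ℝ)
    (x : X), ‖intOp G.op G.strongCont a b (G.blockF j x)‖ ≤ C * (2 ^ j)⁻¹ * ‖x‖ ∧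
      ‖(G.op b - G.op a) (G.blockF j x)‖ ≤ C * 2 ^ j * |b - a| * ‖x‖ := by
  obtain ⟨A, hA, hA'⟩ := exists_isMult_deriv (-1)
  obtain ⟨B, hB, hB'⟩ := exists_isMult_deriv 1
  refine ⟨20 * A + 10 * B, by positivity, fun G j a b x => ⟨?_, ?_⟩⟩
  · rw [← mul_apply_eq_comp, intOp_mul_blockF G (hA' _ isCutoff_cutF), smul_apply, norm_smul,
      mul_apply_eq_comp, Complex.norm_real, Real.norm_eq_abs, abs_of_pos (by positivity)]
    calc _ ≤ (2 ^ j : ℝ)⁻¹ * (2 * (10 * A * ‖x‖)) := by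
          gcongr
          refine (G.norm_op_sub_op_apply_le _ _ _).trans ?_
          gcongr
          exact ContinuousLinearMap.le_of_opNorm_le _ (G.norm_mult_le (hA' _ isCutoff_cutF) j) x
      _ = 20 * A * (2 ^ j)⁻¹ * ‖x‖ := by ring
      _ ≤ _ := by gcongr; linarith
  · rw [← mul_apply_eq_comp, op_sub_mul_blockF G (hB' _ isCutoff_cutF), smul_apply, norm_smul,
      mul_apply_eq_comp, Complex.norm_real, Real.norm_eq_abs, abs_of_pos (by positivity)]
    calc _ ≤ (2 ^ j : ℝ) * (|b - a| * (10 * B * ‖x‖)) := by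
          gcongr
          refine (G.norm_intOp_op_apply_le _ _ _).trans ?_
          gcongr
          exact ContinuousLinearMap.le_of_opNorm_le _ (G.norm_mult_le (hB' _ isCutoff_cutF) j) x
      _ = 10 * B * 2 ^ j * |b - a| * ‖x‖ := by ring
      _ ≤ _ := by gcongr; linarith

variable (X) in
lemma exists_norm_mdiff_blockF_le : ∃ C : NNReal, ∀ (G : PeriodicGroup X) (k j : ℕ) (x : X),
    ‖G.mdiff k (G.blockF j x)‖ ≤ C * (1 / 2) ^ ((k : ℤ) - j).natAbs * ‖x‖ := by
  obtain ⟨C, hC, h⟩ := exists_norm_intOp_blockF_le X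
  have hpi := Real.pi_pos
  refine ⟨(C * π + C).toNNReal, fun G k j x => ?_⟩
  rw [Real.coe_toNNReal _ (by positivity)]
  set η := π / 2 ^ (k + 1) with hη
  have hη0 : 0 < η := by positivity
  have e : G.mdiff k (G.blockF j x) = (2 : ℂ)⁻¹ •
      ((G.op η - G.op (-η)) (G.avg (k + 1) (G.blockF j x))) := rfl
  have e2 : G.avg (k + 1) (G.blockF j x) = ((2 * η : ℝ) : ℂ)⁻¹ •
      intOp G.op G.strongCont (-η) η (G.blockF j x) := rfl
  rw [e, norm_smul, norm_inv, Complex.norm_two]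
  rcases le_total j k with hjk | hjk
  · have hc : (G.op η - G.op (-η)) (G.avg (k + 1) (G.blockF j x)) =
        G.avg (k + 1) ((G.op η - G.op (-η)) (G.blockF j x)) := by
      rw [avg, smul_apply, smul_apply, map_smul, sub_apply, sub_apply, map_sub,
        (HasSymbol.intOp_op _ _).commute_op, (HasSymbol.intOp_op _ _).commute_op]
    rw [hc, show ((k : ℤ) - j).natAbs = k - j by omega, one_div, inv_pow]
    have e3 : (2 : ℝ) ^ j * (2 ^ (k - j)) = 2 ^ k := by rw [← pow_add]; congr 1; omega
    have e4 : (2 : ℝ) ^ j * η = π * (2 ^ (k - j))⁻¹ / 2 := by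
      rw [hη, pow_succ, ← e3]; field_simp
    calc _ ≤ 2⁻¹ * (C * 2 ^ j * |η - -η| * ‖x‖) := by
          gcongr
          exact (G.norm_avg_apply_le _ _).trans (h G j _ _ x).2
      _ = C * (2 ^ j * η) * ‖x‖ := by
          rw [sub_neg_eq_add, ← two_mul, abs_of_pos (by positivity)]; ring
      _ = C * π * (2 ^ (k - j))⁻¹ * ‖x‖ / 2 := by rw [e4]; ring
      _ ≤ C * π * (2 ^ (k - j))⁻¹ * ‖x‖ := half_le_self (by positivity)
      _ ≤ _ := by gcongr; linarith
  · rw [show ((k : ℤ) - j).natAbs = j - k by omega, one_div, inv_pow]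
    have e3 : (2 : ℝ) ^ k * (2 ^ (j - k)) = 2 ^ j := by rw [← pow_add]; congr 1; omega
    have e4 : (2 * η)⁻¹ * (2 ^ j : ℝ)⁻¹ = π⁻¹ * (2 ^ (j - k))⁻¹ := by
      rw [hη, pow_succ, ← e3]; field_simp
    have e5 : π⁻¹ ≤ 1 := inv_le_one_of_one_le₀ (by linarith [Real.pi_gt_three])
    calc _ ≤ 2⁻¹ * (2 * ((2 * η)⁻¹ * (C * (2 ^ j)⁻¹ * ‖x‖))) := by
          gcongr
          refine (G.norm_op_sub_op_apply_le _ _ _).trans ?_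
          gcongr
          rw [e2, norm_smul, norm_inv, Complex.norm_real, Real.norm_eq_abs,
            abs_of_pos (by positivity)]
          gcongr
          exact (h G j _ _ x).1
      _ = C * ((2 * η)⁻¹ * (2 ^ j)⁻¹) * ‖x‖ := by ring
      _ = C * (π⁻¹ * (2 ^ (j - k))⁻¹) * ‖x‖ := by rw [e4]
      _ ≤ C * (1 * (2 ^ (j - k))⁻¹) * ‖x‖ := by gcongr
      _ = C * (2 ^ (j - k))⁻¹ * ‖x‖ := by ring
      _ ≤ _ := by gcongr; nlinarith

lemma proj_zero_blockF (G : PeriodicGroup X) (j : ℕ) (x : X) : G.proj 0 (G.blockF j x) = 0 := by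
  rw [HasSymbol.blockF j]; simp [cutF_zero]

/-- Synthesis half of the Littlewood–Paley inequality. -/
lemma exists_enorm_sum_blockF_le {θ : ℝ} (hθ : 1 ≤ θ) (hX : IsotropicSmooth X θ) :
    ∃ C : NNReal, ∀ (G : PeriodicGroup X) (S : Finset ℕ) (y : ℕ → X),
      ‖∑ j ∈ S, G.blockF j (y j)‖ₑ ^ θ ≤ C * ∑ j ∈ S, ‖y j‖ₑ ^ θ := by
  obtain ⟨c, hc0, hc⟩ := hX
  obtain ⟨D, hD⟩ := exists_norm_mdiff_blockF_le X
  obtain ⟨B, hB⟩ := exists_tsum_geom_schur (r := 1 / 2) (by norm_num)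
  have hθ0 : 0 < θ := by linarith
  refine ⟨c.toNNReal * (D ^ θ * B ^ θ), fun G S y => ?_⟩
  set x := ∑ j ∈ S, G.blockF j (y j) with hx
  have h0 : G.avg 0 x = 0 := by
    rw [avg_zero, hx, map_sum]
    exact Finset.sum_eq_zero fun j _ => G.proj_zero_blockF j _
  set a : ℕ → ℝ≥0∞ := fun j => if j ∈ S then ‖y j‖ₑ else 0 with ha
  have hS : ∑ j ∈ S, ‖y j‖ₑ ^ θ = ∑' j, a j ^ θ := by
    rw [tsum_eq_sum (s := S)]
    · exact Finset.sum_congr rfl fun j hj => by simp [ha, hj]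
    · intro j hj; simp [ha, hj, hθ0]
  have hk : ∀ k, ‖G.mdiff k x‖ₑ ≤ D * ∑' j : ℕ, (((1 / 2 : NNReal) : ℝ≥0∞) ^
      ((k : ℤ) - j).natAbs * a j) := by
    intro k
    rw [hx, map_sum, tsum_eq_sum (s := S) (by intro j hj; simp [ha, hj]), Finset.mul_sum]
    refine (enorm_sum_le _ _).trans (Finset.sum_le_sum fun j hj => ?_)
    simp only [ha, if_pos hj]
    have := hD G k j (y j)
    rw [← ofReal_norm, ← ofReal_norm]
    refine (ENNReal.ofReal_le_ofReal this).trans_eq ?_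
    rw [ENNReal.ofReal_mul (by positivity), ENNReal.ofReal_mul (by positivity),
      ENNReal.ofReal_coe_nnreal, mul_assoc, ENNReal.ofReal_pow (by norm_num)]
    congr 3
    rw [← ENNReal.ofReal_coe_nnreal]; norm_num
  have hN : ∀ N, ‖G.avg N x‖ₑ ^ θ ≤ ((c.toNNReal * (D ^ θ * B ^ θ) : NNReal) : ℝ≥0∞) *
      ∑ j ∈ S, ‖y j‖ₑ ^ θ := by
    intro N
    have e : ∀ y : X, ‖y‖ₑ ^ θ = ENNReal.ofReal (‖y‖ ^ θ) := fun y => by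
      rw [← ofReal_norm, ENNReal.ofReal_rpow_of_nonneg (norm_nonneg _) hθ0.le]
    have h1 := G.norm_avg_le_sum hc N x
    rw [h0, norm_zero, Real.zero_rpow hθ0.ne', zero_add] at h1
    calc ‖G.avg N x‖ₑ ^ θ ≤ c.toNNReal * ∑ k ∈ Finset.range N, ‖G.mdiff k x‖ₑ ^ θ := by
          rw [e]
          refine (ENNReal.ofReal_le_ofReal h1).trans_eq ?_
          rw [ENNReal.ofReal_mul hc0.le, ENNReal.ofReal_sum_of_nonneg fun _ _ => by positivity]
          simp only [e]; rfl
      _ ≤ c.toNNReal * ∑' k : ℕ, (D * ∑' j : ℕ, (((1 / 2 : NNReal) : ℝ≥0∞) ^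
          ((k : ℤ) - j).natAbs * a j)) ^ θ := by
          gcongr
          refine (ENNReal.sum_le_tsum _).trans (ENNReal.tsum_le_tsum fun k => ?_)
          gcongr
          exact hk k
      _ = c.toNNReal * (D ^ θ * ∑' k : ℕ, (∑' j : ℕ, (((1 / 2 : NNReal) : ℝ≥0∞) ^
          ((k : ℤ) - j).natAbs * a j)) ^ θ) := by
          simp only [ENNReal.mul_rpow_of_nonneg _ _ hθ0.le, ENNReal.tsum_mul_left]
      _ ≤ c.toNNReal * (D ^ θ * (B ^ θ * ∑' j, a j ^ θ)) := by
          gcongr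
          exact hB θ hθ a
      _ = _ := by
          rw [hS]
          push_cast [ENNReal.coe_rpow_of_nonneg _ hθ0.le]
          ring
  have ht := (G.tendsto_avg x).enorm
  refine le_of_tendsto ((ENNReal.continuous_rpow_const (y := θ)).tendsto _ |>.comp ht) ?_
  exact Filter.Eventually.of_forall hN

end Synthesis
end PeriodicGroup

/-- Signed binomial coefficients. -/
def diffCoef (γ : ℝ) (ν : ℕ) : ℝ := (-1 : ℝ) ^ ν * fracBinom γ ν

lemma diffCoef_zero (γ : ℝ) : diffCoef γ 0 = 1 := by simp [diffCoef, fracBinom]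

lemma abs_diffCoef_succ (γ : ℝ) (ν : ℕ) :
    |diffCoef γ (ν + 1)| * (ν + 1) = |diffCoef γ ν| * |γ - ν| := by
  have h : (0 : ℝ) < ν + 1 := by positivity
  simp only [diffCoef, abs_mul, abs_pow, abs_neg, abs_one, one_pow, one_mul, fracBinom, abs_div]
  rw [abs_of_pos h, div_mul_cancel₀ _ h.ne']

lemma summable_abs_diffCoef {γ : ℝ} (hγ : 0 < γ) : Summable fun ν => |diffCoef γ ν| := by
  obtain ⟨n, hn⟩ := exists_nat_gt γ
  refine (summable_nat_add_iff n).1 (summable_of_sum_range_le (c := n * |diffCoef γ n| / γ)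
    (fun _ => abs_nonneg _) fun N => ?_)
  have key : ∀ N : ℕ, γ * ∑ ν ∈ Finset.range N, |diffCoef γ (ν + n)| =
      n * |diffCoef γ n| - (N + n : ℕ) * |diffCoef γ (N + n)| := by
    intro N
    induction N with
    | zero => simp
    | succ N ih =>
      have h1 := abs_diffCoef_succ γ (N + n)
      have h2 : γ - (N + n : ℕ) < 0 := by
        push_cast
        have : (0 : ℝ) ≤ N := by positivity
        linarith
      rw [abs_of_neg h2] at h1
      rw [Finset.sum_range_succ, mul_add, ih, show N + 1 + n = N + n + 1 by ring]
      push_cast at h1 ⊢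
      linarith
  rw [le_div_iff₀ hγ, mul_comm, key]
  have : 0 ≤ ((N + n : ℕ) : ℝ) * |diffCoef γ (N + n)| := by positivity
  linarith

lemma fracBinom_eq_choose (γ : ℝ) (n : ℕ) : fracBinom γ n = Ring.choose γ n := by
  induction n with
  | zero => simp [fracBinom]
  | succ n ih =>
    have h : (0 : ℝ) < n + 1 := by positivity
    have h2 : ((n.factorial : ℕ) : ℝ) ≠ 0 := by exact_mod_cast n.factorial_ne_zero
    rw [fracBinom, ih, Ring.choose_eq_smul, Ring.choose_eq_smul, descPochhammer_succ_right,
      Nat.factorial_succ]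
    simp only [Polynomial.smeval_mul, smul_eq_mul, Polynomial.smeval_sub, Polynomial.smeval_X,
      Polynomial.smeval_natCast, pow_one, pow_zero, nsmul_eq_mul, mul_one]
    push_cast
    field_simp

/-- The binomial series on the closed unit disc. -/
lemma tsum_diffCoef_mul_pow {γ : ℝ} (hγ : 0 < γ) {z : ℂ} (hz : ‖z‖ ≤ 1) :
    ∑' ν, (diffCoef γ ν : ℂ) * z ^ ν = (1 - z) ^ (γ : ℂ) := by
  have hopen : ∀ w : ℂ, ‖w‖ < 1 → ∑' ν, (diffCoef γ ν : ℂ) * w ^ ν = (1 - w) ^ (γ : ℂ) := by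
    intro w hw
    have h := Complex.one_add_cpow_hasFPowerSeriesOnBall_zero (a := (γ : ℂ))
    have h1 := (h.hasSum (y := -w) (by simpa [← ofReal_norm] using hw)).tsum_eq
    rw [zero_add, ← sub_eq_add_neg] at h1
    rw [← h1]
    refine tsum_congr fun n => ?_
    rw [binomialSeries_apply, List.ofFn_const, List.prod_replicate, smul_eq_mul,
      ← Complex.ofReal_choose, ← fracBinom_eq_choose, neg_pow, diffCoef]
    push_cast
    ring
  have hsum := summable_abs_diffCoef hγ
  have hF : ContinuousOn (fun w : ℂ => ∑' ν, (diffCoef γ ν : ℂ) * w ^ ν)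
      (Metric.closedBall 0 1) := by
    refine continuousOn_tsum (fun ν => by fun_prop) hsum fun ν w hw => ?_
    rw [norm_mul, Complex.norm_real, norm_pow, Real.norm_eq_abs]
    refine mul_le_of_le_one_right (abs_nonneg _) (pow_le_one₀ (norm_nonneg _) ?_)
    simpa using hw
  have hline : Filter.Tendsto (fun x : ℝ => (x : ℂ) * z) (nhdsWithin 1 (Set.Ioo 0 1)) (nhds z) := by
    have : Continuous fun x : ℝ => (x : ℂ) * z := by fun_prop
    have h := this.tendsto 1
    rw [Complex.ofReal_one, one_mul] at h
    exact h.mono_left nhdsWithin_le_nhds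
  have hnorm : ∀ x ∈ Set.Ioo (0 : ℝ) 1, ‖(x : ℂ) * z‖ < 1 := fun x hx => by
    rw [norm_mul, Complex.norm_real, Real.norm_eq_abs, abs_of_pos hx.1]
    nlinarith [hx.2, hx.1, norm_nonneg z]
  have : (nhdsWithin (1 : ℝ) (Set.Ioo 0 1)).NeBot := right_nhdsWithin_Ioo_neBot zero_lt_one
  have t1 : Filter.Tendsto (fun x : ℝ => ∑' ν, (diffCoef γ ν : ℂ) * ((x : ℂ) * z) ^ ν)
      (nhdsWithin 1 (Set.Ioo 0 1)) (nhds (∑' ν, (diffCoef γ ν : ℂ) * z ^ ν)) := by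
    refine (hF z (by simpa using hz)).tendsto.comp (tendsto_nhdsWithin_iff.2 ⟨hline, ?_⟩)
    filter_upwards [self_mem_nhdsWithin] with x hx
    simpa using (hnorm x hx).le
  have hre : 0 ≤ (1 - z).re := by
    have := (Complex.re_le_norm z).trans hz
    rw [Complex.sub_re, Complex.one_re]; linarith
  have t2 : Filter.Tendsto (fun x : ℝ => (1 - (x : ℂ) * z) ^ (γ : ℂ))
      (nhdsWithin 1 (Set.Ioo 0 1)) (nhds ((1 - z) ^ (γ : ℂ))) := by
    have hc := Complex.continuousAt_cpow_of_re_pos (p := (1 - z, (γ : ℂ))) (Or.inl hre)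
      (by simpa using hγ)
    exact hc.tendsto.comp ((hline.const_sub 1).prodMk_nhds tendsto_const_nhds)
  refine tendsto_nhds_unique (t1.congr' ?_) t2
  filter_upwards [self_mem_nhdsWithin] with x hx
  exact hopen _ (hnorm x hx)

lemma Complex.ofReal_mul_cpow {r : ℝ} (hr : 0 < r) (z : ℂ) (hz : z ≠ 0) (γ : ℝ) :
    ((r : ℂ) * z) ^ (γ : ℂ) = ((r ^ γ : ℝ) : ℂ) * z ^ (γ : ℂ) := by
  have hr' : (r : ℂ) ≠ 0 := by exact_mod_cast hr.ne'
  rw [Complex.cpow_def_of_ne_zero (mul_ne_zero hr' hz), Complex.log_ofReal_mul hr hz, add_mul,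
    Complex.exp_add, Complex.cpow_def_of_ne_zero hz, Complex.ofReal_cpow hr.le,
    Complex.cpow_def_of_ne_zero hr', Complex.ofReal_log hr.le]

lemma hasSum_clm_apply {X : Type*} [NormedAddCommGroup X] [NormedSpace ℂ X] {f : ℕ → X →L[ℂ] X}
    {A : X →L[ℂ] X} (h : HasSum f A) (x : X) : HasSum (fun n => f n x) (A x) := by
  have h1 := h.map (ContinuousLinearMap.apply ℂ X x) (ContinuousLinearMap.apply ℂ X x).continuous
  exact h1

namespace PeriodicGroup

variable {X : Type*} [NormedAddCommGroup X] [NormedSpace ℂ X] [CompleteSpace X]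
  (G : PeriodicGroup X)

/-- The (backward) fractional difference of order `γ`. -/
def diffOp (γ h : ℝ) : X →L[ℂ] X := ∑' ν : ℕ, (diffCoef γ ν : ℂ) • G.op (-(ν * h))

variable {γ : ℝ}

lemma norm_diffCoef_smul_op_le (γ : ℝ) (ν : ℕ) (s : ℝ) :
    ‖(diffCoef γ ν : ℂ) • G.op s‖ ≤ |diffCoef γ ν| := by
  rw [norm_smul, Complex.norm_real]
  exact mul_le_of_le_one_right (norm_nonneg _) (G.norm_op_le _)

lemma summable_diffOp (hγ : 0 < γ) (h : ℝ) :
    Summable fun ν : ℕ => (diffCoef γ ν : ℂ) • G.op (-(ν * h)) :=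
  .of_norm_bounded (summable_abs_diffCoef hγ) fun ν => G.norm_diffCoef_smul_op_le γ ν _

lemma norm_diffOp_le (hγ : 0 < γ) (h : ℝ) : ‖G.diffOp γ h‖ ≤ ∑' ν, |diffCoef γ ν| :=
  tsum_of_norm_bounded (summable_abs_diffCoef hγ).hasSum
    fun ν => G.norm_diffCoef_smul_op_le γ ν _

lemma hasSum_diffOp_apply (hγ : 0 < γ) (h : ℝ) (x : X) :
    HasSum (fun ν : ℕ => (diffCoef γ ν : ℂ) • G.op (-(ν * h)) x) (G.diffOp γ h x) :=
  hasSum_clm_apply (G.summable_diffOp hγ h).hasSum x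

variable {G}

lemma HasSymbol.tsum {A : ℕ → X →L[ℂ] X} {a : ℕ → ℤ → ℂ} (hA : Summable A)
    (ha : ∀ m, Summable fun ν => a ν m) (h : ∀ ν, G.HasSymbol (A ν) (a ν)) :
    G.HasSymbol (∑' ν, A ν) (fun m => ∑' ν, a ν m) := fun m x => by
  have h1 := (hasSum_clm_apply hA.hasSum x).map (G.proj m) (G.proj m).continuous
  have h2 := (ha m).hasSum.smul_const (G.proj m x)
  refine h1.unique ?_
  convert h2 using 2 with ν
  exact h ν m x

lemma HasSymbol.diffOp (hγ : 0 < γ) (h : ℝ) : G.HasSymbol (G.diffOp γ h)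
    fun m => (1 - Complex.exp (-(Complex.I * m * h))) ^ (γ : ℂ) := by
  have hn : ∀ m : ℤ, ‖Complex.exp (-(Complex.I * m * h))‖ = 1 := fun m => by
    rw [show -(Complex.I * m * h) = ((-(m * h) : ℝ) : ℂ) * Complex.I by push_cast; ring,
      Complex.norm_exp_ofReal_mul_I]
  refine (HasSymbol.tsum (G.summable_diffOp hγ h) (fun m => ?_)
    fun ν => (HasSymbol.op _).smul _).congr fun m => ?_
  · refine .of_norm_bounded (summable_abs_diffCoef hγ) fun ν => ?_
    simp only [Pi.smul_apply, smul_eq_mul, norm_mul, Complex.norm_real, Real.norm_eq_abs]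
    rw [show Complex.I * m * ((-(ν * h) : ℝ) : ℂ) = ((-(m * (ν * h)) : ℝ) : ℂ) * Complex.I by
      push_cast; ring, Complex.norm_exp_ofReal_mul_I, mul_one]
  · rw [← tsum_diffCoef_mul_pow hγ (hn m).le]
    refine tsum_congr fun ν => ?_
    rw [Pi.smul_apply, smul_eq_mul, ← Complex.exp_nat_mul]
    congr 2
    push_cast
    ring

variable (G)

lemma diffOp_zero (hγ : 0 < γ) : G.diffOp γ 0 = 0 :=
  (HasSymbol.diffOp hγ 0).ext fun m x => by simp [hγ.ne']

end PeriodicGroup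

namespace PeriodicGroup

variable {X : Type*} [NormedAddCommGroup X] [NormedSpace ℂ X] [CompleteSpace X]

lemma one_sub_exp_ne_zero {s : ℝ} (hs : s ≠ 0) (hs' : |s| ≤ π) :
    1 - Complex.exp (-(Complex.I * s)) ≠ 0 := fun h => by
  have := abs_half_le_norm_exp_sub_one hs'
  rw [← norm_neg, neg_sub, h, norm_zero] at this
  have := abs_pos.2 hs
  linarith

lemma one_sub_exp_cpow {η u : ℝ} (hη : η ≠ 0) (hη' : |η| ≤ 1 / 4) (hu : u ≠ 0) (hu' : |u| ≤ 4)
    (γ : ℝ) : (1 - Complex.exp (-(Complex.I * (η * u : ℝ)))) ^ (γ : ℂ) = ((|η| ^ γ : ℝ) : ℂ) *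
      (((|η|⁻¹ : ℝ) : ℂ) * (1 - Complex.exp (-(Complex.I * (η * u : ℝ))))) ^ (γ : ℂ) := by
  have h0 : 0 < |η| := abs_pos.2 hη
  have h1 : ((|η| : ℝ) : ℂ) ≠ 0 := by exact_mod_cast h0.ne'
  have h2 : 1 - Complex.exp (-(Complex.I * (η * u : ℝ))) ≠ 0 := by
    refine one_sub_exp_ne_zero (mul_ne_zero hη hu) ?_
    rw [abs_mul]
    nlinarith [Real.pi_gt_three, abs_nonneg u]
  rw [← Complex.ofReal_mul_cpow h0 _ (mul_ne_zero (by simpa using hη) h2)]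
  congr 1
  push_cast
  field_simp

lemma diffOp_mul_blockF (G : PeriodicGroup X) {γ η A : ℝ} (hγ : 0 < γ) (hη : η ≠ 0)
    (hη' : |η| ≤ 1 / 4) (h : IsMult (fun u => cutF u *
      (((|η|⁻¹ : ℝ) : ℂ) * (1 - Complex.exp (-(Complex.I * (η * u : ℝ))))) ^ (γ : ℂ)) A) (j : ℕ) :
    G.diffOp γ (η / 2 ^ j) * G.blockF j = ((|η| ^ γ : ℝ) : ℂ) • G.mult (fun u => cutF u *
      (((|η|⁻¹ : ℝ) : ℂ) * (1 - Complex.exp (-(Complex.I * (η * u : ℝ))))) ^ (γ : ℂ)) j := by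
  refine ((HasSymbol.diffOp hγ _).comp (.blockF j)).ext
    (((G.hasSymbol_mult h j).smul _).congr fun m => ?_)
  simp only [Pi.smul_apply, Pi.mul_apply, smul_eq_mul]
  by_cases hm : 1 / 4 ≤ |(m / 2 ^ j : ℝ)| ∧ |(m / 2 ^ j : ℝ)| ≤ 4
  swap
  · simp [isCutoff_cutF.supp _ hm]
  have hu : (m / 2 ^ j : ℝ) ≠ 0 := by intro h; rw [h] at hm; norm_num at hm
  have e : Complex.I * m * ((η / 2 ^ j : ℝ) : ℂ) = Complex.I * ((η * (m / 2 ^ j) : ℝ) : ℂ) := by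
    push_cast; ring
  rw [e, one_sub_exp_cpow hη hη' hu hm.2]
  ring

lemma blockQ_eq_mul_diffOp (G : PeriodicGroup X) {γ η A : ℝ} (hγ : 0 < γ) (hη : η ≠ 0)
    (hη' : |η| ≤ 1 / 4) (h : IsMult (fun u => cutF u *
      (((|η|⁻¹ : ℝ) : ℂ) * (1 - Complex.exp (-(Complex.I * (η * u : ℝ))))) ^ ((-γ : ℝ) : ℂ)) A)
    (j : ℕ) : ((|η| ^ γ : ℝ) : ℂ) • G.blockQ j = G.mult (fun u => cutF u *
      (((|η|⁻¹ : ℝ) : ℂ) * (1 - Complex.exp (-(Complex.I * (η * u : ℝ))))) ^ ((-γ : ℝ) : ℂ)) j *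
        (G.blockQ j * G.diffOp γ (η / 2 ^ j)) := by
  refine ((HasSymbol.blockQ j).smul _).ext (((G.hasSymbol_mult h j).comp
    ((HasSymbol.blockQ j).comp (.diffOp hγ _))).congr fun m => ?_)
  simp only [Pi.smul_apply, Pi.mul_apply, smul_eq_mul]
  by_cases hm : 1 / 2 ≤ |(m / 2 ^ j : ℝ)| ∧ |(m / 2 ^ j : ℝ)| ≤ 2
  swap
  · simp [cutQ_eq_zero hm]
  have hu : (m / 2 ^ j : ℝ) ≠ 0 := by intro h; rw [h] at hm; norm_num at hm
  have e : Complex.I * m * ((η / 2 ^ j : ℝ) : ℂ) = Complex.I * ((η * (m / 2 ^ j) : ℝ) : ℂ) := by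
    push_cast; ring
  have h0 : 0 < |η| := abs_pos.2 hη
  rw [e, one_sub_exp_cpow hη hη' hu (hm.2.trans (by norm_num)), cutF_eq_one hm.1 hm.2,
    Complex.ofReal_neg, Complex.cpow_neg]
  have h2 : 1 - Complex.exp (-(Complex.I * (η * (m / 2 ^ j) : ℝ))) ≠ 0 := by
    refine one_sub_exp_ne_zero (mul_ne_zero hη hu) ?_
    rw [abs_mul]
    nlinarith [Real.pi_gt_three, abs_nonneg (m / 2 ^ j : ℝ)]
  have h3 : (((|η|⁻¹ : ℝ) : ℂ) * (1 - Complex.exp (-(Complex.I * (η * (m / 2 ^ j) : ℝ))))) ^ (γ : ℂ)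
      ≠ 0 := by
    rw [Complex.cpow_ne_zero_iff]
    exact Or.inl (mul_ne_zero (by simpa using hη) h2)
  generalize (((|η|⁻¹ : ℝ) : ℂ) * (1 - Complex.exp (-(Complex.I * (η * (m / 2 ^ j) : ℝ))))) ^
      (γ : ℂ)
    = Z at h3 ⊢
  push_cast
  field_simp

variable (X) in
lemma exists_norm_diffOp_blockF_le {γ : ℝ} (hγ : 0 < γ) : ∃ C : ℝ, 0 < C ∧
    ∀ (G : PeriodicGroup X) (h : ℝ) (j : ℕ) (x : X),
      ‖G.diffOp γ h (G.blockF j x)‖ ≤ C * min 1 (2 ^ j * |h|) ^ γ * ‖x‖ := by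
  obtain ⟨A, hA, hA'⟩ := exists_isMult_diff γ
  set K := ∑' ν, |diffCoef γ ν| with hK
  have hK0 : 0 ≤ K := tsum_nonneg fun _ => abs_nonneg _
  refine ⟨10 * A + 4 ^ γ * (K * 100), by positivity, fun G h j x => ?_⟩
  rcases eq_or_ne h 0 with rfl | hh
  · rw [diffOp_zero _ hγ]; simp only [zero_apply, norm_zero]; positivity
  have h0 : 0 < |h| := abs_pos.2 hh
  rcases le_total (2 ^ j * |h|) (1 / 4) with hs | hs
  · have hη : (2 ^ j * h) ≠ 0 := by positivity
    have hη' : |2 ^ j * h| = 2 ^ j * |h| := by rw [abs_mul, abs_of_pos (by positivity)]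
    have hm := hA' cutF isCutoff_cutF (2 ^ j * h) hη (by rwa [hη'])
    have e := G.diffOp_mul_blockF hγ hη (by rwa [hη']) hm j
    rw [mul_div_cancel_left₀ _ (by positivity)] at e
    rw [← mul_apply_eq_comp, e, smul_apply, norm_smul, Complex.norm_real, Real.norm_eq_abs,
      abs_of_nonneg (by positivity), hη', min_eq_right (by linarith)]
    calc _ ≤ (2 ^ j * |h|) ^ γ * (10 * A * ‖x‖) := by
          rw [hη'] at hm
          gcongr
          exact ContinuousLinearMap.le_of_opNorm_le _ (G.norm_mult_le hm j) x
      _ = 10 * A * (2 ^ j * |h|) ^ γ * ‖x‖ := by ring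
      _ ≤ _ := by gcongr; linarith [show 0 ≤ 4 ^ γ * (K * 100) by positivity]
  · have h1 : (1 / 4 : ℝ) ≤ min 1 (2 ^ j * |h|) := le_min (by norm_num) hs
    have h2 : 1 ≤ 4 ^ γ * min 1 (2 ^ j * |h|) ^ γ := by
      rw [← Real.mul_rpow (by norm_num) (by positivity)]
      exact Real.one_le_rpow (by linarith) hγ.le
    calc _ ≤ K * (100 * ‖x‖) := by
          refine ((G.diffOp γ h).le_of_opNorm_le (G.norm_diffOp_le hγ h) _).trans ?_
          gcongr
          exact (G.blockF j).le_of_opNorm_le (G.norm_blockF_le j) x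
      _ = 1 * (K * 100 * ‖x‖) := by ring
      _ ≤ (4 ^ γ * min 1 (2 ^ j * |h|) ^ γ) * (K * 100 * ‖x‖) := by gcongr
      _ = 4 ^ γ * (K * 100) * min 1 (2 ^ j * |h|) ^ γ * ‖x‖ := by ring
      _ ≤ _ := by gcongr; linarith

variable (X) in
lemma exists_le_norm_blockQ_diffOp {γ : ℝ} (hγ : 0 < γ) : ∃ C : ℝ, 0 < C ∧
    ∀ (G : PeriodicGroup X) (h : ℝ) (j : ℕ) (x : X), h ≠ 0 → 2 ^ j * |h| ≤ 1 / 4 →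
      (2 ^ j * |h|) ^ γ * ‖G.blockQ j x‖ ≤ C * ‖G.blockQ j (G.diffOp γ h x)‖ := by
  obtain ⟨A, hA, hA'⟩ := exists_isMult_diff (-γ)
  refine ⟨10 * A, by positivity, fun G h j x hh hs => ?_⟩
  have h0 : 0 < |h| := abs_pos.2 hh
  have hη : (2 ^ j * h) ≠ 0 := by positivity
  have hη' : |2 ^ j * h| = 2 ^ j * |h| := by rw [abs_mul, abs_of_pos (by positivity)]
  have hm := hA' cutF isCutoff_cutF (2 ^ j * h) hη (by rwa [hη'])
  have e := congrArg (fun A => ‖A x‖) (G.blockQ_eq_mul_diffOp hγ hη (by rwa [hη']) hm j)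
  simp only [mul_div_cancel_left₀ h (by positivity : (2 ^ j : ℝ) ≠ 0), smul_apply, norm_smul,
    Complex.norm_real, Real.norm_eq_abs, mul_apply_eq_comp] at e
  rw [abs_of_nonneg (by positivity), hη'] at e
  rw [hη'] at hm
  rw [e]
  exact ContinuousLinearMap.le_of_opNorm_le _ (G.norm_mult_le hm j) _

lemma continuous_diffOp (G : PeriodicGroup X) {γ : ℝ} (hγ : 0 < γ) (x : X) :
    Continuous fun s => G.diffOp γ s x := by
  simp only [← (G.hasSum_diffOp_apply hγ _ x).tsum_eq]
  refine continuous_tsum (fun ν => ?_) ((summable_abs_diffCoef hγ).mul_right ‖x‖) fun ν s => ?_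
  · exact ((G.continuous_op x).comp (by fun_prop : Continuous fun s : ℝ =>
        -((ν : ℝ) * s))).const_smul _
  · rw [norm_smul, G.norm_op, Complex.norm_real, Real.norm_eq_abs]

lemma strongCont_diffOp (G : PeriodicGroup X) {γ : ℝ} (hγ : 0 < γ) : StrongCont (G.diffOp γ) :=
  ⟨G.continuous_diffOp hγ, _, G.norm_diffOp_le hγ⟩

/-- Averages of the differences over the steps in `[0, δ]`. -/
def meanDiff (G : PeriodicGroup X) {γ : ℝ} (hγ : 0 < γ) (δ : ℝ) : X →L[ℂ] X :=
  ((δ⁻¹ : ℝ) : ℂ) • intOp (G.diffOp γ) (G.strongCont_diffOp hγ) 0 δ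

lemma norm_meanDiff_sub_le (G : PeriodicGroup X) {γ δ M : ℝ} (hγ : 0 < γ) (hδ : 0 < δ) (x : X)
    (hM : ∀ a b : ℝ, ‖intOp G.op G.strongCont a b x‖ ≤ M) :
    ‖G.meanDiff hγ δ x - x‖ ≤ (∑' ν, |diffCoef γ ν|) * (δ⁻¹ * M) := by
  have hM0 : 0 ≤ M := (norm_nonneg _).trans (hM 0 0)
  have hcont : ∀ ν : ℕ, Continuous fun s : ℝ => (diffCoef γ ν : ℂ) • G.op (-(ν * s)) x := fun ν =>
    ((G.continuous_op x).comp (by fun_prop : Continuous fun s : ℝ => -((ν : ℝ) * s))).const_smul _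
  have hs : HasSum (fun ν : ℕ => ∫ s in (0 : ℝ)..δ, (diffCoef γ ν : ℂ) • G.op (-(ν * s)) x)
      (∫ s in (0 : ℝ)..δ, G.diffOp γ s x) := by
    refine intervalIntegral.hasSum_integral_of_dominated_convergence
      (fun ν _ => |diffCoef γ ν| * ‖x‖) (fun ν => (hcont ν).aestronglyMeasurable) (fun ν =>
          ?_) ?_ ?_ ?_
    · refine .of_forall fun s _ => ?_
      rw [norm_smul, G.norm_op, Complex.norm_real, Real.norm_eq_abs]
    · exact .of_forall fun s _ => (summable_abs_diffCoef hγ).mul_right _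
    · exact intervalIntegrable_const
    · exact .of_forall fun s _ => G.hasSum_diffOp_apply hγ s x
  have hs2 := hs.const_smul ((δ⁻¹ : ℝ) : ℂ)
  have hdef : ((δ⁻¹ : ℝ) : ℂ) • ∫ s in (0 : ℝ)..δ, G.diffOp γ s x = G.meanDiff hγ δ x := rfl
  rw [hdef] at hs2
  have h0 : ((δ⁻¹ : ℝ) : ℂ) • ∫ s in (0 : ℝ)..δ, (diffCoef γ 0 : ℂ) • G.op (-((0 : ℕ) * s)) x =
      x := by
    simp only [diffCoef_zero, Nat.cast_zero, zero_mul, neg_zero, G.op_zero, Complex.ofReal_one,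
      one_smul, one_apply_eq_self, intervalIntegral.integral_const, sub_zero,
      Complex.coe_smul, smul_smul]
    rw [inv_mul_cancel₀ hδ.ne', one_smul]
  have hs3 := (hasSum_nat_add_iff' 1).2 hs2
  rw [Finset.sum_range_one, h0] at hs3
  have hb : ∀ ν : ℕ, ‖((δ⁻¹ : ℝ) : ℂ) • ∫ s in (0 : ℝ)..δ,
      (diffCoef γ (ν + 1) : ℂ) • G.op (-((ν + 1 : ℕ) * s)) x‖ ≤
          |diffCoef γ (ν + 1)| * (δ⁻¹ * M) := by
    intro ν
    have hν : ((ν + 1 : ℕ) : ℝ) ≠ 0 := by positivity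
    have hν1 : (1 : ℝ) ≤ (ν + 1 : ℕ) := by push_cast; linarith [show (0 : ℝ) ≤ ν by positivity]
    have e : ∫ s in (0 : ℝ)..δ, G.op (-((ν + 1 : ℕ) * s)) x =
        ((ν + 1 : ℕ) : ℝ)⁻¹ • intOp G.op G.strongCont (-((ν + 1 : ℕ) * δ)) 0 x := by
      have := intervalIntegral.integral_comp_mul_left (fun s => G.op s x) (a := 0) (b := δ)
        (c := -((ν + 1 : ℕ) : ℝ)) (neg_ne_zero.2 hν)
      simp only [neg_mul, mul_zero] at this
      rw [this, intOp_apply, intervalIntegral.integral_symm, inv_neg, smul_neg, neg_smul, neg_neg]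
    rw [intervalIntegral.integral_smul, e, norm_smul, norm_smul, norm_smul, Complex.norm_real,
      Complex.norm_real, Real.norm_eq_abs, Real.norm_eq_abs, Real.norm_eq_abs,
      abs_of_pos (inv_pos.2 hδ), abs_of_pos (a := ((ν + 1 : ℕ) : ℝ)⁻¹) (by positivity)]
    have h1 : ((ν + 1 : ℕ) : ℝ)⁻¹ ≤ 1 := inv_le_one_of_one_le₀ hν1
    calc _ ≤ δ⁻¹ * (|diffCoef γ (ν + 1)| * (1 * M)) := by gcongr; exact hM _ _
      _ = _ := by ring
  have hsum := summable_abs_diffCoef hγ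
  rw [← hs3.tsum_eq]
  refine (tsum_of_norm_bounded (((summable_nat_add_iff 1).2 hsum).mul_right
      (δ⁻¹ * M)).hasSum hb).trans ?_
  rw [tsum_mul_right]
  refine mul_le_mul_of_nonneg_right ?_ (by positivity)
  have := hsum.sum_add_tsum_nat_add 1
  rw [← this, Finset.sum_range_one]
  linarith [abs_nonneg (diffCoef γ 0)]

lemma HasSymbol.meanDiff (G : PeriodicGroup X) {γ : ℝ} (hγ : 0 < γ) (δ : ℝ) :
    ∃ a, G.HasSymbol (G.meanDiff hγ δ) a :=
  ⟨_, (HasSymbol.intOp (G.strongCont_diffOp hγ) (fun s => HasSymbol.diffOp hγ s) 0 δ).smul _⟩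

/-- `B` is dominated by the family `D` of operators with parameters in `[-δ, δ]`. -/
def InHull (D : ℝ → X →L[ℂ] X) (δ : ℝ) (B : X →L[ℂ] X) : Prop :=
  ∀ (L : X →L[ℂ] X) (y : X) (M : ℝ), (∀ s, |s| ≤ δ → ‖L (D s y)‖ ≤ M) → ‖L (B y)‖ ≤ M

lemma inHull_meanDiff (G : PeriodicGroup X) {γ δ : ℝ} (hγ : 0 < γ) (hδ : 0 < δ) :
    InHull (G.diffOp γ) δ (G.meanDiff hγ δ) := fun L y M hM => by
  have hM0 : 0 ≤ M := (norm_nonneg _).trans (hM 0 (by simpa using hδ.le))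
  rw [meanDiff, smul_apply, intOp_apply, map_smul,
    ← ContinuousLinearMap.intervalIntegral_comp_comm _
      ((G.continuous_diffOp hγ y).intervalIntegrable _ _), norm_smul, Complex.norm_real,
    Real.norm_eq_abs, abs_of_pos (inv_pos.2 hδ), inv_mul_le_iff₀ hδ, mul_comm]
  refine (intervalIntegral.norm_integral_le_of_norm_le_const (C := M) fun s hs => ?_).trans_eq ?_
  · rw [Set.uIoc_of_le hδ.le] at hs
    exact hM s (by rw [abs_of_pos hs.1]; exact hs.2)
  · rw [sub_zero, abs_of_pos hδ]

variable (X) in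
/-- The blocks of `y` are controlled by averages of differences of `y` with small steps. -/
lemma exists_inHull {γ : ℝ} (hγ : 0 < γ) : ∃ C : ℝ, 0 < C ∧ ∀ (G : PeriodicGroup X) (δ : ℝ),
    0 < δ → ∃ B : Fin 2 → X →L[ℂ] X, (∀ i, InHull (G.diffOp γ) δ (B i)) ∧
      (∀ i, ∃ b, G.HasSymbol (B i) b) ∧ ∀ j y, min 1 (2 ^ j * δ) ^ γ * ‖G.blockQ j y‖ ≤
        C * ∑ i, ‖G.blockQ j (B i y)‖ := by
  obtain ⟨C₁, hC₁, h₁⟩ := exists_le_norm_blockQ_diffOp X hγ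
  obtain ⟨C₂, hC₂, h₂⟩ := exists_norm_intOp_blockF_le X
  set K := ∑' ν, |diffCoef γ ν| with hK
  have hK0 : 0 ≤ K := tsum_nonneg fun _ => abs_nonneg _
  set R := 1 + 2 * K * C₂ with hR
  have hR1 : 1 ≤ R := by have := mul_nonneg hK0 hC₂.le; linarith
  have hR0 : 0 < R := by linarith
  refine ⟨2 + (4 * R) ^ γ * C₁, by positivity, fun G δ hδ =>
    ⟨![G.diffOp γ (δ / (4 * R)), G.meanDiff hγ δ], ?_, ?_, fun j y => ?_⟩⟩
  · rw [Fin.forall_fin_two]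
    refine ⟨fun L y M hM => hM _ ?_, G.inHull_meanDiff hγ hδ⟩
    rw [abs_of_pos (by positivity)]
    exact div_le_self hδ.le (by linarith)
  · rw [Fin.forall_fin_two]
    exact ⟨⟨_, HasSymbol.diffOp hγ _⟩, HasSymbol.meanDiff G hγ δ⟩
  rw [Fin.sum_univ_two]
  simp only [Matrix.cons_val_zero, Matrix.cons_val_one]
  have hmin : min 1 (2 ^ j * δ) ^ γ ≤ 1 :=
    Real.rpow_le_one (by positivity) (min_le_left _ _) hγ.le
  rcases le_total (2 ^ j * δ) R with hj | hj
  · have hpos : 0 < δ / (4 * R) := by positivity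
    have hle : 2 ^ j * |δ / (4 * R)| ≤ 1 / 4 := by
      rw [abs_of_pos hpos, ← mul_div_assoc, div_le_iff₀ (by positivity)]; linarith
    have := h₁ G (δ / (4 * R)) j y hpos.ne' hle
    rw [abs_of_pos hpos, ← mul_div_assoc, Real.div_rpow (by positivity) (by positivity),
      div_mul_eq_mul_div, div_le_iff₀ (by positivity)] at this
    calc _ ≤ (2 ^ j * δ) ^ γ * ‖G.blockQ j y‖ := by
          gcongr; exact min_le_right _ _
      _ ≤ _ := this
      _ = (4 * R) ^ γ * C₁ * ‖G.blockQ j (G.diffOp γ (δ / (4 * R)) y)‖ := by ring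
      _ ≤ _ := by
        gcongr
        · linarith
        · exact le_add_of_nonneg_right (norm_nonneg _)
  · obtain ⟨b, hb⟩ := HasSymbol.meanDiff G hγ δ
    have hcomm : G.blockQ j (G.meanDiff hγ δ y) = G.meanDiff hγ δ (G.blockQ j y) :=
      (HasSymbol.blockQ j).commute hb.commute_op y
    have h3 := G.norm_meanDiff_sub_le hγ hδ (G.blockQ j y) (M := C₂ * (2 ^ j)⁻¹ * ‖G.blockQ j y‖)
      fun a b => by
        have := (h₂ G j a b (G.blockQ j y)).1
        rwa [← mul_apply_eq_comp (G.blockF j), blockF_mul_blockQ] at this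
    have h4 : K * (δ⁻¹ * (C₂ * (2 ^ j)⁻¹ * ‖G.blockQ j y‖)) ≤ 1 / 2 * ‖G.blockQ j y‖ := by
      have h5 : K * C₂ * (2 ^ j * δ)⁻¹ ≤ 1 / 2 := by
        rw [← div_eq_mul_inv, div_le_iff₀ (by positivity)]; linarith
      calc _ = K * C₂ * (2 ^ j * δ)⁻¹ * ‖G.blockQ j y‖ := by rw [mul_inv]; ring
        _ ≤ _ := by gcongr
    have h6 : ‖G.blockQ j y‖ ≤ ‖G.meanDiff hγ δ (G.blockQ j y)‖ +
        ‖G.meanDiff hγ δ (G.blockQ j y) - G.blockQ j y‖ := by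
      exact norm_le_norm_add_norm_sub _ _
    rw [hcomm]
    calc _ ≤ 1 * ‖G.blockQ j y‖ := by gcongr
      _ ≤ 2 * ‖G.meanDiff hγ δ (G.blockQ j y)‖ := by linarith
      _ ≤ _ := by
        gcongr
        · linarith [show 0 ≤ (4 * R) ^ γ * C₁ by positivity]
        · exact le_add_of_nonneg_left (norm_nonneg _)

end PeriodicGroup

namespace PeriodicGroup

variable {X : Type*} [NormedAddCommGroup X] [NormedSpace ℂ X] [CompleteSpace X]

/-- Two periodic groups whose operators commute. -/
def Commuting (G H : PeriodicGroup X) : Prop := ∀ s t x, G.op s (H.op t x) = H.op t (G.op s x)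

variable {G H : PeriodicGroup X}

lemma Commuting.symm (hc : Commuting G H) : Commuting H G := fun s t x => (hc t s x).symm

lemma Commuting.apply (hc : Commuting G H) {A B : X →L[ℂ] X} {a b : ℤ → ℂ} (hA : G.HasSymbol A a)
    (hB : H.HasSymbol B b) (x : X) : A (B x) = B (A x) :=
  hA.commute (fun s y => hB.commute (fun t z => (hc s t z)) y |>.symm ▸ rfl) x

lemma Commuting.ext (h : ∀ m n, G.proj m (H.proj n x) = G.proj m (H.proj n y)) : x = y :=
  H.ext_proj fun n => G.ext_proj fun m => h m n

lemma Commuting.proj_proj_apply (hc : Commuting G H) {A B : X →L[ℂ] X} {a b : ℤ → ℂ}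
    (hA : G.HasSymbol A a) (hB : H.HasSymbol B b) (m n : ℤ) (x : X) :
    G.proj m (H.proj n (A (B x))) = (a m * b n) • G.proj m (H.proj n x) := by
  rw [← hc.apply hA (.proj n), hA, hB, map_smul, smul_smul]

lemma exists_enorm_sum_blockF_blockF_le {θ : ℝ} (hθ : 1 ≤ θ) (hX : IsotropicSmooth X θ) :
    ∃ C : NNReal, ∀ (G H : PeriodicGroup X) (S : Finset (ℕ × ℕ)) (y : ℕ × ℕ → X),
      ‖∑ j ∈ S, G.blockF j.1 (H.blockF j.2 (y j))‖ₑ ^ θ ≤ C * ∑ j ∈ S, ‖y j‖ₑ ^ θ := by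
  classical
  obtain ⟨C, hC⟩ := exists_enorm_sum_blockF_le hθ hX
  have hθ0 : 0 < θ := by linarith
  refine ⟨C * C, fun G H S y => ?_⟩
  set S₁ := S.image Prod.fst
  set S₂ := S.image Prod.snd
  have hS : S ⊆ S₁ ×ˢ S₂ := Finset.subset_product
  set z : ℕ × ℕ → X := fun j => if j ∈ S then y j else 0
  have h1 : ∑ j ∈ S, G.blockF j.1 (H.blockF j.2 (y j)) =
      ∑ i ∈ S₁, G.blockF i (∑ k ∈ S₂, H.blockF k (z (i, k))) := by
    simp_rw [map_sum]
    rw [← Finset.sum_product', ← Finset.sum_subset hS]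
    · exact Finset.sum_congr rfl fun j hj => by simp [z, hj]
    · intro j _ hj
      simp [z, hj]
  have h2 : ∑ j ∈ S, ‖y j‖ₑ ^ θ = ∑ i ∈ S₁, ∑ k ∈ S₂, ‖z (i, k)‖ₑ ^ θ := by
    rw [← Finset.sum_product' (f := fun i k => ‖z (i, k)‖ₑ ^ θ), ← Finset.sum_subset hS]
    · exact Finset.sum_congr rfl fun j hj => by simp [z, hj]
    · intro j _ hj
      simp [z, hj, hθ0]
  rw [h1, h2, ENNReal.coe_mul, mul_assoc, Finset.mul_sum]
  refine (hC G S₁ _).trans ?_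
  gcongr with i hi
  exact hC H S₂ fun k => z (i, k)

lemma exists_tsum_blockQ_blockQ_le {τ : ℝ} (hτ : 1 ≤ τ) (hX : IsotropicConvex X τ) :
    ∃ C : NNReal, ∀ (G H : PeriodicGroup X) (x : X),
      ∑' j : ℕ × ℕ, ‖G.blockQ j.1 (H.blockQ j.2 x)‖ₑ ^ τ ≤ C * ‖x‖ₑ ^ τ := by
  obtain ⟨C, hC⟩ := exists_tsum_blockQ_le hτ hX
  refine ⟨C * C, fun G H x => ?_⟩
  rw [ENNReal.tsum_prod', ENNReal.tsum_comm, ENNReal.coe_mul, mul_assoc]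
  refine (ENNReal.tsum_le_tsum fun j => hC G (H.blockQ j x)).trans ?_
  rw [ENNReal.tsum_mul_left]
  gcongr
  exact hC H x

/-- The abstract mixed modulus of smoothness for a pair of periodic groups. -/
def mixedModulus (G H : PeriodicGroup X) (γ₁ γ₂ t₁ t₂ : ℝ) (x : X) : ℝ≥0∞ :=
  ⨆ (h₁ : ℝ) (_ : |h₁| ≤ t₁) (h₂ : ℝ) (_ : |h₂| ≤ t₂), ‖G.diffOp γ₁ h₁ (H.diffOp γ₂ h₂ x)‖ₑ

lemma enorm_le_mixedModulus {γ₁ γ₂ t₁ t₂ h₁ h₂ : ℝ} (hh₁ : |h₁| ≤ t₁) (hh₂ : |h₂| ≤ t₂) (x : X) :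
    ‖G.diffOp γ₁ h₁ (H.diffOp γ₂ h₂ x)‖ₑ ≤ mixedModulus G H γ₁ γ₂ t₁ t₂ x :=
  le_iSup₂_of_le h₁ hh₁ (le_iSup₂_of_le h₂ hh₂ le_rfl)

lemma mixedModulus_mono {γ₁ γ₂ t₁ t₂ u₁ u₂ : ℝ} (h₁ : t₁ ≤ u₁) (h₂ : t₂ ≤ u₂) (x : X) :
    mixedModulus G H γ₁ γ₂ t₁ t₂ x ≤ mixedModulus G H γ₁ γ₂ u₁ u₂ x :=
  iSup₂_le fun _ k₁ => iSup₂_le fun _ k₂ =>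
    enorm_le_mixedModulus (k₁.trans h₁) (k₂.trans h₂) x

lemma mixedModulus_ne_top {γ₁ γ₂ : ℝ} (hγ₁ : 0 < γ₁) (hγ₂ : 0 < γ₂) (t₁ t₂ : ℝ) (x : X) :
    mixedModulus G H γ₁ γ₂ t₁ t₂ x ≠ ⊤ := by
  refine ne_top_of_le_ne_top (b := ENNReal.ofReal ((∑' ν, |diffCoef γ₁ ν|) *
    ((∑' ν, |diffCoef γ₂ ν|) * ‖x‖))) ENNReal.ofReal_ne_top
    (iSup₂_le fun h₁ _ => iSup₂_le fun h₂ _ => ?_)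
  rw [← ofReal_norm]
  refine ENNReal.ofReal_le_ofReal ((ContinuousLinearMap.le_of_opNorm_le _
    (G.norm_diffOp_le hγ₁ h₁) _).trans ?_)
  exact mul_le_mul_of_nonneg_left (ContinuousLinearMap.le_of_opNorm_le _
    (H.norm_diffOp_le hγ₂ h₂) _) (tsum_nonneg fun _ => abs_nonneg _)

end PeriodicGroup

namespace PeriodicGroup

variable {X : Type*} [NormedAddCommGroup X] [NormedSpace ℂ X] [CompleteSpace X]
variable {G H : PeriodicGroup X}

lemma norm_inHull_le {D D' : ℝ → X →L[ℂ] X} {δ₁ δ₂ M : ℝ} {B B' : X →L[ℂ] X}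
    (hB : InHull D δ₁ B) (hB' : InHull D' δ₂ B') {x : X}
    (hM : ∀ s t, |s| ≤ δ₁ → |t| ≤ δ₂ → ‖D s (D' t x)‖ ≤ M) : ‖B (B' x)‖ ≤ M :=
  hB' B x M fun t ht => hB 1 (D' t x) M fun s hs => hM s t hs ht

variable (X) in
lemma exists_weight_mul_norm_blockQ_le {β₁ β₂ : ℝ} (hβ₁ : 0 < β₁) (hβ₂ : 0 < β₂) :
    ∃ C : ℝ, 0 < C ∧ ∀ (G H : PeriodicGroup X), Commuting G H → ∀ (x : X) (δ₁ δ₂ : ℝ),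
      0 < δ₁ → 0 < δ₂ → ∃ y : Fin 2 × Fin 2 → X,
        (∀ i, ‖y i‖ₑ ≤ mixedModulus G H β₁ β₂ δ₁ δ₂ x) ∧ ∀ j : ℕ × ℕ,
          min 1 (2 ^ j.1 * δ₁) ^ β₁ * min 1 (2 ^ j.2 * δ₂) ^ β₂ *
            ‖G.blockQ j.1 (H.blockQ j.2 x)‖ ≤
          C * ∑ i, ‖G.blockQ j.1 (H.blockQ j.2 (y i))‖ := by
  obtain ⟨C₁, hC₁, h₁⟩ := exists_inHull X hβ₁
  obtain ⟨C₂, hC₂, h₂⟩ := exists_inHull X hβ₂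
  refine ⟨C₁ * C₂, by positivity, fun G H hc x δ₁ δ₂ hδ₁ hδ₂ => ?_⟩
  obtain ⟨B, hB, hBs, hBQ⟩ := h₁ G δ₁ hδ₁
  obtain ⟨B', hB', hBs', hBQ'⟩ := h₂ H δ₂ hδ₂
  choose b hb using hBs
  choose b' hb' using hBs'
  refine ⟨fun i => B i.1 (B' i.2 x), fun i => ?_, fun j => ?_⟩
  · have htop := mixedModulus_ne_top (G := G) (H := H) hβ₁ hβ₂ δ₁ δ₂ x
    rw [← ofReal_norm, ← ENNReal.ofReal_toReal htop]
    refine ENNReal.ofReal_le_ofReal (norm_inHull_le (hB i.1) (hB' i.2) fun s t hs ht => ?_)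
    rw [← toReal_enorm]
    exact ENNReal.toReal_mono htop (enorm_le_mixedModulus hs ht x)
  · have hw : 0 ≤ min 1 (2 ^ j.2 * δ₂) ^ β₂ := by positivity
    calc _ = min 1 (2 ^ j.2 * δ₂) ^ β₂ * (min 1 (2 ^ j.1 * δ₁) ^ β₁ *
            ‖G.blockQ j.1 (H.blockQ j.2 x)‖) := by ring
      _ ≤ min 1 (2 ^ j.2 * δ₂) ^ β₂ * (C₁ * ∑ i, ‖G.blockQ j.1 (B i (H.blockQ j.2 x))‖) :=
          mul_le_mul_of_nonneg_left (hBQ _ _) hw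
      _ = C₁ * ∑ i, min 1 (2 ^ j.2 * δ₂) ^ β₂ * ‖H.blockQ j.2 (G.blockQ j.1 (B i x))‖ := by
          rw [← Finset.mul_sum]
          have : ∀ i, G.blockQ j.1 (B i (H.blockQ j.2 x)) = H.blockQ j.2 (G.blockQ j.1 (B i x)) :=
            fun i => by rw [hc.apply (hb i) (.blockQ _), hc.apply (.blockQ _) (.blockQ _)]
          simp_rw [this]; ring
      _ ≤ C₁ * ∑ i, C₂ * ∑ k, ‖H.blockQ j.2 (B' k (G.blockQ j.1 (B i x)))‖ := by
          exact mul_le_mul_of_nonneg_left (Finset.sum_le_sum fun i _ => hBQ' _ _) hC₁.le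
      _ = _ := by
          have : ∀ i k, H.blockQ j.2 (B' k (G.blockQ j.1 (B i x))) =
              G.blockQ j.1 (H.blockQ j.2 (B i (B' k x))) := fun i k => by
            rw [← hc.apply (.blockQ _) (hb' k), ← hc.apply (.blockQ _) (.blockQ _),
              ← hc.apply (hb i) (hb' k)]
          simp_rw [this]
          rw [Fintype.sum_prod_type, ← Finset.mul_sum]; ring

lemma exists_tsum_weight_mul_blockQ_le {τ β₁ β₂ : ℝ} (hτ : 1 ≤ τ) (hX : IsotropicConvex X τ)
    (hβ₁ : 0 < β₁) (hβ₂ : 0 < β₂) :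
    ∃ C : NNReal, ∀ (G H : PeriodicGroup X), Commuting G H → ∀ (x : X) (δ₁ δ₂ : ℝ),
      0 < δ₁ → 0 < δ₂ → ∑' j : ℕ × ℕ, (ENNReal.ofReal (min 1 (2 ^ j.1 * δ₁) ^ β₁ *
        min 1 (2 ^ j.2 * δ₂) ^ β₂) * ‖G.blockQ j.1 (H.blockQ j.2 x)‖ₑ) ^ τ ≤
          C * mixedModulus G H β₁ β₂ δ₁ δ₂ x ^ τ := by
  obtain ⟨C, hC, h⟩ := exists_weight_mul_norm_blockQ_le X hβ₁ hβ₂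
  obtain ⟨K, hK⟩ := exists_tsum_blockQ_blockQ_le hτ hX
  have hτ0 : 0 ≤ τ := by linarith
  refine ⟨(Real.toNNReal C) ^ τ * (4 ^ (τ - 1) * (4 * K)), fun G H hc x δ₁ δ₂ hδ₁ hδ₂ => ?_⟩
  obtain ⟨y, hy, hyj⟩ := h G H hc x δ₁ δ₂ hδ₁ hδ₂
  calc _ ≤ ∑' j : ℕ × ℕ, ENNReal.ofReal C ^ τ * (4 ^ (τ - 1) *
          ∑ i, ‖G.blockQ j.1 (H.blockQ j.2 (y i))‖ₑ ^ τ) := by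
        refine ENNReal.tsum_le_tsum fun j => ?_
        have h4 := ENNReal.rpow_sum_le_const_mul_sum_rpow (Finset.univ : Finset (Fin 2 × Fin 2))
          (fun i => ‖G.blockQ j.1 (H.blockQ j.2 (y i))‖ₑ) hτ
        have h5 : (((Finset.univ : Finset (Fin 2 × Fin 2)).card : ℕ) : ℝ≥0∞) = 4 := by
          simp
        rw [h5] at h4
        refine le_trans ?_ (mul_le_mul_right h4 _)
        rw [← ENNReal.mul_rpow_of_nonneg _ _ hτ0]
        refine ENNReal.rpow_le_rpow ?_ hτ0
        simp_rw [← ofReal_norm]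
        rw [← ENNReal.ofReal_sum_of_nonneg (fun _ _ => norm_nonneg _), ← ENNReal.ofReal_mul hC.le,
          ← ENNReal.ofReal_mul (by positivity)]
        exact ENNReal.ofReal_le_ofReal (hyj j)
    _ = ENNReal.ofReal C ^ τ * (4 ^ (τ - 1) *
          ∑ i, ∑' j : ℕ × ℕ, ‖G.blockQ j.1 (H.blockQ j.2 (y i))‖ₑ ^ τ) := by
        rw [ENNReal.tsum_mul_left, ENNReal.tsum_mul_left,
          Summable.tsum_finsetSum fun _ _ => ENNReal.summable]
    _ ≤ ENNReal.ofReal C ^ τ * (4 ^ (τ - 1) *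
          ∑ _i : Fin 2 × Fin 2, K * mixedModulus G H β₁ β₂ δ₁ δ₂ x ^ τ) := by
        gcongr with i
        exact (hK G H (y i)).trans (by gcongr; exact hy i)
    _ = _ := by
        rw [Finset.sum_const, Finset.card_univ]
        simp only [Fintype.card_prod, Fintype.card_fin, nsmul_eq_mul]
        push_cast
        rw [ENNReal.coe_rpow_of_nonneg _ hτ0, ENNReal.coe_rpow_of_nonneg _ (by linarith)]
        rw [show ENNReal.ofReal C = (C.toNNReal : ℝ≥0∞) from rfl]
        push_cast
        ring

end PeriodicGroup

lemma sum_cutQ_eventually_eq_one {m : ℤ} (hm : m ≠ 0) :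
    ∀ᶠ N in Filter.atTop, ∑ j ∈ Finset.range (N + 1), cutQ ((m : ℝ) / 2 ^ j) = 1 := by
  filter_upwards [Filter.eventually_ge_atTop m.natAbs] with N hN
  rw [sum_cutQ hm, bump_eq_one]
  have h1 : (N : ℝ) < 2 ^ N := by exact_mod_cast Nat.lt_two_pow_self
  have h2 : |(m : ℝ)| ≤ N := by
    rw [← Int.cast_abs, Int.abs_eq_natAbs]; exact_mod_cast hN
  rw [abs_div, abs_of_pos (by positivity : (0 : ℝ) < 2 ^ N), div_le_one (by positivity)]
  linarith

namespace PeriodicGroup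

variable {X : Type*} [NormedAddCommGroup X] [NormedSpace ℂ X] [CompleteSpace X]
variable {G H : PeriodicGroup X}

lemma proj_proj_hasSum {z : ℕ × ℕ → X} {S : X} (hS : HasSum z S) {u : ℤ → ℤ → X}
    (hz : ∀ m n j, G.proj m (H.proj n (z j)) =
      ((cutQ ((m : ℝ) / 2 ^ j.1) : ℂ) * (cutQ ((n : ℝ) / 2 ^ j.2) : ℂ)) • u m n)
    (hu : ∀ m n, m = 0 ∨ n = 0 → u m n = 0) (m n : ℤ) :
    G.proj m (H.proj n S) = u m n := by
  have h1 : HasSum (fun j => G.proj m (H.proj n (z j))) (G.proj m (H.proj n S)) :=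
    (hS.map (H.proj n) (H.proj n).continuous).map (G.proj m) (G.proj m).continuous
  by_cases h0 : m = 0 ∨ n = 0
  · rw [hu m n h0]
    refine h1.unique ?_
    simp_rw [hz, hu m n h0, smul_zero]
    exact hasSum_zero
  push Not at h0
  have hmono : Filter.Tendsto (fun N => Finset.range (N + 1) ×ˢ Finset.range (N + 1))
      Filter.atTop (Filter.atTop : Filter (Finset (ℕ × ℕ))) := by
    refine Filter.tendsto_atTop_finset_of_monotone (fun a b hab => ?_) fun x => ?_
    · exact Finset.product_subset_product (Finset.range_mono (by omega))
        (Finset.range_mono (by omega))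
    · exact ⟨x.1 + x.2, by simp⟩
  refine tendsto_nhds_unique (h1.comp hmono) (tendsto_const_nhds.congr' ?_)
  filter_upwards [sum_cutQ_eventually_eq_one h0.1, sum_cutQ_eventually_eq_one h0.2] with N h2 h3
  simp only [Function.comp, hz]
  rw [← Finset.sum_smul, Finset.sum_product (s := Finset.range (N + 1))]
  simp_rw [← Finset.mul_sum, ← Finset.sum_mul]
  rw [← Complex.ofReal_sum, ← Complex.ofReal_sum, h2, h3]
  simp

lemma hasSymbol_diffOp_blockQ {γ : ℝ} (hγ : 0 < γ) (G : PeriodicGroup X) (h : ℝ) (j : ℕ) :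
    G.HasSymbol (G.diffOp γ h * G.blockQ j) fun m =>
      (1 - Complex.exp (-(Complex.I * m * h))) ^ (γ : ℂ) * cutQ ((m : ℝ) / 2 ^ j) :=
  (HasSymbol.diffOp hγ h).comp (.blockQ j)

variable (X) in
lemma exists_norm_diffOp_diffOp_blockQ_le {γ₁ γ₂ : ℝ} (hγ₁ : 0 < γ₁) (hγ₂ : 0 < γ₂) :
    ∃ C : ℝ, 0 < C ∧ ∀ (G H : PeriodicGroup X), Commuting G H → ∀ (x : X) (h₁ h₂ : ℝ)
      (j : ℕ × ℕ), ‖G.diffOp γ₁ h₁ (H.diffOp γ₂ h₂ (G.blockF j.1 (H.blockF j.2 x)))‖ ≤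
        C * (min 1 (2 ^ j.1 * |h₁|) ^ γ₁ * min 1 (2 ^ j.2 * |h₂|) ^ γ₂) * ‖x‖ := by
  obtain ⟨C₁, hC₁, h₁⟩ := exists_norm_diffOp_blockF_le X hγ₁
  obtain ⟨C₂, hC₂, h₂⟩ := exists_norm_diffOp_blockF_le X hγ₂
  refine ⟨C₁ * C₂, by positivity, fun G H hc x s t j => ?_⟩
  rw [← hc.apply (.blockF _) (.diffOp hγ₂ _)]
  refine (h₁ G s j.1 _).trans ?_
  refine (mul_le_mul_of_nonneg_left (h₂ H t j.2 x) (by positivity)).trans_eq ?_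
  ring

variable (X) in
lemma exists_mixedModulus_le_tsum {γ₁ γ₂ : ℝ} (hγ₁ : 0 < γ₁) (hγ₂ : 0 < γ₂) :
    ∃ C : NNReal, ∀ (G H : PeriodicGroup X), Commuting G H → ∀ (x : X) (t₁ t₂ : ℝ),
      (∀ n, G.proj 0 (H.proj n x) = 0) → (∀ m, G.proj m (H.proj 0 x) = 0) →
      mixedModulus G H γ₁ γ₂ t₁ t₂ x ≤ C * ∑' j : ℕ × ℕ, ENNReal.ofReal
        (min 1 (2 ^ j.1 * t₁) ^ γ₁ * min 1 (2 ^ j.2 * t₂) ^ γ₂) *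
          ‖G.blockQ j.1 (H.blockQ j.2 x)‖ₑ := by
  obtain ⟨C, hC, h⟩ := exists_norm_diffOp_diffOp_blockQ_le X hγ₁ hγ₂
  refine ⟨C.toNNReal, fun G H hc x t₁ t₂ hx₁ hx₂ => iSup₂_le fun h₁ hh₁ => iSup₂_le fun h₂ hh₂ =>
      ?_⟩
  set z : ℕ × ℕ → X := fun j => G.diffOp γ₁ h₁ (H.diffOp γ₂ h₂ (G.blockQ j.1 (H.blockQ j.2 x)))
    with hz
  have hzle : ∀ j, ‖z j‖ₑ ≤ (C.toNNReal : ℝ≥0∞) * (ENNReal.ofReal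
      (min 1 (2 ^ j.1 * t₁) ^ γ₁ * min 1 (2 ^ j.2 * t₂) ^ γ₂) *
        ‖G.blockQ j.1 (H.blockQ j.2 x)‖ₑ) := fun j => by
    have h3 := h G H hc (G.blockQ j.1 (H.blockQ j.2 x)) h₁ h₂ j
    rw [hc.apply (.blockQ j.1) (.blockQ j.2), ← mul_apply_eq_comp (H.blockF j.2),
      H.blockF_mul_blockQ, ← hc.apply (.blockQ j.1) (.blockQ j.2),
      ← mul_apply_eq_comp (G.blockF j.1), G.blockF_mul_blockQ] at h3
    have ht₁ : 0 ≤ t₁ := (abs_nonneg _).trans hh₁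
    have ht₂ : 0 ≤ t₂ := (abs_nonneg _).trans hh₂
    change _ ≤ ENNReal.ofReal C * _
    rw [← ofReal_norm, ← ofReal_norm, ← ENNReal.ofReal_mul (by positivity),
      ← ENNReal.ofReal_mul hC.le, ← mul_assoc]
    refine ENNReal.ofReal_le_ofReal (h3.trans ?_)
    gcongr
  rw [← ENNReal.tsum_mul_left]
  refine le_trans ?_ (ENNReal.tsum_le_tsum hzle)
  by_cases htop : ∑' j, ‖z j‖ₑ = ⊤
  · rw [htop]; exact le_top
  have hsum : Summable z := Summable.of_enorm htop
  have heq : G.diffOp γ₁ h₁ (H.diffOp γ₂ h₂ x) = ∑' j, z j := by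
    refine Commuting.ext (G := G) (H := H) fun m n => ?_
    rw [proj_proj_hasSum (G := G) (H := H) hsum.hasSum
      (u := fun m n => G.proj m (H.proj n (G.diffOp γ₁ h₁ (H.diffOp γ₂ h₂ x))))]
    · intro m n j
      have h5 : z j = (G.diffOp γ₁ h₁ * G.blockQ j.1) ((H.diffOp γ₂ h₂ * H.blockQ j.2) x) := by
        simp only [hz, mul_apply_eq_comp]
        rw [hc.apply (.blockQ _) (.diffOp hγ₂ _)]
      rw [h5, hc.proj_proj_apply (hasSymbol_diffOp_blockQ hγ₁ G h₁ _)
        (hasSymbol_diffOp_blockQ hγ₂ H h₂ _), hc.proj_proj_apply (.diffOp hγ₁ _) (.diffOp hγ₂ _),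
        smul_smul]
      congr 1; ring
    · intro m n hmn
      rw [hc.proj_proj_apply (.diffOp hγ₁ _) (.diffOp hγ₂ _)]
      rcases hmn with rfl | rfl
      · rw [hx₁, smul_zero]
      · rw [hx₂, smul_zero]
  rw [heq]
  exact enorm_tsum_le_tsum_enorm
end PeriodicGroup

lemma exists_tsum_geom_le {r : NNReal} (hr : r < 1) : ∃ B : NNReal, ∀ k : ℕ,
    ∑' j : ℕ, (r : ℝ≥0∞) ^ ((k : ℤ) - j).natAbs ≤ B := by
  obtain ⟨B, hB⟩ := exists_tsum_geom_schur hr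
  refine ⟨B, fun k => ?_⟩
  have h := hB 1 le_rfl (Pi.single k 1)
  simp only [ENNReal.rpow_one] at h
  rw [tsum_eq_single (f := (Pi.single k 1 : ℕ → ℝ≥0∞)) k fun j hj => by simp [hj],
    Pi.single_eq_same, mul_one] at h
  refine le_trans (ENNReal.tsum_le_tsum fun j => ?_) h
  rw [tsum_eq_single k fun i hi => by simp [hi]]
  rw [Pi.single_eq_same, mul_one, ← Int.natAbs_neg, neg_sub]

lemma exists_tsum_geom_schur_prod {r₁ r₂ : NNReal} (hr₁ : r₁ < 1) (hr₂ : r₂ < 1) :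
    ∃ B : NNReal, ∀ (s : ℝ), 1 ≤ s → ∀ a : ℕ × ℕ → ℝ≥0∞,
    ∑' k : ℕ × ℕ, (∑' j : ℕ × ℕ, ((r₁ : ℝ≥0∞) ^ ((k.1 : ℤ) - j.1).natAbs *
      (r₂ : ℝ≥0∞) ^ ((k.2 : ℤ) - j.2).natAbs) * a j) ^ s ≤ (B : ℝ≥0∞) ^ s * ∑' j, a j ^ s := by
  obtain ⟨B₁, hB₁⟩ := exists_tsum_geom_le hr₁
  obtain ⟨B₂, hB₂⟩ := exists_tsum_geom_le hr₂
  have key : ∀ k : ℕ × ℕ, ∑' j : ℕ × ℕ, ((r₁ : ℝ≥0∞) ^ ((k.1 : ℤ) - j.1).natAbs *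
      (r₂ : ℝ≥0∞) ^ ((k.2 : ℤ) - j.2).natAbs) ≤ (B₁ * B₂ : NNReal) := fun k => by
    rw [ENNReal.tsum_prod', ENNReal.coe_mul]
    simp_rw [ENNReal.tsum_mul_left]
    rw [ENNReal.tsum_mul_right]
    exact mul_le_mul' (hB₁ _) (hB₂ _)
  refine ⟨B₁ * B₂, fun s hs a => ENNReal.tsum_rpow_tsum_mul_le _ a hs key fun j => ?_⟩
  refine le_trans (ENNReal.tsum_le_tsum fun k => ?_) (key j)
  rw [← Int.natAbs_neg, neg_sub, ← Int.natAbs_neg ((k.2 : ℤ) - j.2), neg_sub]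

/-- The dyadic weight `2^{kρ} min(1, 2^k δ)^β`. -/
def dyadicWeight (ρ β δ : ℝ) (k : ℕ) : ℝ := (2 ^ k) ^ ρ * min 1 (2 ^ k * δ) ^ β

lemma dyadicWeight_nonneg {ρ β δ : ℝ} (hδ : 0 ≤ δ) (k : ℕ) : 0 ≤ dyadicWeight ρ β δ k := by
  unfold dyadicWeight; positivity

lemma dyadicWeight_mul_le {ρ α β δ : ℝ} (hβ : 0 ≤ β) (hδ : 0 < δ) (k j : ℕ) :
    dyadicWeight ρ β δ k * min 1 (2 ^ j * (2 ^ k)⁻¹) ^ (ρ + α + β) ≤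
      (2 ^ (-(min ρ α))) ^ ((k : ℤ) - j).natAbs * dyadicWeight ρ β δ j := by
  have h2 : (1 : ℝ) < 2 := by norm_num
  unfold dyadicWeight
  rcases le_total k j with hkj | hkj
  · obtain ⟨n, rfl⟩ := Nat.exists_eq_add_of_le hkj
    have h1 : ((k : ℤ) - (k + n : ℕ)).natAbs = n := by omega
    have h3 : (2 : ℝ) ^ (k + n) * (2 ^ k)⁻¹ = 2 ^ n := by rw [pow_add]; field_simp
    rw [h1, h3, min_eq_left (one_le_pow₀ h2.le), one_rpow, mul_one]
    have h4 : (2 : ℝ) ^ (k + n) = 2 ^ k * 2 ^ n := pow_add _ _ _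
    have h5 : 1 ≤ (2 ^ (-(min ρ α)) : ℝ) ^ n * (2 ^ n) ^ ρ := by
      rw [← rpow_natCast, ← rpow_natCast, ← rpow_mul zero_le_two, ← rpow_mul zero_le_two,
        ← rpow_add (by norm_num)]
      refine one_le_rpow h2.le ?_
      have := min_le_left ρ α
      have h0 : (0 : ℝ) ≤ n := n.cast_nonneg
      nlinarith
    calc ((2 : ℝ) ^ k) ^ ρ * min 1 (2 ^ k * δ) ^ β ≤
          ((2 : ℝ) ^ k) ^ ρ * min 1 (2 ^ (k + n) * δ) ^ β := by
          gcongr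
          · norm_num
      _ ≤ ((2 ^ (-(min ρ α)) : ℝ) ^ n * (2 ^ n) ^ ρ) *
          (((2 : ℝ) ^ k) ^ ρ * min 1 (2 ^ (k + n) * δ) ^ β) :=
          le_mul_of_one_le_left (by positivity) h5
      _ = _ := by rw [h4, mul_rpow (by positivity) (by positivity)]; ring
  · obtain ⟨n, rfl⟩ := Nat.exists_eq_add_of_le hkj
    have h1 : (((j + n : ℕ) : ℤ) - j).natAbs = n := by omega
    have h3 : (2 : ℝ) ^ j * (2 ^ (j + n))⁻¹ = (2 ^ n)⁻¹ := by rw [pow_add]; field_simp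
    have h6 : (1 : ℝ) ≤ 2 ^ n := one_le_pow₀ h2.le
    have h4 : (2 : ℝ) ^ (j + n) = 2 ^ j * 2 ^ n := pow_add _ _ _
    rw [h1, h3, min_eq_right (inv_le_one_of_one_le₀ h6)]
    have h5 : min 1 (2 ^ (j + n) * δ) ≤ 2 ^ n * min 1 (2 ^ j * δ) := by
      rw [mul_min_of_nonneg _ _ (by positivity)]
      refine min_le_min (by linarith) (by rw [h4]; exact le_of_eq (by ring))
    have h7 : ((2 : ℝ) ^ n) ^ ρ * (2 ^ n) ^ β * ((2 ^ n)⁻¹) ^ (ρ + α + β) ≤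
        (2 ^ (-(min ρ α)) : ℝ) ^ n := by
      rw [← rpow_neg_one, ← rpow_mul (by positivity), ← rpow_add (by positivity),
        ← rpow_add (by positivity), ← rpow_natCast, ← rpow_natCast, ← rpow_mul zero_le_two,
        ← rpow_mul zero_le_two]
      refine rpow_le_rpow_of_exponent_le h2.le ?_
      have := min_le_right ρ α
      have h0 : (0 : ℝ) ≤ n := n.cast_nonneg
      nlinarith
    calc ((2 : ℝ) ^ (j + n)) ^ ρ * min 1 (2 ^ (j + n) * δ) ^ β * ((2 ^ n)⁻¹) ^ (ρ + α + β)
        ≤ ((2 : ℝ) ^ (j + n)) ^ ρ * (2 ^ n * min 1 (2 ^ j * δ)) ^ β *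
          ((2 ^ n)⁻¹) ^ (ρ + α + β) := by gcongr
      _ = (((2 : ℝ) ^ n) ^ ρ * (2 ^ n) ^ β * ((2 ^ n)⁻¹) ^ (ρ + α + β)) *
          ((2 ^ j) ^ ρ * min 1 (2 ^ j * δ) ^ β) := by
          rw [h4, mul_rpow (by positivity) (by positivity),
            mul_rpow (by positivity) (by positivity)]; ring
      _ ≤ _ := by gcongr

namespace PeriodicGroup

variable {X : Type*} [NormedAddCommGroup X] [NormedSpace ℂ X] [CompleteSpace X]
variable {G H : PeriodicGroup X}

variable (X) in
lemma exists_derivOp (γ : ℝ) : ∃ C : ℝ, 0 < C ∧ ∀ (G : PeriodicGroup X) (j : ℕ),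
    ∃ V : X →L[ℂ] X, G.HasSymbol V (fun m => cutF ((m : ℝ) / 2 ^ j) *
      (Complex.I * m) ^ (γ : ℂ)) ∧ ∀ x, ‖V x‖ ≤ C * (2 ^ j) ^ γ * ‖x‖ := by
  obtain ⟨A, hA, h⟩ := exists_isMult_deriv γ
  refine ⟨10 * A, by positivity, fun G j => ?_⟩
  have hF := h _ isCutoff_cutF
  refine ⟨((((2 : ℝ) ^ j) ^ γ : ℝ) : ℂ) • G.mult _ j, ((G.hasSymbol_mult hF j).smul _).congr
    fun m => ?_, fun x => ?_⟩
  · rw [Pi.smul_apply, smul_eq_mul]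
    rcases eq_or_ne m 0 with rfl | hm
    · simp [cutF_zero]
    · rw [mul_left_comm]
      congr 1
      have h1 : Complex.I * (((m : ℝ) / 2 ^ j : ℝ) : ℂ) ≠ 0 := by
        simp [hm]
      rw [← Complex.ofReal_mul_cpow (by positivity) _ h1]
      congr 1
      push_cast
      field_simp
  · rw [_root_.smul_apply, norm_smul, Complex.norm_real, Real.norm_eq_abs,
      abs_of_nonneg (by positivity)]
    have := ContinuousLinearMap.le_of_opNorm_le _ (G.norm_mult_le hF j) x
    calc _ ≤ ((2 : ℝ) ^ j) ^ γ * (10 * A * ‖x‖) := by gcongr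
      _ = _ := by ring

lemma cpow_neg_mul_cpow {m : ℤ} (hm : m ≠ 0) (ρ : ℝ) :
    (Complex.I * m) ^ ((-ρ : ℝ) : ℂ) * (Complex.I * m) ^ (ρ : ℂ) = 1 := by
  rw [← Complex.cpow_add _ _ (by simp [hm])]
  simp

variable (X) in
lemma exists_norm_blockQ_le_deriv (ρ₁ ρ₂ : ℝ) :
    ∃ C : ℝ, 0 < C ∧ ∀ (G H : PeriodicGroup X), Commuting G H → ∀ (x y : X),
      (∀ m n, G.proj m (H.proj n y) = ((Complex.I * (m : ℂ)) ^ (ρ₁ : ℂ) *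
        (Complex.I * (n : ℂ)) ^ (ρ₂ : ℂ)) • G.proj m (H.proj n x)) → ∀ j : ℕ × ℕ,
      (2 ^ j.1) ^ ρ₁ * (2 ^ j.2) ^ ρ₂ * ‖G.blockQ j.1 (H.blockQ j.2 x)‖ ≤
        C * ‖G.blockQ j.1 (H.blockQ j.2 y)‖ := by
  obtain ⟨C₁, hC₁, h₁⟩ := exists_derivOp X (-ρ₁)
  obtain ⟨C₂, hC₂, h₂⟩ := exists_derivOp X (-ρ₂)
  refine ⟨C₁ * C₂, by positivity, fun G H hc x y hxy j => ?_⟩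
  obtain ⟨V, hV, hV'⟩ := h₁ G j.1
  obtain ⟨W, hW, hW'⟩ := h₂ H j.2
  have heq : G.blockQ j.1 (H.blockQ j.2 x) = V (W (G.blockQ j.1 (H.blockQ j.2 y))) := by
    rw [← hc.apply (.blockQ _) hW, ← mul_apply_eq_comp V, ← mul_apply_eq_comp W]
    refine Commuting.ext (G := G) (H := H) fun m n => ?_
    rw [hc.proj_proj_apply (.blockQ _) (.blockQ _),
      hc.proj_proj_apply (hV.comp (.blockQ _)) (hW.comp (.blockQ _)), hxy, smul_smul]
    rcases eq_or_ne m 0 with rfl | hm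
    · simp [cutQ_zero]
    rcases eq_or_ne n 0 with rfl | hn
    · simp [cutQ_zero]
    congr 1
    simp only [Pi.mul_apply]
    have e1 := cpow_neg_mul_cpow hm ρ₁
    have e2 := cpow_neg_mul_cpow hn ρ₂
    have e3 := congrArg (fun u : ℝ => (u : ℂ)) (cutF_mul_cutQ ((m : ℝ) / 2 ^ j.1))
    have e4 := congrArg (fun u : ℝ => (u : ℂ)) (cutF_mul_cutQ ((n : ℝ) / 2 ^ j.2))
    simp only [Complex.ofReal_mul] at e3 e4
    linear_combination -e3 * ((cutF ((n : ℝ) / 2 ^ j.2) : ℂ) * cutQ ((n : ℝ) / 2 ^ j.2)) -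
      cutQ ((m : ℝ) / 2 ^ j.1) * e4 + (-(cutF ((m : ℝ) / 2 ^ j.1) : ℂ) * cutQ ((m : ℝ) / 2 ^ j.1) *
      (cutF ((n : ℝ) / 2 ^ j.2) : ℂ) * cutQ ((n : ℝ) / 2 ^ j.2)) *
      ((Complex.I * n) ^ ((-ρ₂ : ℝ) : ℂ) * (Complex.I * n) ^ (ρ₂ : ℂ) * e1 + e2)
  rw [heq]
  calc _ ≤ (2 ^ j.1) ^ ρ₁ * (2 ^ j.2) ^ ρ₂ * (C₁ * (2 ^ j.1) ^ (-ρ₁) *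
        (C₂ * (2 ^ j.2) ^ (-ρ₂) * ‖G.blockQ j.1 (H.blockQ j.2 y)‖)) := by
        gcongr
        exact (hV' _).trans (by gcongr; exact hW' _)
    _ = _ := by
        rw [rpow_neg (by positivity), rpow_neg (by positivity)]
        field_simp

/-- The lower bound for the modulus of a mixed derivative. -/
theorem exists_tsum_dyadicWeight_mul_mixedModulus_le {τ ρ₁ ρ₂ α₁ α₂ β₁ β₂ : ℝ} (hτ : 1 ≤ τ)
    (hX : IsotropicConvex X τ) (hρ₁ : 0 < ρ₁) (hρ₂ : 0 < ρ₂) (hα₁ : 0 < α₁) (hα₂ : 0 < α₂)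
    (hβ₁ : 0 < β₁) (hβ₂ : 0 < β₂) :
    ∃ C : NNReal, ∀ (G H : PeriodicGroup X), Commuting G H → ∀ (x y : X) (δ₁ δ₂ : ℝ),
      0 < δ₁ → 0 < δ₂ →
      (∀ n, G.proj 0 (H.proj n x) = 0) → (∀ m, G.proj m (H.proj 0 x) = 0) →
      (∀ m n, G.proj m (H.proj n y) = ((Complex.I * (m : ℂ)) ^ (ρ₁ : ℂ) *
        (Complex.I * (n : ℂ)) ^ (ρ₂ : ℂ)) • G.proj m (H.proj n x)) →
      ∑' k : ℕ × ℕ, (ENNReal.ofReal (dyadicWeight ρ₁ β₁ δ₁ k.1 * dyadicWeight ρ₂ β₂ δ₂ k.2) *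
        mixedModulus G H (ρ₁ + α₁ + β₁) (ρ₂ + α₂ + β₂) (2 ^ k.1)⁻¹ (2 ^ k.2)⁻¹ x) ^ τ ≤
          C * mixedModulus G H β₁ β₂ δ₁ δ₂ y ^ τ := by
  have hτ0 : 0 ≤ τ := by linarith
  have hlt : ∀ {ρ α : ℝ}, 0 < ρ → 0 < α → ((2 : ℝ) ^ (-(min ρ α))).toNNReal < 1 := by
    intro ρ α h1 h2
    rw [Real.toNNReal_lt_one]
    exact rpow_lt_one_of_one_lt_of_neg (by norm_num) (by simp [h1, h2])
  obtain ⟨C₁, hC₁⟩ := exists_mixedModulus_le_tsum X (γ₁ := ρ₁ + α₁ + β₁) (γ₂ := ρ₂ + α₂ + β₂)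
    (by positivity) (by positivity)
  obtain ⟨B, hB⟩ := exists_tsum_geom_schur_prod (hlt hρ₁ hα₁) (hlt hρ₂ hα₂)
  obtain ⟨C₂, hC₂0, hC₂⟩ := exists_norm_blockQ_le_deriv X ρ₁ ρ₂
  obtain ⟨C₃, hC₃⟩ := exists_tsum_weight_mul_blockQ_le hτ hX hβ₁ hβ₂
  refine ⟨C₁ ^ τ * (B ^ τ * (C₂.toNNReal ^ τ * C₃)), fun G H hc x y δ₁ δ₂ hδ₁ hδ₂ hx₁ hx₂ hxy => ?_⟩
  set q : ℕ × ℕ → ℝ≥0∞ := fun j => ‖G.blockQ j.1 (H.blockQ j.2 x)‖ₑ with hq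
  set a : ℕ × ℕ → ℝ≥0∞ := fun j =>
    ENNReal.ofReal (dyadicWeight ρ₁ β₁ δ₁ j.1 * dyadicWeight ρ₂ β₂ δ₂ j.2) * q j with ha
  calc _ ≤ ∑' k : ℕ × ℕ, (C₁ * ∑' j : ℕ × ℕ,
        ((((2 : ℝ) ^ (-(min ρ₁ α₁))).toNNReal : ℝ≥0∞) ^ ((k.1 : ℤ) - j.1).natAbs *
        (((2 : ℝ) ^ (-(min ρ₂ α₂))).toNNReal : ℝ≥0∞) ^ ((k.2 : ℤ) - j.2).natAbs) * a j) ^ τ := by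
        refine ENNReal.tsum_le_tsum fun k => ENNReal.rpow_le_rpow ?_ hτ0
        refine (mul_le_mul_right (hC₁ G H hc x _ _ hx₁ hx₂) _).trans ?_
        rw [mul_left_comm, ← ENNReal.tsum_mul_left]
        refine mul_le_mul_right (ENNReal.tsum_le_tsum fun j => ?_) _
        simp only [ha]
        rw [← mul_assoc, ← mul_assoc]
        refine mul_le_mul_left ?_ _
        change _ ≤ ENNReal.ofReal _ ^ _ * ENNReal.ofReal _ ^ _ * _
        rw [← ENNReal.ofReal_pow (by positivity), ← ENNReal.ofReal_pow (by positivity),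
          ← ENNReal.ofReal_mul (mul_nonneg (dyadicWeight_nonneg hδ₁.le _)
            (dyadicWeight_nonneg hδ₂.le _)), ← ENNReal.ofReal_mul (by positivity),
          ← ENNReal.ofReal_mul (by positivity)]
        refine ENNReal.ofReal_le_ofReal ?_
        have h1 := dyadicWeight_mul_le (ρ := ρ₁) (α := α₁) hβ₁.le hδ₁ k.1 j.1
        have h2 := dyadicWeight_mul_le (ρ := ρ₂) (α := α₂) hβ₂.le hδ₂ k.2 j.2
        have h3 := mul_le_mul h1 h2 (mul_nonneg (dyadicWeight_nonneg hδ₂.le _) (by positivity))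
          (mul_nonneg (by positivity) (dyadicWeight_nonneg hδ₁.le _))
        linarith
    _ = C₁ ^ τ * ∑' k : ℕ × ℕ, (∑' j : ℕ × ℕ,
        ((((2 : ℝ) ^ (-(min ρ₁ α₁))).toNNReal : ℝ≥0∞) ^ ((k.1 : ℤ) - j.1).natAbs *
        (((2 : ℝ) ^ (-(min ρ₂ α₂))).toNNReal : ℝ≥0∞) ^ ((k.2 : ℤ) - j.2).natAbs) * a j) ^ τ := by
        simp_rw [ENNReal.mul_rpow_of_nonneg _ _ hτ0]
        rw [ENNReal.tsum_mul_left]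
    _ ≤ C₁ ^ τ * (B ^ τ * ∑' j, a j ^ τ) := by gcongr; exact hB τ hτ a
    _ ≤ C₁ ^ τ * (B ^ τ * (ENNReal.ofReal C₂ ^ τ * (C₃ * mixedModulus G H β₁ β₂ δ₁ δ₂ y ^ τ))) := by
        gcongr
        refine le_trans ?_ (mul_le_mul_right (hC₃ G H hc y δ₁ δ₂ hδ₁ hδ₂) _)
        rw [← ENNReal.tsum_mul_left]
        refine ENNReal.tsum_le_tsum fun j => ?_
        rw [← ENNReal.mul_rpow_of_nonneg _ _ hτ0]
        refine ENNReal.rpow_le_rpow ?_ hτ0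
        simp only [ha, hq]
        rw [← ofReal_norm, ← ofReal_norm, ← ENNReal.ofReal_mul (mul_nonneg
          (dyadicWeight_nonneg hδ₁.le _) (dyadicWeight_nonneg hδ₂.le _)),
          ← ENNReal.ofReal_mul (by positivity), ← ENNReal.ofReal_mul hC₂0.le]
        refine ENNReal.ofReal_le_ofReal ?_
        have h1 := mul_le_mul_of_nonneg_left (hC₂ G H hc x y hxy j)
          (by positivity : 0 ≤ min 1 (2 ^ j.1 * δ₁) ^ β₁ * min 1 (2 ^ j.2 * δ₂) ^ β₂)
        unfold dyadicWeight
        linarith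
    _ = _ := by
        push_cast
        rw [ENNReal.coe_rpow_of_nonneg _ hτ0, ENNReal.coe_rpow_of_nonneg _ hτ0,
          ENNReal.coe_rpow_of_nonneg _ hτ0]
        rw [show ENNReal.ofReal C₂ = (C₂.toNNReal : ℝ≥0∞) from rfl]
        ring

end PeriodicGroup

namespace PeriodicGroup

variable {X : Type*} [NormedAddCommGroup X] [NormedSpace ℂ X] [CompleteSpace X]
variable {G H : PeriodicGroup X}

variable (X) in
lemma exists_enorm_blockQ_le_mixedModulus {γ₁ γ₂ : ℝ} (hγ₁ : 0 < γ₁) (hγ₂ : 0 < γ₂) :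
    ∃ C : NNReal, ∀ (G H : PeriodicGroup X), Commuting G H → ∀ (x : X) (j : ℕ × ℕ),
      ‖G.blockQ j.1 (H.blockQ j.2 x)‖ₑ ≤
        C * mixedModulus G H γ₁ γ₂ (2 ^ (j.1 + 1))⁻¹ (2 ^ (j.2 + 1))⁻¹ x := by
  obtain ⟨C₁, hC₁, h₁⟩ := exists_le_norm_blockQ_diffOp X hγ₁
  obtain ⟨C₂, hC₂, h₂⟩ := exists_le_norm_blockQ_diffOp X hγ₂
  refine ⟨(((1 / 4 : ℝ) ^ γ₁)⁻¹ * C₁ * (((1 / 4 : ℝ) ^ γ₂)⁻¹ * C₂) * (100 * 100)).toNNReal,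
    fun G H hc x j => ?_⟩
  have hs : ∀ i : ℕ, (0 : ℝ) < (2 ^ (i + 2))⁻¹ := fun i => by positivity
  have hs' : ∀ i : ℕ, (2 : ℝ) ^ i * |(2 ^ (i + 2))⁻¹| = 1 / 4 := fun i => by
    rw [abs_of_pos (hs i), pow_add]; field_simp; norm_num
  have hs2 : ∀ i : ℕ, |((2 : ℝ) ^ (i + 2))⁻¹| ≤ (2 ^ (i + 1))⁻¹ := fun i => by
    rw [abs_of_pos (hs i)]
    gcongr
    · norm_num
    · omega
  set s := ((2 : ℝ) ^ (j.1 + 2))⁻¹ with hsdef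
  set t := ((2 : ℝ) ^ (j.2 + 2))⁻¹ with htdef
  have e1 : ‖G.blockQ j.1 (H.blockQ j.2 x)‖ ≤ ((1 / 4 : ℝ) ^ γ₁)⁻¹ * C₁ *
      ‖G.blockQ j.1 (G.diffOp γ₁ s (H.blockQ j.2 x))‖ := by
    have := h₁ G s j.1 (H.blockQ j.2 x) (hs _).ne' (hs' _).le
    rw [hs'] at this
    rw [mul_assoc]
    exact (le_inv_mul_iff₀ (by positivity)).2 this
  have c1 : G.blockQ j.1 (G.diffOp γ₁ s (H.blockQ j.2 x)) =
      H.blockQ j.2 (G.blockQ j.1 (G.diffOp γ₁ s x)) := by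
    rw [hc.apply (.diffOp hγ₁ _) (.blockQ _), hc.apply (.blockQ _) (.blockQ _)]
  have e2 : ‖H.blockQ j.2 (G.blockQ j.1 (G.diffOp γ₁ s x))‖ ≤ ((1 / 4 : ℝ) ^ γ₂)⁻¹ * C₂ *
      ‖H.blockQ j.2 (H.diffOp γ₂ t (G.blockQ j.1 (G.diffOp γ₁ s x)))‖ := by
    have := h₂ H t j.2 (G.blockQ j.1 (G.diffOp γ₁ s x)) (hs _).ne' (hs' _).le
    rw [hs'] at this
    rw [mul_assoc]
    exact (le_inv_mul_iff₀ (by positivity)).2 this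
  have c2 : H.diffOp γ₂ t (G.blockQ j.1 (G.diffOp γ₁ s x)) =
      G.blockQ j.1 (G.diffOp γ₁ s (H.diffOp γ₂ t x)) := by
    rw [← hc.apply (.blockQ _) (.diffOp hγ₂ _), ← hc.apply (.diffOp hγ₁ _) (.diffOp hγ₂ _)]
  have e3 : ‖H.blockQ j.2 (G.blockQ j.1 (G.diffOp γ₁ s (H.diffOp γ₂ t x)))‖ ≤
      100 * (100 * ‖G.diffOp γ₁ s (H.diffOp γ₂ t x)‖) :=
    (ContinuousLinearMap.le_of_opNorm_le _ (H.norm_blockQ_le _) _).trans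
      (mul_le_mul_of_nonneg_left (ContinuousLinearMap.le_of_opNorm_le _ (G.norm_blockQ_le _) _)
        (by norm_num))
  rw [c1] at e1
  rw [c2] at e2
  refine le_trans ?_ (mul_le_mul_right (enorm_le_mixedModulus (hs2 j.1) (hs2 j.2) x) _)
  change _ ≤ ENNReal.ofReal _ * _
  rw [← ofReal_norm, ← ofReal_norm, ← ENNReal.ofReal_mul (by positivity)]
  refine ENNReal.ofReal_le_ofReal ?_
  calc _ ≤ ((1 / 4 : ℝ) ^ γ₁)⁻¹ * C₁ * (((1 / 4 : ℝ) ^ γ₂)⁻¹ * C₂ *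
        (100 * (100 * ‖G.diffOp γ₁ s (H.diffOp γ₂ t x)‖))) := by
        refine e1.trans (mul_le_mul_of_nonneg_left (e2.trans
          (mul_le_mul_of_nonneg_left e3 (by positivity))) (by positivity))
    _ = _ := by ring

variable (X) in
lemma exists_derivBlock (ρ₁ ρ₂ : ℝ) :
    ∃ C : ℝ, 0 < C ∧ ∀ (G H : PeriodicGroup X), Commuting G H → ∀ (x : X) (j : ℕ × ℕ),
      ∃ y, (∀ m n, G.proj m (H.proj n y) =
          ((cutQ ((m : ℝ) / 2 ^ j.1) : ℂ) * (cutQ ((n : ℝ) / 2 ^ j.2) : ℂ)) •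
            ((Complex.I * (m : ℂ)) ^ (ρ₁ : ℂ) * (Complex.I * (n : ℂ)) ^ (ρ₂ : ℂ)) •
              G.proj m (H.proj n x)) ∧
        G.blockF j.1 (H.blockF j.2 y) = y ∧
        ‖y‖ ≤ C * ((2 ^ j.1) ^ ρ₁ * (2 ^ j.2) ^ ρ₂) * ‖G.blockQ j.1 (H.blockQ j.2 x)‖ := by
  obtain ⟨C₁, hC₁, h₁⟩ := exists_derivOp X ρ₁
  obtain ⟨C₂, hC₂, h₂⟩ := exists_derivOp X ρ₂
  refine ⟨C₁ * C₂, by positivity, fun G H hc x j => ?_⟩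
  obtain ⟨V, hV, hV'⟩ := h₁ G j.1
  obtain ⟨W, hW, hW'⟩ := h₂ H j.2
  have heq : V (W (G.blockQ j.1 (H.blockQ j.2 x))) = (V * G.blockQ j.1) ((W * H.blockQ j.2) x) := by
    simp only [mul_apply_eq_comp]
    rw [← hc.apply (.blockQ _) hW]
  have hcut : ∀ (m : ℤ) (i : ℕ), (cutF ((m : ℝ) / 2 ^ i) : ℂ) * (cutQ ((m : ℝ) / 2 ^ i) : ℂ) =
      cutQ ((m : ℝ) / 2 ^ i) := fun m i => by rw [← Complex.ofReal_mul, cutF_mul_cutQ]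
  have hP : ∀ m n, G.proj m (H.proj n (V (W (G.blockQ j.1 (H.blockQ j.2 x))))) =
          ((cutQ ((m : ℝ) / 2 ^ j.1) : ℂ) * (cutQ ((n : ℝ) / 2 ^ j.2) : ℂ)) •
            ((Complex.I * (m : ℂ)) ^ (ρ₁ : ℂ) * (Complex.I * (n : ℂ)) ^ (ρ₂ : ℂ)) •
              G.proj m (H.proj n x) := fun m n => by
    rw [heq, hc.proj_proj_apply (hV.comp (.blockQ _)) (hW.comp (.blockQ _)), smul_smul]
    congr 1
    simp only [Pi.mul_apply]
    rw [← hcut m, ← hcut n, hcut m, hcut n]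
    linear_combination (Complex.I * (m : ℂ)) ^ (ρ₁ : ℂ) * (Complex.I * (n : ℂ)) ^ (ρ₂ : ℂ) *
      (hcut m j.1 * (cutF ((n : ℝ) / 2 ^ j.2) * cutQ ((n : ℝ) / 2 ^ j.2)) +
        cutQ ((m : ℝ) / 2 ^ j.1) * hcut n j.2)
  refine ⟨V (W (G.blockQ j.1 (H.blockQ j.2 x))), hP, ?_, ?_⟩
  · refine Commuting.ext (G := G) (H := H) fun m n => ?_
    rw [hc.proj_proj_apply (.blockF _) (.blockF _), hP, smul_smul]
    congr 1
    linear_combination (hcut m j.1 * (cutF ((n : ℝ) / 2 ^ j.2) * cutQ ((n : ℝ) / 2 ^ j.2)) +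
        cutQ ((m : ℝ) / 2 ^ j.1) * hcut n j.2)
  · refine (hV' _).trans ((mul_le_mul_of_nonneg_left (hW' _) (by positivity)).trans_eq ?_)
    ring

lemma summable_of_enorm_rpow {θ : ℝ} (hθ : 0 < θ) {C : NNReal} {z : ℕ × ℕ → X}
    (hC : ∀ S : Finset (ℕ × ℕ), ‖∑ j ∈ S, z j‖ₑ ^ θ ≤ C * ∑ j ∈ S, ‖z j‖ₑ ^ θ)
    (hz : ∑' j, ‖z j‖ₑ ^ θ ≠ ⊤) : Summable z := by
  rw [summable_iff_vanishing_norm]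
  intro ε hε
  have h1 : Filter.Tendsto (fun S : Finset (ℕ × ℕ) => (C : ℝ≥0∞) * ∑' j : {j // j ∉ S}, ‖z j‖ₑ ^ θ)
      Filter.atTop (nhds (C * 0)) :=
    ENNReal.Tendsto.const_mul (ENNReal.tendsto_tsum_compl_atTop_zero hz) (Or.inr ENNReal.coe_ne_top)
  rw [mul_zero] at h1
  have h2 : (0 : ℝ≥0∞) < ENNReal.ofReal ε ^ θ :=
    ENNReal.rpow_pos (by simpa using hε) ENNReal.ofReal_ne_top
  obtain ⟨S, hS⟩ := (h1.eventually (gt_mem_nhds h2)).exists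
  refine ⟨S, fun T hT => ?_⟩
  have h3 : ‖∑ j ∈ T, z j‖ₑ ^ θ < ENNReal.ofReal ε ^ θ := by
    refine (hC T).trans_lt (lt_of_le_of_lt (mul_le_mul_right ?_ _) hS)
    rw [← Finset.tsum_subtype T fun j => ‖z j‖ₑ ^ θ]
    exact ENNReal.tsum_mono_subtype (fun j => ‖z j‖ₑ ^ θ)
      fun j hj hj' => Finset.disjoint_left.1 hT hj hj'
  have h4 := (ENNReal.rpow_lt_rpow_iff hθ).1 h3
  rw [← ofReal_norm] at h4
  exact (ENNReal.ofReal_lt_ofReal_iff hε).1 h4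

/-- Existence of a mixed derivative and the upper bound for its modulus. -/
theorem exists_deriv_mixedModulus_le {θ ρ₁ ρ₂ γ₁ γ₂ β₁ β₂ : ℝ} (hθ : 1 ≤ θ)
    (hX : IsotropicSmooth X θ) (hρ₁ : 0 < ρ₁) (hρ₂ : 0 < ρ₂) (hγ₁ : 0 < γ₁) (hγ₂ : 0 < γ₂)
    (hβ₁ : 0 < β₁) (hβ₂ : 0 < β₂) :
    ∃ C : NNReal, ∀ (G H : PeriodicGroup X), Commuting G H → ∀ x : X,
      ∑' k : ℕ × ℕ, (ENNReal.ofReal ((2 ^ k.1) ^ ρ₁ * (2 ^ k.2) ^ ρ₂) *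
        mixedModulus G H γ₁ γ₂ (2 ^ (k.1 + 1))⁻¹ (2 ^ (k.2 + 1))⁻¹ x) ^ θ ≠ ⊤ →
      ∃ y, (∀ m n, G.proj m (H.proj n y) = ((Complex.I * (m : ℂ)) ^ (ρ₁ : ℂ) *
          (Complex.I * (n : ℂ)) ^ (ρ₂ : ℂ)) • G.proj m (H.proj n x)) ∧
        ∀ δ₁ δ₂ : ℝ, 0 < δ₁ → 0 < δ₂ → mixedModulus G H β₁ β₂ δ₁ δ₂ y ^ θ ≤
          C * ∑' k : ℕ × ℕ, (ENNReal.ofReal (dyadicWeight ρ₁ β₁ δ₁ k.1 *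
            dyadicWeight ρ₂ β₂ δ₂ k.2) *
              mixedModulus G H γ₁ γ₂ (2 ^ (k.1 + 1))⁻¹ (2 ^ (k.2 + 1))⁻¹ x) ^ θ := by
  have hθ0 : 0 < θ := by linarith
  obtain ⟨C₁, h₁⟩ := exists_enorm_blockQ_le_mixedModulus X hγ₁ hγ₂
  obtain ⟨C₂, hC₂, h₂⟩ := exists_derivBlock X ρ₁ ρ₂
  obtain ⟨C₃, h₃⟩ := exists_enorm_sum_blockF_blockF_le hθ hX
  obtain ⟨C₄, hC₄, h₄⟩ := exists_norm_diffOp_diffOp_blockQ_le X hβ₁ hβ₂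
  refine ⟨C₃ * (C₄.toNNReal * C₂.toNNReal * C₁) ^ θ, fun G H hc x hx => ?_⟩
  choose z hzP hzF hzn using h₂ G H hc x
  set Ω : ℕ × ℕ → ℝ≥0∞ := fun k =>
    mixedModulus G H γ₁ γ₂ (2 ^ (k.1 + 1))⁻¹ (2 ^ (k.2 + 1))⁻¹ x with hΩ
  have hzn' : ∀ j, ‖z j‖ₑ ≤ C₂.toNNReal * C₁ *
      (ENNReal.ofReal ((2 ^ j.1) ^ ρ₁ * (2 ^ j.2) ^ ρ₂) * Ω j) := fun j => by
    calc ‖z j‖ₑ ≤ ENNReal.ofReal C₂ * ENNReal.ofReal ((2 ^ j.1) ^ ρ₁ * (2 ^ j.2) ^ ρ₂) *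
          ‖G.blockQ j.1 (H.blockQ j.2 x)‖ₑ := by
          rw [← ofReal_norm, ← ofReal_norm, ← ENNReal.ofReal_mul hC₂.le,
            ← ENNReal.ofReal_mul (by positivity)]
          exact ENNReal.ofReal_le_ofReal (hzn j)
      _ ≤ ENNReal.ofReal C₂ * ENNReal.ofReal ((2 ^ j.1) ^ ρ₁ * (2 ^ j.2) ^ ρ₂) * (C₁ * Ω j) := by
          gcongr; exact h₁ G H hc x j
      _ = _ := by
          rw [show ENNReal.ofReal C₂ = (C₂.toNNReal : ℝ≥0∞) from rfl]; ring
  have hzsum : ∑' j, ‖z j‖ₑ ^ θ ≠ ⊤ := by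
    refine ne_top_of_le_ne_top (ENNReal.mul_ne_top (ENNReal.rpow_ne_top_of_nonneg hθ0.le
      (ENNReal.mul_ne_top (ENNReal.coe_ne_top (r := C₂.toNNReal))
        (ENNReal.coe_ne_top (r := C₁)))) hx) ?_
    rw [← ENNReal.tsum_mul_left]
    refine ENNReal.tsum_le_tsum fun j => ?_
    rw [← ENNReal.mul_rpow_of_nonneg _ _ hθ0.le]
    exact ENNReal.rpow_le_rpow (hzn' j) hθ0.le
  have hsum : Summable z := by
    refine summable_of_enorm_rpow hθ0 (C := C₃) (fun S => ?_) hzsum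
    have := h₃ G H S z
    simp_rw [hzF] at this
    exact this
  refine ⟨∑' j, z j, fun m n => proj_proj_hasSum (G := G) (H := H) hsum.hasSum (u := fun m n =>
    ((Complex.I * (m : ℂ)) ^ (ρ₁ : ℂ) * (Complex.I * (n : ℂ)) ^ (ρ₂ : ℂ)) •
      G.proj m (H.proj n x)) (fun m n j => hzP j m n) ?_ m n, fun δ₁ δ₂ hδ₁ hδ₂ => ?_⟩
  · rintro m n (rfl | rfl)
    · simp [hρ₁.ne']
    · simp [hρ₂.ne']
  rw [← ENNReal.le_rpow_inv_iff hθ0]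
  refine iSup₂_le fun s hs => iSup₂_le fun t ht => ?_
  rw [ENNReal.le_rpow_inv_iff hθ0]
  set w : ℕ × ℕ → X := fun j => G.diffOp β₁ s (H.diffOp β₂ t (z j)) with hw
  have hwF : ∀ j, G.blockF j.1 (H.blockF j.2 (w j)) = w j := fun j => by
    simp only [hw]
    rw [← hc.apply (.diffOp hβ₁ _) (.blockF _),
      (HasSymbol.blockF (G := G) j.1).commute fun u v => (HasSymbol.diffOp hβ₁ s).commute_op u v,
      (HasSymbol.blockF (G := H) j.2).commute fun u v => (HasSymbol.diffOp hβ₂ t).commute_op u v,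
      hc.apply (.blockF _) (.diffOp hβ₂ _), hzF]
  have hwle : ∀ j, ‖w j‖ₑ ≤ C₄.toNNReal * C₂.toNNReal * C₁ * (ENNReal.ofReal
      (dyadicWeight ρ₁ β₁ δ₁ j.1 * dyadicWeight ρ₂ β₂ δ₂ j.2) * Ω j) := fun j => by
    have e := h₄ G H hc (z j) s t j
    rw [hzF] at e
    calc ‖w j‖ₑ ≤ ENNReal.ofReal C₄ * ENNReal.ofReal
          (min 1 (2 ^ j.1 * δ₁) ^ β₁ * min 1 (2 ^ j.2 * δ₂) ^ β₂) * ‖z j‖ₑ := by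
          rw [← ofReal_norm, ← ofReal_norm, ← ENNReal.ofReal_mul hC₄.le,
            ← ENNReal.ofReal_mul (by positivity)]
          refine ENNReal.ofReal_le_ofReal (e.trans ?_)
          gcongr
      _ ≤ ENNReal.ofReal C₄ * ENNReal.ofReal
          (min 1 (2 ^ j.1 * δ₁) ^ β₁ * min 1 (2 ^ j.2 * δ₂) ^ β₂) * (C₂.toNNReal * C₁ *
            (ENNReal.ofReal ((2 ^ j.1) ^ ρ₁ * (2 ^ j.2) ^ ρ₂) * Ω j)) := by
          gcongr; exact hzn' j
      _ = ENNReal.ofReal C₄ * C₂.toNNReal * C₁ * (ENNReal.ofReal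
          (min 1 (2 ^ j.1 * δ₁) ^ β₁ * min 1 (2 ^ j.2 * δ₂) ^ β₂) *
            ENNReal.ofReal ((2 ^ j.1) ^ ρ₁ * (2 ^ j.2) ^ ρ₂) * Ω j) := by ring
      _ = _ := by
          rw [← ENNReal.ofReal_mul (by positivity)]
          unfold dyadicWeight
          congr 3
          ring
  have hwsum : HasSum w (G.diffOp β₁ s (H.diffOp β₂ t (∑' j, z j))) :=
    (hsum.hasSum.map (H.diffOp β₂ t) (H.diffOp β₂ t).continuous).map (G.diffOp β₁ s)
      (G.diffOp β₁ s).continuous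
  have hlim : Filter.Tendsto (fun S : Finset (ℕ × ℕ) => ‖∑ j ∈ S, w j‖ₑ ^ θ) Filter.atTop
      (nhds (‖G.diffOp β₁ s (H.diffOp β₂ t (∑' j, z j))‖ₑ ^ θ)) :=
    ((ENNReal.continuous_rpow_const.comp continuous_enorm).tendsto _).comp hwsum
  refine le_of_tendsto' hlim fun S => ?_
  have e := h₃ G H S w
  simp_rw [hwF] at e
  refine e.trans ?_
  rw [ENNReal.coe_mul, mul_assoc, ENNReal.coe_rpow_of_nonneg _ hθ0.le, ← ENNReal.tsum_mul_left]
  refine mul_le_mul_right ((ENNReal.sum_le_tsum S).trans (ENNReal.tsum_le_tsum fun j => ?_)) _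
  rw [← ENNReal.mul_rpow_of_nonneg _ _ hθ0.le]
  push_cast
  exact ENNReal.rpow_le_rpow (hwle j) hθ0.le

end PeriodicGroup

/-- The kernel `t^{-ρs} min(1, δ/t)^{βs} / t`. -/
def dyadicKernel (ρ β δ s t : ℝ) : ℝ := t ^ (-ρ * s) * min 1 (δ / t) ^ (β * s) / t

lemma dyadicKernel_nonneg {ρ β δ s t : ℝ} (hδ : 0 < δ) (ht : 0 < t) :
    0 ≤ dyadicKernel ρ β δ s t := by
  unfold dyadicKernel; positivity

lemma setLIntegral_Ioo_eq_tsum (F : ℝ → ℝ≥0∞) : ∫⁻ t in Set.Ioo (0 : ℝ) 1, F t =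
    ∑' k : ℕ, ∫⁻ t in Set.Ioc ((2 ^ (k + 1))⁻¹ : ℝ) (2 ^ k)⁻¹, F t := by
  have hU : Set.Ioc (0 : ℝ) 1 = ⋃ k : ℕ, Set.Ioc ((2 ^ (k + 1))⁻¹ : ℝ) (2 ^ k)⁻¹ := by
    ext t
    simp only [Set.mem_Ioc, Set.mem_iUnion]
    constructor
    · rintro ⟨h0, h1⟩
      obtain ⟨n, hn, hn'⟩ := exists_nat_pow_near_of_lt_one h0 h1 (y := (2 : ℝ)⁻¹) (by norm_num)
        (by norm_num)
      exact ⟨n, by simpa using hn, by simpa using hn'⟩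
    · rintro ⟨n, hn, hn'⟩
      refine ⟨lt_trans (by positivity) hn, hn'.trans (inv_le_one_of_one_le₀ ?_)⟩
      exact one_le_pow₀ (by norm_num)
  rw [setLIntegral_congr Ioo_ae_eq_Ioc, hU, lintegral_iUnion (fun _ => measurableSet_Ioc)]
  have hanti : Antitone fun k : ℕ => ((2 : ℝ) ^ k)⁻¹ := fun a b hab => by
    simp only
    gcongr
    norm_num
  exact hanti.pairwise_disjoint_on_Ioc_succ

lemma volume_dyadic (k : ℕ) : volume (Set.Ioc ((2 ^ (k + 1))⁻¹ : ℝ) (2 ^ k)⁻¹) =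
    ENNReal.ofReal (2 ^ (k + 1))⁻¹ := by
  rw [Real.volume_Ioc]
  congr 1
  rw [pow_succ]
  field_simp
  norm_num

lemma dyadicKernel_mul_le {ρ β δ s t : ℝ} (hρ : 0 ≤ ρ) (hβ : 0 ≤ β) (hs : 0 < s) (hδ : 0 < δ)
    (k : ℕ) (h1 : (2 ^ (k + 1))⁻¹ < t) :
    dyadicKernel ρ β δ s t * (2 ^ (k + 1))⁻¹ ≤ (2 ^ (ρ + β) * dyadicWeight ρ β δ k) ^ s := by
  have ht : 0 < t := lt_trans (by positivity) h1
  have h3 : t⁻¹ ≤ 2 ^ (k + 1) := inv_le_of_inv_le₀ (by positivity) h1.le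
  have e1 : t ^ (-ρ * s) ≤ (2 ^ (k + 1)) ^ (ρ * s) := by
    rw [neg_mul, rpow_neg ht.le, ← inv_rpow ht.le]
    gcongr
  have e2 : min 1 (δ / t) ≤ 2 * min 1 (2 ^ k * δ) := by
    rw [mul_min_of_nonneg _ _ (by norm_num)]
    refine min_le_min (by norm_num) ?_
    rw [div_eq_mul_inv]
    calc δ * t⁻¹ ≤ δ * 2 ^ (k + 1) := by gcongr
      _ = _ := by ring
  unfold dyadicKernel dyadicWeight
  calc _ ≤ (2 ^ (k + 1)) ^ (ρ * s) * (2 * min 1 (2 ^ k * δ)) ^ (β * s) / t * (2 ^ (k + 1))⁻¹ := by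
        gcongr
    _ = (2 ^ (k + 1)) ^ (ρ * s) * (2 * min 1 (2 ^ k * δ)) ^ (β * s) * (t⁻¹ * (2 ^ (k + 1))⁻¹) := by
        ring
    _ ≤ (2 ^ (k + 1)) ^ (ρ * s) * (2 * min 1 (2 ^ k * δ)) ^ (β * s) * 1 := by
        gcongr
        exact mul_inv_le_one_of_le₀ h3 (by positivity)
    _ = _ := by
        have hm : (0 : ℝ) ≤ min 1 (2 ^ k * δ) := by positivity
        rw [mul_one, rpow_mul (by positivity), rpow_mul (by positivity),
          ← mul_rpow (by positivity) (by positivity), rpow_add (by norm_num), pow_succ,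
          mul_rpow (x := (2 : ℝ) ^ k) (by positivity) (by norm_num),
          mul_rpow (x := (2 : ℝ)) (z := β) (by norm_num) hm]
        congr 1
        ring

lemma le_dyadicKernel_mul {ρ β δ s t : ℝ} (hρ : 0 ≤ ρ) (hβ : 0 ≤ β) (hs : 0 < s) (hδ : 0 < δ)
    (k : ℕ) (ht : 0 < t) (h2 : t ≤ (2 ^ k)⁻¹) :
    dyadicWeight ρ β δ k ^ s ≤ 2 * (dyadicKernel ρ β δ s t * (2 ^ (k + 1))⁻¹) := by
  have h3 : 2 ^ k ≤ t⁻¹ := (le_inv_comm₀ (by positivity) ht).2 h2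
  have e1 : (2 ^ k) ^ (ρ * s) ≤ t ^ (-ρ * s) := by
    rw [neg_mul, rpow_neg ht.le, ← inv_rpow ht.le]
    gcongr
  have e2 : min 1 (2 ^ k * δ) ≤ min 1 (δ / t) := by
    refine min_le_min le_rfl ?_
    rw [div_eq_mul_inv, mul_comm]
    gcongr
  unfold dyadicKernel dyadicWeight
  calc _ = (2 ^ k) ^ (ρ * s) * min 1 (2 ^ k * δ) ^ (β * s) := by
        rw [mul_rpow (by positivity) (by positivity), rpow_mul (by positivity),
          rpow_mul (by positivity)]
    _ ≤ t ^ (-ρ * s) * min 1 (δ / t) ^ (β * s) * 1 := by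
        rw [mul_one]; gcongr
    _ ≤ t ^ (-ρ * s) * min 1 (δ / t) ^ (β * s) * (t⁻¹ * (2 ^ k)⁻¹) := by
        gcongr
        rw [← div_eq_mul_inv, one_le_div (by positivity)]
        exact h3
    _ = _ := by
        rw [pow_succ]
        field_simp

lemma lintegral_dyadicKernel_le {ρ β δ s : ℝ} (hρ : 0 ≤ ρ) (hβ : 0 ≤ β) (hs : 0 < s) (hδ : 0 < δ)
    {F : ℝ → ℝ≥0∞} (hF : Monotone F) :
    ∫⁻ t in Set.Ioo (0 : ℝ) 1, ENNReal.ofReal (dyadicKernel ρ β δ s t) * F t ≤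
      ENNReal.ofReal (2 ^ (ρ + β)) ^ s *
        ∑' k : ℕ, ENNReal.ofReal (dyadicWeight ρ β δ k) ^ s * F (2 ^ k)⁻¹ := by
  rw [setLIntegral_Ioo_eq_tsum, ← ENNReal.tsum_mul_left]
  refine ENNReal.tsum_le_tsum fun k => ?_
  rw [← mul_assoc, ← ENNReal.mul_rpow_of_nonneg _ _ hs.le, ← ENNReal.ofReal_mul (by positivity),
    ENNReal.ofReal_rpow_of_nonneg (mul_nonneg (by positivity) (dyadicWeight_nonneg hδ.le _)) hs.le]
  set M := (2 ^ (ρ + β) * dyadicWeight ρ β δ k) ^ s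
  calc _ ≤ ∫⁻ t in Set.Ioc ((2 ^ (k + 1))⁻¹ : ℝ) (2 ^ k)⁻¹,
        ENNReal.ofReal (M * 2 ^ (k + 1)) * F (2 ^ k)⁻¹ := by
        refine setLIntegral_mono' measurableSet_Ioc fun t ht => ?_
        refine mul_le_mul' (ENNReal.ofReal_le_ofReal ?_) (hF ht.2)
        exact (mul_inv_le_iff₀ (by positivity)).1 (dyadicKernel_mul_le hρ hβ hs hδ k ht.1)
    _ = _ := by
        rw [setLIntegral_const, volume_dyadic, mul_right_comm,
          ← ENNReal.ofReal_mul' (by positivity)]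
        congr 2
        field_simp

lemma tsum_dyadicWeight_le {ρ β δ s : ℝ} (hρ : 0 ≤ ρ) (hβ : 0 ≤ β) (hs : 0 < s) (hδ : 0 < δ)
    {F : ℝ → ℝ≥0∞} (hF : Monotone F) :
    ∑' k : ℕ, ENNReal.ofReal (dyadicWeight ρ β δ k) ^ s * F (2 ^ (k + 1))⁻¹ ≤
      2 * ∫⁻ t in Set.Ioo (0 : ℝ) 1, ENNReal.ofReal (dyadicKernel ρ β δ s t) * F t := by
  rw [setLIntegral_Ioo_eq_tsum, ← ENNReal.tsum_mul_left]
  refine ENNReal.tsum_le_tsum fun k => ?_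
  rw [ENNReal.ofReal_rpow_of_nonneg (dyadicWeight_nonneg hδ.le _) hs.le]
  set M := dyadicWeight ρ β δ k ^ s
  calc _ = 2 * ∫⁻ t in Set.Ioc ((2 ^ (k + 1))⁻¹ : ℝ) (2 ^ k)⁻¹,
        ENNReal.ofReal (M / 2 * 2 ^ (k + 1)) * F (2 ^ (k + 1))⁻¹ := by
        rw [setLIntegral_const, volume_dyadic, mul_right_comm,
          ← ENNReal.ofReal_mul' (by positivity), ← mul_assoc,
          show (2 : ℝ≥0∞) = ENNReal.ofReal 2 by simp, ← ENNReal.ofReal_mul (by norm_num)]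
        congr 2
        field_simp
    _ ≤ _ := by
        refine mul_le_mul_right (setLIntegral_mono' measurableSet_Ioc fun t ht => ?_) _
        refine mul_le_mul' (ENNReal.ofReal_le_ofReal ?_) (hF ht.1.le)
        have := le_dyadicKernel_mul hρ hβ hs hδ k (lt_trans (by positivity) ht.1) ht.2
        rw [← le_mul_inv_iff₀ (by positivity)]
        linarith

lemma lintegral_lintegral_const_mul {κ₁ κ₂ : ℝ → ℝ} (h : ∀ t ∈ Set.Ioo (0 : ℝ) 1, 0 ≤ κ₁ t)
    (ω : ℝ → ℝ → ℝ≥0∞) :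
    ∫⁻ t₁ in Set.Ioo (0 : ℝ) 1, ∫⁻ t₂ in Set.Ioo (0 : ℝ) 1,
      ENNReal.ofReal (κ₁ t₁ * κ₂ t₂) * ω t₁ t₂ =
    ∫⁻ t₁ in Set.Ioo (0 : ℝ) 1, ENNReal.ofReal (κ₁ t₁) * ∫⁻ t₂ in Set.Ioo (0 : ℝ) 1,
      ENNReal.ofReal (κ₂ t₂) * ω t₁ t₂ := by
  refine setLIntegral_congr_fun measurableSet_Ioo fun t ht => ?_
  rw [← lintegral_const_mul' _ _ ENNReal.ofReal_ne_top]
  simp_rw [ENNReal.ofReal_mul (h t ht), mul_assoc]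

section Double

variable {ρ₁ ρ₂ β₁ β₂ δ₁ δ₂ s : ℝ} {ω : ℝ → ℝ → ℝ≥0∞}

lemma tsum_prod_weight_eq (hδ₁ : 0 < δ₁) (hs : 0 < s) (f : ℕ → ℕ → ℝ≥0∞) :
    ∑' k : ℕ × ℕ, (ENNReal.ofReal (dyadicWeight ρ₁ β₁ δ₁ k.1 * dyadicWeight ρ₂ β₂ δ₂ k.2) *
        f k.1 k.2) ^ s =
      ∑' k : ℕ, ENNReal.ofReal (dyadicWeight ρ₁ β₁ δ₁ k) ^ s *
        ∑' l : ℕ, ENNReal.ofReal (dyadicWeight ρ₂ β₂ δ₂ l) ^ s * f k l ^ s := by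
  rw [ENNReal.tsum_prod']
  refine tsum_congr fun k => ?_
  rw [← ENNReal.tsum_mul_left]
  refine tsum_congr fun l => ?_
  rw [ENNReal.mul_rpow_of_nonneg _ _ hs.le, ENNReal.ofReal_mul (dyadicWeight_nonneg hδ₁.le _),
    ENNReal.mul_rpow_of_nonneg _ _ hs.le, mul_assoc]

lemma lintegral_dyadicKernel_prod_le (hρ₁ : 0 ≤ ρ₁) (hρ₂ : 0 ≤ ρ₂) (hβ₁ : 0 ≤ β₁) (hβ₂ : 0 ≤ β₂)
    (hs : 0 < s) (hδ₁ : 0 < δ₁) (hδ₂ : 0 < δ₂)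
    (hω : ∀ t₁ t₂ u₁ u₂, t₁ ≤ u₁ → t₂ ≤ u₂ → ω t₁ t₂ ≤ ω u₁ u₂) :
    ∫⁻ t₁ in Set.Ioo (0 : ℝ) 1, ∫⁻ t₂ in Set.Ioo (0 : ℝ) 1, ENNReal.ofReal
      (dyadicKernel ρ₁ β₁ δ₁ s t₁ * dyadicKernel ρ₂ β₂ δ₂ s t₂) * ω t₁ t₂ ^ s ≤
    (ENNReal.ofReal (2 ^ (ρ₁ + β₁)) * ENNReal.ofReal (2 ^ (ρ₂ + β₂))) ^ s *
      ∑' k : ℕ × ℕ, (ENNReal.ofReal (dyadicWeight ρ₁ β₁ δ₁ k.1 * dyadicWeight ρ₂ β₂ δ₂ k.2) *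
        ω (2 ^ k.1)⁻¹ (2 ^ k.2)⁻¹) ^ s := by
  rw [lintegral_lintegral_const_mul (fun t ht => dyadicKernel_nonneg hδ₁ ht.1) fun t₁ t₂ =>
    ω t₁ t₂ ^ s, tsum_prod_weight_eq hδ₁ hs fun k l => ω (2 ^ k)⁻¹ (2 ^ l)⁻¹]
  refine le_trans (lintegral_mono fun t₁ => mul_le_mul_right
    (lintegral_dyadicKernel_le hρ₂ hβ₂ hs hδ₂ (F := fun t₂ => ω t₁ t₂ ^ s) ?_) _) ?_
  · exact fun a b hab => ENNReal.rpow_le_rpow (hω _ _ _ _ le_rfl hab) hs.le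
  refine (lintegral_dyadicKernel_le hρ₁ hβ₁ hs hδ₁ (F := fun t₁ => ENNReal.ofReal (2 ^ (ρ₂ +
      β₂)) ^ s *
        ∑' k : ℕ, ENNReal.ofReal (dyadicWeight ρ₂ β₂ δ₂ k) ^ s * ω t₁ (2 ^ k)⁻¹ ^ s) ?_).trans_eq ?_
  · intro a b hab
    refine mul_le_mul_right (ENNReal.tsum_le_tsum fun k => mul_le_mul_right ?_ _) _
    exact ENNReal.rpow_le_rpow (hω _ _ _ _ hab le_rfl) hs.le
  · rw [ENNReal.mul_rpow_of_nonneg _ _ hs.le, mul_assoc, ← ENNReal.tsum_mul_left (a := _ ^ s)]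
    simp_rw [← ENNReal.tsum_mul_left]
    refine tsum_congr fun k => tsum_congr fun l => ?_
    ring

lemma tsum_prod_dyadicWeight_le (hρ₁ : 0 ≤ ρ₁) (hρ₂ : 0 ≤ ρ₂) (hβ₁ : 0 ≤ β₁) (hβ₂ : 0 ≤ β₂)
    (hs : 0 < s) (hδ₁ : 0 < δ₁) (hδ₂ : 0 < δ₂)
    (hω : ∀ t₁ t₂ u₁ u₂, t₁ ≤ u₁ → t₂ ≤ u₂ → ω t₁ t₂ ≤ ω u₁ u₂) :
    ∑' k : ℕ × ℕ, (ENNReal.ofReal (dyadicWeight ρ₁ β₁ δ₁ k.1 * dyadicWeight ρ₂ β₂ δ₂ k.2) *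
        ω (2 ^ (k.1 + 1))⁻¹ (2 ^ (k.2 + 1))⁻¹) ^ s ≤
    4 * ∫⁻ t₁ in Set.Ioo (0 : ℝ) 1, ∫⁻ t₂ in Set.Ioo (0 : ℝ) 1, ENNReal.ofReal
      (dyadicKernel ρ₁ β₁ δ₁ s t₁ * dyadicKernel ρ₂ β₂ δ₂ s t₂) * ω t₁ t₂ ^ s := by
  rw [lintegral_lintegral_const_mul (fun t ht => dyadicKernel_nonneg hδ₁ ht.1) fun t₁ t₂ =>
    ω t₁ t₂ ^ s, tsum_prod_weight_eq hδ₁ hs fun k l => ω (2 ^ (k + 1))⁻¹ (2 ^ (l + 1))⁻¹]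
  refine le_trans (ENNReal.tsum_le_tsum fun k => mul_le_mul_right
    (tsum_dyadicWeight_le hρ₂ hβ₂ hs hδ₂ (F := fun t₂ => ω (2 ^ (k + 1))⁻¹ t₂ ^ s) ?_) _) ?_
  · exact fun a b hab => ENNReal.rpow_le_rpow (hω _ _ _ _ le_rfl hab) hs.le
  refine (tsum_dyadicWeight_le hρ₁ hβ₁ hs hδ₁ (F := fun t₁ => 2 * ∫⁻ t₂ in Set.Ioo (0 : ℝ) 1,
    ENNReal.ofReal (dyadicKernel ρ₂ β₂ δ₂ s t₂) * ω t₁ t₂ ^ s) ?_).trans_eq ?_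
  · intro a b hab
    refine mul_le_mul_right (lintegral_mono fun t => mul_le_mul_right ?_ _) _
    exact ENNReal.rpow_le_rpow (hω _ _ _ _ hab le_rfl) hs.le
  · simp_rw [mul_left_comm _ (2 : ℝ≥0∞)]
    rw [lintegral_const_mul' _ _ (by norm_num), ← mul_assoc]
    norm_num

end Double

instance fact_two_pi_pos : Fact (0 < 2 * π) := ⟨Real.two_pi_pos⟩

/-- The two-dimensional torus of period `2π`. -/
abbrev Torus := AddCircle (2 * π) × AddCircle (2 * π)

/-- The complex space `L_p(T²)`. -/
abbrev LpTorus (p : ℝ≥0∞) := Lp ℂ p (volume : Measure Torus)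

instance isAddLeftInvariant_torus : (volume : Measure Torus).IsAddLeftInvariant :=
  inferInstanceAs (Measure.IsAddLeftInvariant
    ((volume : Measure (AddCircle (2 * π))).prod (volume : Measure (AddCircle (2 * π)))))

lemma measurePreserving_add_torus (a : Torus) :
    MeasurePreserving (fun z : Torus => z + a) volume volume :=
  measurePreserving_add_right _ a

section Translation

variable {p : ℝ≥0∞} [Fact (1 ≤ p)]

/-- Translation by `a` on `L_p(T²)`. -/
def lpTranslate (a : Torus) : LpTorus p →L[ℂ] LpTorus p :=
  (Lp.compMeasurePreservingₗᵢ ℂ (fun z => z + a)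
    (measurePreserving_add_torus a)).toContinuousLinearMap

lemma lpTranslate_apply (a : Torus) (F : LpTorus p) :
    lpTranslate a F = Lp.compMeasurePreserving _ (measurePreserving_add_torus a) F := rfl

lemma coeFn_lpTranslate (a : Torus) (F : LpTorus p) : lpTranslate a F
    =ᵐ[volume] fun z => F (z + a) :=
  Lp.coeFn_compMeasurePreserving F (measurePreserving_add_torus a)

lemma norm_lpTranslate (a : Torus) (F : LpTorus p) : ‖lpTranslate a F‖ = ‖F‖ :=
  Lp.norm_compMeasurePreserving F (measurePreserving_add_torus a)

lemma ae_add_torus {P : Torus → Prop} (h : ∀ᵐ z, P z) (a : Torus) : ∀ᵐ z : Torus, P (z + a) :=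
  (measurePreserving_add_torus a).quasiMeasurePreserving.ae h

lemma lpTranslate_zero : (lpTranslate 0 : LpTorus p →L[ℂ] LpTorus p) = 1 := by
  ext1 F
  refine Lp.ext ?_
  filter_upwards [coeFn_lpTranslate 0 F] with z hz
  simp [hz]

lemma lpTranslate_add (a b : Torus) (F : LpTorus p) :
    lpTranslate (a + b) F = lpTranslate a (lpTranslate b F) := by
  refine Lp.ext ?_
  filter_upwards [coeFn_lpTranslate (a + b) F, coeFn_lpTranslate a (lpTranslate b F),
    ae_add_torus (coeFn_lpTranslate b F) a] with z h1 h2 h3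
  rw [h1, h2, h3, add_assoc]

lemma continuous_lpTranslate (hp : p ≠ ⊤) (F : LpTorus p) :
    Continuous fun a => lpTranslate a F := by
  simp only [lpTranslate_apply]
  refine Continuous.compMeasurePreservingLp (g := fun a : Torus => ⟨fun z => z + a, by fun_prop⟩)
    continuous_const ?_ (fun a => measurePreserving_add_torus a) hp
  exact ContinuousMap.continuous_of_continuous_uncurry _ (by
    change Continuous fun q : Torus × Torus => q.2 + q.1
    fun_prop)

/-- The translations of `L_p(T²)` along a one-parameter subgroup of the torus. -/
def translationGroup (hp : p ≠ ⊤) (ι : ℝ →+ Torus) (hι : Continuous ι) (hper : ι (2 * π) = 0) :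
    PeriodicGroup (LpTorus p) where
  op s := lpTranslate (ι s)
  op_zero := by rw [map_zero, lpTranslate_zero]
  op_add s t F := by rw [map_add, lpTranslate_add]
  norm_op s F := norm_lpTranslate _ _
  op_periodic s := by rw [map_add, hper, add_zero]
  continuous_op F := (continuous_lpTranslate hp F).comp hι

/-- The first coordinate direction on the torus. -/
def torusFst : ℝ →+ Torus :=
  (AddMonoidHom.inl _ _).comp (QuotientAddGroup.mk' (AddSubgroup.zmultiples (2 * π)))

/-- The second coordinate direction on the torus. -/
def torusSnd : ℝ →+ Torus :=
  (AddMonoidHom.inr _ _).comp (QuotientAddGroup.mk' (AddSubgroup.zmultiples (2 * π)))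

lemma torusFst_apply (s : ℝ) : torusFst s = ((s : AddCircle (2 * π)), 0) := rfl

lemma torusSnd_apply (s : ℝ) : torusSnd s = (0, (s : AddCircle (2 * π))) := rfl

lemma continuous_torusFst : Continuous torusFst :=
  continuous_prodMk.2 ⟨AddCircle.continuous_mk' _, continuous_const⟩

lemma continuous_torusSnd : Continuous torusSnd :=
  continuous_prodMk.2 ⟨continuous_const, AddCircle.continuous_mk' _⟩

lemma torusFst_two_pi : torusFst (2 * π) = 0 := by
  rw [torusFst_apply, AddCircle.coe_period]
  rfl

lemma torusSnd_two_pi : torusSnd (2 * π) = 0 := by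
  rw [torusSnd_apply, AddCircle.coe_period]
  rfl

/-- Translations of `L_p(T²)` in the first variable. -/
def translationFst (hp : p ≠ ⊤) : PeriodicGroup (LpTorus p) :=
  translationGroup hp torusFst continuous_torusFst torusFst_two_pi

/-- Translations of `L_p(T²)` in the second variable. -/
def translationSnd (hp : p ≠ ⊤) : PeriodicGroup (LpTorus p) :=
  translationGroup hp torusSnd continuous_torusSnd torusSnd_two_pi

lemma translationFst_op (hp : p ≠ ⊤) (s : ℝ) (F : LpTorus p) :
    (translationFst hp).op s F = lpTranslate (torusFst s) F := rfl

lemma translationSnd_op (hp : p ≠ ⊤) (s : ℝ) (F : LpTorus p) :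
    (translationSnd hp).op s F = lpTranslate (torusSnd s) F := rfl

lemma commuting_translation (hp : p ≠ ⊤) :
    PeriodicGroup.Commuting (translationFst (p := p) hp) (translationSnd hp) := fun s t F => by
  simp only [translationFst_op, translationSnd_op, ← lpTranslate_add, add_comm]

end Translation

section Pairing

variable {p : ℝ≥0∞} [Fact (1 ≤ p)]

lemma integrable_coeFn_Lp (F : LpTorus p) : Integrable F volume :=
  (Lp.memLp F).integrable (Fact.out (p := 1 ≤ p))

lemma Lp_integrable_mul (F : LpTorus p) {φ : Torus → ℂ} (hφ : Measurable φ) (hb : ∀ z, ‖φ z‖ ≤ 1) :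
    Integrable (fun z => F z * φ z) volume :=
  (integrable_coeFn_Lp F).mul_bdd (c := 1) hφ.aestronglyMeasurable (.of_forall hb)

/-- Integration against a fixed measurable function bounded by `1`, as a functional on `L_p`. -/
def pairing (p : ℝ≥0∞) [Fact (1 ≤ p)] (φ : Torus → ℂ) (hφ : Measurable φ) (hb : ∀ z, ‖φ z‖ ≤ 1) :
    LpTorus p →L[ℂ] ℂ :=
  LinearMap.mkContinuousOfExistsBound
    { toFun := fun F => ∫ z, F z * φ z
      map_add' := fun F G => by
        rw [← integral_add (Lp_integrable_mul F hφ hb) (Lp_integrable_mul G hφ hb)]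
        refine integral_congr_ae ?_
        filter_upwards [Lp.coeFn_add F G] with z hz
        rw [hz, Pi.add_apply, add_mul]
      map_smul' := fun c F => by
        rw [RingHom.id_apply, smul_eq_mul, ← integral_const_mul]
        refine integral_congr_ae ?_
        filter_upwards [Lp.coeFn_smul c F] with z hz
        rw [hz, Pi.smul_apply, smul_eq_mul, mul_assoc] }
    (by
      obtain ⟨K, hK⟩ : ∃ K : NNReal, ∀ F : LpTorus p, eLpNorm F 1 volume ≤ ‖F‖ₑ * K := by
        refine ⟨((volume (Set.univ : Set Torus)) ^ (1 - 1 / p.toReal)).toNNReal, fun F => ?_⟩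
        rw [ENNReal.coe_toNNReal]
        · have := eLpNorm_le_eLpNorm_mul_rpow_measure_univ (μ := (volume : Measure Torus))
            (Fact.out (p := 1 ≤ p)) (Lp.aestronglyMeasurable F)
          rwa [ENNReal.toReal_one, div_one, ← Lp.enorm_def] at this
        · refine (ENNReal.rpow_lt_top_of_nonneg ?_ (measure_ne_top _ _)).ne
          rw [sub_nonneg]
          rcases eq_or_ne p ⊤ with rfl | h
          · simp
          · rw [div_le_one₀ (ENNReal.toReal_pos (zero_lt_one.trans_le Fact.out).ne' h)]
            exact ENNReal.toReal_mono h (Fact.out (p := 1 ≤ p))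
      refine ⟨K, fun F => ?_⟩
      have h1 : ‖∫ z, F z * φ z‖ₑ ≤ K * ‖F‖ₑ := by
        refine (enorm_integral_le_lintegral_enorm _).trans ?_
        refine le_trans ?_ ((hK F).trans_eq (mul_comm _ _))
        rw [eLpNorm_one_eq_lintegral_enorm]
        refine lintegral_mono fun z => ?_
        rw [← ofReal_norm, ← ofReal_norm, norm_mul]
        exact ENNReal.ofReal_le_ofReal (mul_le_of_le_one_right (norm_nonneg _) (hb z))
      have h2 := ENNReal.toReal_mono (ENNReal.mul_ne_top ENNReal.coe_ne_top enorm_ne_top) h1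
      rwa [ENNReal.toReal_mul, toReal_enorm, toReal_enorm] at h2)

lemma pairing_apply (φ : Torus → ℂ) (hφ : Measurable φ) (hb : ∀ z, ‖φ z‖ ≤ 1) (F : LpTorus p) :
    pairing p φ hφ hb F = ∫ z, F z * φ z := rfl

lemma pairing_lpTranslate {φ : Torus → ℂ} (hφ : Measurable φ) (hb : ∀ z, ‖φ z‖ ≤ 1) {a : Torus}
    {c : ℂ} (h : ∀ z, φ z = c * φ (z + a)) (F : LpTorus p) :
    pairing p φ hφ hb (lpTranslate a F) = c * pairing p φ hφ hb F := by
  rw [pairing_apply, pairing_apply]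
  calc _ = ∫ z, c * (F (z + a) * φ (z + a)) := by
        refine integral_congr_ae ?_
        filter_upwards [coeFn_lpTranslate a F] with z hz
        rw [hz, h z]
        ring
    _ = _ := by
        rw [integral_const_mul, integral_add_right_eq_self (fun z => F z * φ z) a]

end Pairing

lemma PeriodicGroup.apply_proj {X : Type*} [NormedAddCommGroup X] [NormedSpace ℂ X]
    [CompleteSpace X] (G : PeriodicGroup X) (ℓ : X →L[ℂ] ℂ) (k : ℤ)
    (h : ∀ s x, ℓ (G.op s x) = Complex.exp (Complex.I * k * s) * ℓ x) (m : ℤ) (x : X) :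
    ℓ (G.proj m x) = if m = k then ℓ x else 0 := by
  have hc : Continuous fun s : ℝ => Complex.exp (-(Complex.I * m * s)) • G.op s x := by
    have := G.continuous_op x
    fun_prop
  rw [proj_apply, map_smul, ← ContinuousLinearMap.intervalIntegral_comp_comm _
    (hc.intervalIntegrable _ _)]
  have e : ∀ s : ℝ, ℓ (Complex.exp (-(Complex.I * m * s)) • G.op s x) =
      Complex.exp (Complex.I * ((k - m : ℤ) : ℂ) * s) * ℓ x := fun s => by
    rw [map_smul, h, smul_eq_mul, ← mul_assoc, ← Complex.exp_add]
    push_cast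
    ring_nf
  simp_rw [e]
  rw [intervalIntegral.integral_mul_const, integral_exp_int]
  by_cases hm : m = k
  · have hπ : (π : ℂ) ≠ 0 := by exact_mod_cast Real.pi_ne_zero
    simp only [hm, sub_self, if_true]
    simp only [smul_eq_mul]
    field_simp
  · rw [if_neg (by omega), if_neg hm]
    simp

/-- The character `e^{i(mx+ny)}` of the torus. -/
def torusChar (m n : ℤ) (z : Torus) : ℂ := fourier m z.1 * fourier n z.2

lemma torusChar_add (m n : ℤ) (a b : Torus) :
    torusChar m n (a + b) = torusChar m n a * torusChar m n b := by
  simp only [torusChar, Prod.fst_add, Prod.snd_add, fourier_apply, smul_add,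
    AddCircle.toCircle_add, Circle.coe_mul]
  ring

lemma torusChar_neg (m n : ℤ) (a : Torus) :
    torusChar (-m) (-n) a * torusChar m n a = 1 := by
  rw [torusChar, torusChar, mul_mul_mul_comm, ← fourier_add, ← fourier_add]
  simp

lemma continuous_torusChar (m n : ℤ) : Continuous (torusChar m n) := by
  unfold torusChar
  fun_prop

lemma norm_torusChar (m n : ℤ) (z : Torus) : ‖torusChar m n z‖ = 1 := by
  simp only [torusChar, fourier_apply, norm_mul, Circle.norm_coe, mul_one]

lemma torusChar_coe (m n : ℤ) (x y : ℝ) :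
    torusChar m n ((x : AddCircle (2 * π)), (y : AddCircle (2 * π))) =
      Complex.exp (Complex.I * (m * x + n * y)) := by
  have hπ : (π : ℂ) ≠ 0 := by exact_mod_cast Real.pi_ne_zero
  rw [torusChar, fourier_coe_apply, fourier_coe_apply, ← Complex.exp_add]
  congr 1
  push_cast
  field_simp

lemma conj_torusChar (m n : ℤ) (z : Torus) :
    (starRingEnd ℂ) (torusChar m n z) = torusChar (-m) (-n) z := by
  simp only [torusChar, map_mul, fourier_neg]

section

variable {p : ℝ≥0∞} [Fact (1 ≤ p)]

/-- The (unnormalized) Fourier coefficient as a functional on `L_p(T²)`. -/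
def torusCoef (p : ℝ≥0∞) [Fact (1 ≤ p)] (m n : ℤ) : LpTorus p →L[ℂ] ℂ :=
  pairing p (torusChar (-m) (-n)) (continuous_torusChar _ _).measurable
    fun z => (norm_torusChar _ _ z).le

lemma torusCoef_apply (m n : ℤ) (F : LpTorus p) :
    torusCoef p m n F = ∫ z, F z * torusChar (-m) (-n) z := rfl

lemma torusChar_neg_eq (m n : ℤ) (a z : Torus) :
    torusChar (-m) (-n) z = torusChar m n a * torusChar (-m) (-n) (z + a) := by
  rw [torusChar_add, mul_left_comm, mul_comm (torusChar m n a), torusChar_neg, mul_one]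

lemma torusCoef_lpTranslate (m n : ℤ) (a : Torus) (F : LpTorus p) :
    torusCoef p m n (lpTranslate a F) = torusChar m n a * torusCoef p m n F :=
  pairing_lpTranslate _ _ (torusChar_neg_eq m n a) F

lemma torusChar_torusFst (m n : ℤ) (s : ℝ) :
    torusChar m n (torusFst s) = Complex.exp (Complex.I * m * s) := by
  have := torusChar_coe m n s 0
  rw [AddCircle.coe_zero] at this
  rw [torusFst_apply, this]
  simp [mul_assoc]

lemma torusChar_torusSnd (m n : ℤ) (s : ℝ) :
    torusChar m n (torusSnd s) = Complex.exp (Complex.I * n * s) := by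
  have := torusChar_coe m n 0 s
  rw [AddCircle.coe_zero] at this
  rw [torusSnd_apply, this]
  simp [mul_assoc]

lemma torusCoef_proj_proj (hp : p ≠ ⊤) (m n k l : ℤ) (F : LpTorus p) :
    torusCoef p k l ((translationFst hp).proj m ((translationSnd hp).proj n F)) =
      if m = k ∧ n = l then torusCoef p k l F else 0 := by
  rw [PeriodicGroup.apply_proj _ _ k (fun s x => by
    rw [translationFst_op, torusCoef_lpTranslate, torusChar_torusFst]),
    PeriodicGroup.apply_proj _ _ l (fun s x => by
    rw [translationSnd_op, torusCoef_lpTranslate, torusChar_torusSnd])]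
  split_ifs <;> first | rfl | tauto

lemma eq_zero_of_torusCoef_eq_zero {m n : ℤ} {W : LpTorus p}
    (hW : ∀ a, lpTranslate a W = torusChar m n a • W) (h0 : torusCoef p m n W = 0) : W = 0 := by
  have hm : StronglyMeasurable (W : Torus → ℂ) := Lp.stronglyMeasurable W
  have h1 : ∀ a, ∀ᵐ z, W (z + a) = torusChar m n a * W z := fun a => by
    have := coeFn_lpTranslate a W
    rw [hW a] at this
    filter_upwards [this, Lp.coeFn_smul (torusChar m n a) W] with z h2 h3
    rw [← h2, h3, Pi.smul_apply, smul_eq_mul]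
  have hset : MeasurableSet {q : Torus × Torus | W (q.2 + q.1) = torusChar m n q.1 * W q.2} :=
    measurableSet_eq_fun (hm.measurable.comp (by fun_prop))
      (((continuous_torusChar m n).measurable.comp measurable_fst).mul
        (hm.measurable.comp measurable_snd))
  have h2 : ∀ᵐ z : Torus, ∀ᵐ a : Torus, W (z + a) = torusChar m n a * W z :=
    (Measure.ae_ae_comm hset).1 (.of_forall h1)
  refine Lp.ext ?_
  filter_upwards [h2, Lp.coeFn_zero ℂ p volume] with z hz hz0
  rw [hz0, Pi.zero_apply]
  have h3 : ∫ a, W (z + a) * torusChar (-m) (-n) a = 0 := by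
    have : ∀ a, W (z + a) * torusChar (-m) (-n) a =
        torusChar m n z * (W (z + a) * torusChar (-m) (-n) (z + a)) := fun a => by
      rw [torusChar_neg_eq m n z a, add_comm a z]; ring
    simp_rw [this]
    rw [integral_const_mul, integral_add_left_eq_self (fun a => W a * torusChar (-m) (-n) a) z,
      ← torusCoef_apply, h0, mul_zero]
  have h4 : ∫ a : Torus, W (z + a) * torusChar (-m) (-n) a = ∫ a : Torus, W z := by
    refine integral_congr_ae ?_
    filter_upwards [hz] with a ha
    rw [ha, mul_right_comm, mul_comm (torusChar m n a), torusChar_neg, one_mul]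
  rw [h3, integral_const] at h4
  have h5 : (volume : Measure Torus).real Set.univ ≠ 0 := by
    rw [Measure.real, Measure.volume_eq_prod, Measure.prod_apply MeasurableSet.univ]
    simp [Real.pi_pos.le, Real.pi_ne_zero]
  simpa [h5] using h4.symm

lemma proj_proj_eq_zero_iff (hp : p ≠ ⊤) (m n : ℤ) (F : LpTorus p) :
    (translationFst hp).proj m ((translationSnd hp).proj n F) = 0 ↔ torusCoef p m n F = 0 := by
  constructor
  · intro h
    have := torusCoef_proj_proj hp m n m n F
    rw [h, map_zero, if_pos ⟨rfl, rfl⟩] at this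
    exact this.symm
  · intro h
    refine eq_zero_of_torusCoef_eq_zero (m := m) (n := n) (fun a => ?_) ?_
    · obtain ⟨s, hs⟩ := QuotientAddGroup.mk_surjective a.1
      obtain ⟨t, ht⟩ := QuotientAddGroup.mk_surjective a.2
      have ha : a = torusFst s + torusSnd t := by
        rw [torusFst_apply, torusSnd_apply]
        refine Prod.ext ?_ ?_
        · simp [← hs]
        · simp [← ht]
      have hc := commuting_translation (p := p) hp
      rw [ha, lpTranslate_add, torusChar_add, torusChar_torusFst, torusChar_torusSnd,
        ← translationFst_op hp, ← translationSnd_op hp]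
      rw [(translationFst hp).commute_proj (fun s' x => (hc s' t x).symm), PeriodicGroup.op_proj,
        PeriodicGroup.op_proj, map_smul, smul_smul]
    · rw [torusCoef_proj_proj, if_pos ⟨rfl, rfl⟩, h]

end

/-- The function `u` on the torus pulls back to the real function `φ` on the plane. -/
def IsPullback (φ : ℝ → ℝ → ℝ) (u : Torus → ℂ) : Prop :=
  ∀ x y : ℝ, u ((x : AddCircle (2 * π)), (y : AddCircle (2 * π))) = (φ x y : ℂ)

lemma exists_isPullback {φ : ℝ → ℝ → ℝ} (hm : Measurable (Function.uncurry φ))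
    (hx : ∀ y, Function.Periodic (fun x => φ x y) (2 * π))
    (hy : ∀ x, Function.Periodic (φ x) (2 * π)) : ∃ u, Measurable u ∧ IsPullback φ u := by
  have hrep : ∀ (x : ℝ) {f : ℝ → ℝ}, Function.Periodic f (2 * π) →
      f (AddCircle.equivIoc (2 * π) 0 (x : AddCircle (2 * π))) = f x := fun x f hf => by
    rw [← hf.lift_coe, AddCircle.coe_equivIoc, hf.lift_coe]
  have hmr : Measurable fun z : AddCircle (2 * π) => (AddCircle.equivIoc (2 * π) 0 z : ℝ) :=
    measurable_subtype_coe.comp (AddCircle.measurableEquivIoc (2 * π) 0).measurable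
  refine ⟨fun z => (φ (AddCircle.equivIoc (2 * π) 0 z.1) (AddCircle.equivIoc (2 * π) 0 z.2) : ℝ),
    ?_, fun x y => ?_⟩
  · exact Complex.measurable_ofReal.comp
      (hm.comp ((hmr.comp measurable_fst).prodMk (hmr.comp measurable_snd)))
  · simp only
    rw [hrep y (hy _), hrep x (hx y)]

lemma lintegral_torus {F : Torus → ℝ≥0∞} (hF : AEMeasurable F) :
    ∫⁻ x in Set.Ioc (0 : ℝ) (2 * π), ∫⁻ y in Set.Ioc (0 : ℝ) (2 * π),
      F ((x : AddCircle (2 * π)), (y : AddCircle (2 * π))) = ∫⁻ z, F z := by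
  have e : ∀ f : AddCircle (2 * π) → ℝ≥0∞,
      ∫⁻ x in Set.Ioc (0 : ℝ) (2 * π), f x = ∫⁻ z, f z := fun f => by
    simpa using AddCircle.lintegral_preimage (2 * π) 0 f
  rw [Measure.volume_eq_prod, lintegral_prod _ hF, ← e]
  refine lintegral_congr fun x => ?_
  rw [← e]

lemma integral_torus {F : Torus → ℂ} (hF : Integrable F) :
    ∫ x in (0 : ℝ)..(2 * π), ∫ y in (0 : ℝ)..(2 * π),
      F ((x : AddCircle (2 * π)), (y : AddCircle (2 * π))) = ∫ z, F z := by
  have e : ∀ f : AddCircle (2 * π) → ℂ,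
      ∫ x in (0 : ℝ)..(2 * π), f x = ∫ z, f z := fun f => by
    simpa using AddCircle.intervalIntegral_preimage (2 * π) 0 f
  rw [Measure.volume_eq_prod, integral_prod _ hF, ← e]
  refine intervalIntegral.integral_congr fun x _ => ?_
  rw [← e]

section

variable {p : ℝ}

lemma Lp2Norm_eq_eLpNorm (hp : 0 < p) {φ : ℝ → ℝ → ℝ} {u : Torus → ℂ} (h : IsPullback φ u)
    (hu : AEMeasurable u) : Lp2Norm p φ = eLpNorm u (ENNReal.ofReal p) volume := by
  rw [eLpNorm_eq_lintegral_rpow_enorm_toReal (by simpa using hp) ENNReal.ofReal_ne_top,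
    ENNReal.toReal_ofReal hp.le, ← lintegral_torus (by fun_prop), Lp2Norm]
  congr 1
  refine lintegral_congr fun x => lintegral_congr fun y => ?_
  rw [h x y, ← ofReal_norm, Complex.norm_real, Real.norm_eq_abs,
    ENNReal.ofReal_rpow_of_nonneg (abs_nonneg _) hp.le]

lemma Lp2Norm_eq_enorm (hp : 1 < p) [Fact (1 ≤ ENNReal.ofReal p)] {φ : ℝ → ℝ → ℝ} {u : Torus → ℂ}
    (h : IsPullback φ u) {F : LpTorus (ENNReal.ofReal p)} (hu : u =ᵐ[volume] F) :
    Lp2Norm p φ = ‖F‖ₑ := by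
  rw [Lp2Norm_eq_eLpNorm (by linarith) h ⟨F, (Lp.stronglyMeasurable F).measurable, hu⟩,
    Lp.enorm_def, eLpNorm_congr_ae hu]

end

/-- The fractional difference of a function on the torus. -/
def torusDiff (ι : ℝ →+ Torus) (γ h : ℝ) (u : Torus → ℂ) (z : Torus) : ℂ :=
  ∑' ν : ℕ, (diffCoef γ ν : ℂ) * u (z + ι ((γ - ν) * h))

lemma IsPullback.diffX {φ : ℝ → ℝ → ℝ} {u : Torus → ℂ} (hu : IsPullback φ u) (γ h : ℝ) :
    IsPullback (diffX γ h φ) (torusDiff torusFst γ h u) := fun x y => by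
  rw [_root_.diffX, torusDiff, Complex.ofReal_tsum]
  refine tsum_congr fun ν => ?_
  have : (((x : AddCircle (2 * π)), (y : AddCircle (2 * π))) : Torus) + torusFst ((γ - ν) * h) =
      (((x + (γ - ν) * h : ℝ) : AddCircle (2 * π)), (y : AddCircle (2 * π))) := by
    rw [torusFst_apply, Prod.mk_add_mk, add_zero, AddCircle.coe_add]
  rw [this, hu]
  push_cast [diffCoef]
  ring

lemma IsPullback.diffY {φ : ℝ → ℝ → ℝ} {u : Torus → ℂ} (hu : IsPullback φ u) (γ h : ℝ) :
    IsPullback (diffY γ h φ) (torusDiff torusSnd γ h u) := fun x y => by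
  rw [_root_.diffY, torusDiff, Complex.ofReal_tsum]
  refine tsum_congr fun ν => ?_
  have : (((x : AddCircle (2 * π)), (y : AddCircle (2 * π))) : Torus) + torusSnd ((γ - ν) * h) =
      ((x : AddCircle (2 * π)), ((y + (γ - ν) * h : ℝ) : AddCircle (2 * π))) := by
    rw [torusSnd_apply, Prod.mk_add_mk, add_zero, AddCircle.coe_add]
  rw [this, hu]
  push_cast [diffCoef]
  ring

section

variable {p : ℝ≥0∞} [Fact (1 ≤ p)]

lemma torusDiff_ae_eq (hp : p ≠ ⊤) (ι : ℝ →+ Torus) (hι : Continuous ι) (hper : ι (2 * π) = 0)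
    {γ : ℝ} (hγ : 0 < γ) (h : ℝ) {u : Torus → ℂ} {F : LpTorus p} (hu : u =ᵐ[volume] F) :
    torusDiff ι γ h u =ᵐ[volume] lpTranslate (ι (γ * h))
      ((translationGroup hp ι hι hper).diffOp γ h F) := by
  set G := translationGroup hp ι hι hper
  have hs : HasSum (fun ν : ℕ => (diffCoef γ ν : ℂ) • lpTranslate (ι ((γ - ν) * h)) F)
      (lpTranslate (ι (γ * h)) (G.diffOp γ h F)) := by
    have := (G.hasSum_diffOp_apply hγ h F).map (lpTranslate (ι (γ * h)))
      (lpTranslate (ι (γ * h))).continuous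
    convert! this using 2 with ν
    simp only [Function.comp, map_smul]
    congr 1
    change _ = lpTranslate _ (lpTranslate (ι _) F)
    rw [← lpTranslate_add, ← map_add]
    congr 2
    ring_nf
  have hfin : ∑' ν : ℕ, ‖(diffCoef γ ν : ℂ) • lpTranslate (ι ((γ - ν) * h)) F‖ₑ ≠ ⊤ := by
    have hsum : Summable fun ν : ℕ => |diffCoef γ ν| * ‖F‖ :=
      (summable_abs_diffCoef hγ).mul_right _
    refine ne_of_eq_of_ne (tsum_congr fun ν => ?_) hsum.tsum_ofReal_ne_top
    rw [← ofReal_norm, norm_smul, norm_lpTranslate, Complex.norm_real, Real.norm_eq_abs]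
  have h1 := Lp.hasSum_coeFn_tsum hfin
  rw [hs.tsum_eq] at h1
  have h2 : ∀ᵐ z, ∀ ν : ℕ, ((diffCoef γ ν : ℂ) • lpTranslate (ι ((γ - ν) * h)) F : LpTorus p) z =
      diffCoef γ ν * u (z + ι ((γ - ν) * h)) := by
    refine ae_all_iff.2 fun ν => ?_
    filter_upwards [Lp.coeFn_smul (diffCoef γ ν : ℂ) (lpTranslate (ι ((γ - ν) * h)) F),
      coeFn_lpTranslate (ι ((γ - ν) * h)) F, ae_add_torus hu (ι ((γ - ν) * h))] with z h3 h4 h5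
    rw [h3, Pi.smul_apply, h4, h5, smul_eq_mul]
  filter_upwards [h1, h2] with z h3 h4
  rw [torusDiff, ← h3.tsum_eq]
  exact tsum_congr fun ν => (h4 ν).symm

end

lemma mixedMod_eq_mixedModulus {p : ℝ} (hp : 1 < p) [Fact (1 ≤ ENNReal.ofReal p)] {γ₁ γ₂ : ℝ}
    (hγ₁ : 0 < γ₁) (hγ₂ : 0 < γ₂) (δ₁ δ₂ : ℝ) {φ : ℝ → ℝ → ℝ} {u : Torus → ℂ}
    (h : IsPullback φ u) {F : LpTorus (ENNReal.ofReal p)} (hu : u =ᵐ[volume] F) :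
    mixedMod p γ₁ γ₂ δ₁ δ₂ φ = PeriodicGroup.mixedModulus
      (translationFst ENNReal.ofReal_ne_top) (translationSnd ENNReal.ofReal_ne_top)
      γ₁ γ₂ δ₁ δ₂ F := by
  set G := translationFst (p := ENNReal.ofReal p) ENNReal.ofReal_ne_top with hG
  set H := translationSnd (p := ENNReal.ofReal p) ENNReal.ofReal_ne_top with hH
  have hc : G.Commuting H := commuting_translation _
  rw [mixedMod, PeriodicGroup.mixedModulus]
  refine iSup_congr fun h₁ => iSup_congr fun _ => iSup_congr fun h₂ => iSup_congr fun _ => ?_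
  have h2 := torusDiff_ae_eq ENNReal.ofReal_ne_top torusSnd continuous_torusSnd torusSnd_two_pi hγ₂
      h₂ hu
  have h1 := torusDiff_ae_eq ENNReal.ofReal_ne_top torusFst continuous_torusFst torusFst_two_pi hγ₁
      h₁ h2
  rw [Lp2Norm_eq_enorm hp ((h.diffY γ₂ h₂).diffX γ₁ h₁) h1, ← ofReal_norm, norm_lpTranslate]
  change ENNReal.ofReal ‖G.diffOp γ₁ h₁ (H.op (γ₂ * h₂) (H.diffOp γ₂ h₂ F))‖ = _
  rw [hc.apply (.diffOp hγ₁ h₁) (.op _), H.norm_op, ofReal_norm]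

lemma ae_coe_addCircle {P : AddCircle (2 * π) → Prop} (h : ∀ᵐ z, P z) :
    ∀ᵐ y : ℝ, P (y : AddCircle (2 * π)) := by
  have hU : ⋃ n : ℤ, Set.Ioc (n • (2 * π)) ((n + 1) • (2 * π)) = Set.univ :=
    iUnion_Ioc_zsmul Real.two_pi_pos
  rw [← Measure.restrict_univ (μ := (volume : Measure ℝ)), ← hU, ae_restrict_iUnion_iff]
  intro n
  have := (AddCircle.measurePreserving_mk (2 * π) (n • (2 * π))).quasiMeasurePreserving.ae h
  rwa [add_smul, one_smul]

lemma conj_I_mul_int_cpow (m : ℤ) (ρ : ℝ) :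
    (starRingEnd ℂ) ((Complex.I * ((-m : ℤ) : ℂ)) ^ (ρ : ℂ)) = (Complex.I * (m : ℂ)) ^ (ρ : ℂ) := by
  have h := Complex.conj_cpow (Complex.I * ((-m : ℤ) : ℂ)) (ρ : ℂ) (by
    rw [Ne, Complex.arg_eq_pi_iff]
    simp)
  rw [Complex.conj_ofReal] at h
  rw [← h]
  congr 1
  rw [map_mul, Complex.conj_I, map_intCast]
  push_cast
  ring

section

variable {p : ℝ≥0∞} [Fact (1 ≤ p)]

lemma torusCoef_eq_integral (m n : ℤ) {u : Torus → ℂ} {F : LpTorus p} (hu : u =ᵐ[volume] F) :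
    torusCoef p m n F = ∫ z, u z * torusChar (-m) (-n) z := by
  rw [torusCoef_apply]
  refine integral_congr_ae ?_
  filter_upwards [hu] with z hz
  rw [hz]

lemma integrable_mul_torusChar (m n : ℤ) {u : Torus → ℂ} {F : LpTorus p} (hu : u =ᵐ[volume] F) :
    Integrable (fun z => u z * torusChar m n z) := by
  refine (Lp_integrable_mul F (continuous_torusChar m n).measurable
    fun z => (norm_torusChar _ _ z).le).congr ?_
  filter_upwards [hu] with z hz
  rw [hz]

lemma fourierCoefZ_eq_torusCoef {φ : ℝ → ℝ → ℝ} {u : Torus → ℂ} (h : IsPullback φ u)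
    {F : LpTorus p} (hu : u =ᵐ[volume] F) (m n : ℤ) :
    fourierCoefZ φ m n = (((2 * π) ^ 2)⁻¹ : ℝ) * torusCoef p m n F := by
  rw [torusCoef_eq_integral m n hu, ← integral_torus (integrable_mul_torusChar _ _ hu),
    fourierCoefZ]
  congr 1
  refine intervalIntegral.integral_congr fun x _ => intervalIntegral.integral_congr fun y _ => ?_
  simp only [h x y, torusChar_coe]
  congr 2
  push_cast
  ring

lemma torusCoef_ext (hp : p ≠ ⊤) {F G : LpTorus p}
    (h : ∀ m n, torusCoef p m n F = torusCoef p m n G) : F = G :=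
  PeriodicGroup.Commuting.ext (G := translationFst hp) (H := translationSnd hp) fun m n => by
    rw [← sub_eq_zero, ← map_sub, ← map_sub, proj_proj_eq_zero_iff, map_sub, h, sub_self]

lemma torusCoef_star (m n : ℤ) (F : LpTorus p) :
    torusCoef p m n (star F) = (starRingEnd ℂ) (torusCoef p (-m) (-n) F) := by
  rw [torusCoef_apply, torusCoef_apply, ← integral_conj]
  refine integral_congr_ae ?_
  filter_upwards [Lp.coeFn_star F] with z hz
  rw [hz, map_mul, conj_torusChar, neg_neg, neg_neg]
  rfl

lemma torusCoef_zero_left {φ : ℝ → ℝ → ℝ} {u : Torus → ℂ} (h : IsPullback φ u)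
    {F : LpTorus p} (hu : u =ᵐ[volume] F)
    (h0 : ∀ᵐ y : ℝ, (∫ x in (0 : ℝ)..(2 * π), φ x y) = 0) (n : ℤ) : torusCoef p 0 n F = 0 := by
  have e : ∀ f : AddCircle (2 * π) → ℂ, ∫ x in (0 : ℝ)..(2 * π), f x = ∫ z, f z := fun f => by
    simpa using AddCircle.intervalIntegral_preimage (2 * π) 0 f
  rw [torusCoef_eq_integral 0 n hu, Measure.volume_eq_prod,
    integral_prod_symm _ (integrable_mul_torusChar _ _ hu), ← e]
  refine intervalIntegral.integral_zero_ae ?_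
  filter_upwards [h0] with y hy _
  simp only [torusChar, neg_zero, fourier_zero, one_mul]
  rw [integral_mul_const, ← e]
  simp_rw [h _ y]
  rw [intervalIntegral.integral_ofReal, hy]
  simp

lemma torusCoef_zero_right {φ : ℝ → ℝ → ℝ} {u : Torus → ℂ} (h : IsPullback φ u)
    {F : LpTorus p} (hu : u =ᵐ[volume] F)
    (h0 : ∀ᵐ x : ℝ, (∫ y in (0 : ℝ)..(2 * π), φ x y) = 0) (m : ℤ) : torusCoef p m 0 F = 0 := by
  have e : ∀ f : AddCircle (2 * π) → ℂ, ∫ x in (0 : ℝ)..(2 * π), f x = ∫ z, f z := fun f => by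
    simpa using AddCircle.intervalIntegral_preimage (2 * π) 0 f
  rw [torusCoef_eq_integral m 0 hu, Measure.volume_eq_prod,
    integral_prod _ (integrable_mul_torusChar _ _ hu), ← e]
  refine intervalIntegral.integral_zero_ae ?_
  filter_upwards [h0] with x hx _
  simp only [torusChar, neg_zero, fourier_zero, mul_one]
  rw [integral_mul_const, ← e]
  simp_rw [h x]
  rw [intervalIntegral.integral_ofReal, hx]
  simp

lemma pairing_eq_zero_of_proj {φ : Torus → ℂ} (hφ : Measurable φ) (hb : ∀ z, ‖φ z‖ ≤ 1)
    {G H : PeriodicGroup (LpTorus p)} (hc : G.Commuting H)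
    (hG : ∀ s F, pairing p φ hφ hb (G.op s F) = pairing p φ hφ hb F)
    {F : LpTorus p} (h0 : ∀ n, G.proj 0 (H.proj n F) = 0) : pairing p φ hφ hb F = 0 := by
  have h1 : G.proj 0 F = 0 := H.eq_zero_of_proj_eq_zero _ fun n => by
    rw [← hc.apply (.proj 0) (.proj n), h0]
  have h2 := G.apply_proj (pairing p φ hφ hb) 0 (fun s x => by simp [hG]) 0 F
  rw [h1, map_zero, if_pos rfl] at h2
  exact h2.symm

lemma ae_integral_fst_eq_zero (hp : p ≠ ⊤) {u : Torus → ℂ} {F : LpTorus p} (hu : u =ᵐ[volume] F)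
    (h0 : ∀ n, torusCoef p 0 n F = 0) : ∀ᵐ y : AddCircle (2 * π), ∫ x, u (x, y) = 0 := by
  have hi : Integrable u (volume.prod volume) := (integrable_coeFn_Lp F).congr hu.symm
  refine Integrable.ae_eq_zero_of_forall_setIntegral_eq_zero hi.integral_prod_right
    fun A hA _ => ?_
  have hφ : Measurable fun z : Torus => A.indicator (fun _ => (1 : ℂ)) z.2 :=
    (measurable_const.indicator hA).comp measurable_snd
  have hb : ∀ z : Torus, ‖A.indicator (fun _ => (1 : ℂ)) z.2‖ ≤ 1 := fun z => by
    by_cases h : z.2 ∈ A <;> simp [h]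
  have h1 : pairing p _ hφ hb F = 0 :=
    pairing_eq_zero_of_proj hφ hb (commuting_translation hp) (fun s F => by
      rw [translationFst_op, pairing_lpTranslate hφ hb (c := 1) (fun z => by
        simp [torusFst_apply]), one_mul]) fun n => (proj_proj_eq_zero_iff hp 0 n F).2 (h0 n)
  rw [pairing_apply] at h1
  have hint := Lp_integrable_mul F hφ hb
  have h2 : ∫ z : Torus, u z * A.indicator (fun _ => (1 : ℂ)) z.2 = 0 := by
    rw [← h1]
    refine integral_congr_ae ?_
    filter_upwards [hu] with z hz
    rw [hz]
  rw [Measure.volume_eq_prod, integral_prod_symm _ (hint.congr (by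
    filter_upwards [hu] with z hz
    rw [hz]))] at h2
  rw [← integral_indicator hA, ← h2]
  refine integral_congr_ae (.of_forall fun y => ?_)
  by_cases h : y ∈ A <;> simp [h]

lemma ae_integral_snd_eq_zero (hp : p ≠ ⊤) {u : Torus → ℂ} {F : LpTorus p} (hu : u =ᵐ[volume] F)
    (h0 : ∀ m, torusCoef p m 0 F = 0) : ∀ᵐ x : AddCircle (2 * π), ∫ y, u (x, y) = 0 := by
  have hi : Integrable u (volume.prod volume) := (integrable_coeFn_Lp F).congr hu.symm
  refine Integrable.ae_eq_zero_of_forall_setIntegral_eq_zero hi.integral_prod_left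
    fun A hA _ => ?_
  have hφ : Measurable fun z : Torus => A.indicator (fun _ => (1 : ℂ)) z.1 :=
    (measurable_const.indicator hA).comp measurable_fst
  have hb : ∀ z : Torus, ‖A.indicator (fun _ => (1 : ℂ)) z.1‖ ≤ 1 := fun z => by
    by_cases h : z.1 ∈ A <;> simp [h]
  have hc := commuting_translation hp (p := p)
  have h1 : pairing p _ hφ hb F = 0 :=
    pairing_eq_zero_of_proj hφ hb hc.symm (fun s F => by
      rw [translationSnd_op, pairing_lpTranslate hφ hb (c := 1) (fun z => by
        simp [torusSnd_apply]), one_mul]) fun m => by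
      rw [← hc.apply (.proj m) (.proj 0), (proj_proj_eq_zero_iff hp m 0 F).2 (h0 m)]
  rw [pairing_apply] at h1
  have hint := Lp_integrable_mul F hφ hb
  have h2 : ∫ z : Torus, u z * A.indicator (fun _ => (1 : ℂ)) z.1 = 0 := by
    rw [← h1]
    refine integral_congr_ae ?_
    filter_upwards [hu] with z hz
    rw [hz]
  rw [Measure.volume_eq_prod, integral_prod _ (hint.congr (by
    filter_upwards [hu] with z hz
    rw [hz]))] at h2
  rw [← integral_indicator hA, ← h2]
  refine integral_congr_ae (.of_forall fun y => ?_)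
  by_cases h : y ∈ A <;> simp [h]

end

section

variable {p : ℝ} [Fact (1 ≤ ENNReal.ofReal p)]

/-- A real function in `L_p^0(T²)` is represented by a real element of `L_p` of the torus whose
Fourier coefficients vanish on the coordinate axes. -/
lemma MemLp0.exists_Lp (hp : 1 < p) {f : ℝ → ℝ → ℝ} (hf : MemLp0 p f) :
    ∃ (u : Torus → ℂ) (F : LpTorus (ENNReal.ofReal p)), IsPullback f u ∧ u =ᵐ[volume] F ∧
      star F = F ∧ (∀ n, torusCoef _ 0 n F = 0) ∧ ∀ m, torusCoef _ m 0 F = 0 := by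
  obtain ⟨u, hm, hu⟩ := exists_isPullback hf.meas hf.periodic_x hf.periodic_y
  have hLp : MemLp u (ENNReal.ofReal p) volume := by
    refine ⟨hm.aestronglyMeasurable, lt_top_iff_ne_top.2 ?_⟩
    rw [← Lp2Norm_eq_eLpNorm (by linarith) hu hm.aemeasurable]
    exact hf.norm_ne_top
  have hF : u =ᵐ[volume] hLp.toLp u := hLp.coeFn_toLp.symm
  refine ⟨u, hLp.toLp u, hu, hF, Lp.ext ?_, torusCoef_zero_left hu hF hf.mean_x,
    torusCoef_zero_right hu hF hf.mean_y⟩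
  filter_upwards [Lp.coeFn_star (hLp.toLp u), hF] with z h1 h2
  obtain ⟨x, hx⟩ := QuotientAddGroup.mk_surjective z.1
  obtain ⟨y, hy⟩ := QuotientAddGroup.mk_surjective z.2
  rw [h1, Pi.star_apply, ← h2, show z = ((x : AddCircle (2 * π)), (y : AddCircle (2 * π))) from
    Prod.ext hx.symm hy.symm, hu]
  exact Complex.conj_ofReal _

/-- Conversely, such an element comes from a real function in `L_p^0(T²)`. -/
lemma exists_memLp0 (hp : 1 < p) {Y : LpTorus (ENNReal.ofReal p)} (hY : star Y = Y)
    (h1 : ∀ n, torusCoef _ 0 n Y = 0) (h2 : ∀ m, torusCoef _ m 0 Y = 0) :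
    ∃ (g : ℝ → ℝ → ℝ) (u : Torus → ℂ), MemLp0 p g ∧ IsPullback g u ∧ u =ᵐ[volume] Y := by
  have hm : Measurable (Y : Torus → ℂ) := (Lp.stronglyMeasurable Y).measurable
  set g : ℝ → ℝ → ℝ := fun x y => (Y ((x : AddCircle (2 * π)), (y : AddCircle (2 * π)))).re
    with hg
  set u : Torus → ℂ := fun z => ((Y z).re : ℂ) with hu
  have hgu : IsPullback g u := fun x y => rfl
  have huY : u =ᵐ[volume] Y := by
    have hs := Lp.coeFn_star Y
    rw [hY] at hs
    filter_upwards [hs] with z hz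
    exact Complex.conj_eq_iff_re.1 hz.symm
  refine ⟨g, u, ⟨?_, fun y x => ?_, fun x y => ?_, ?_, ?_, ?_⟩, hgu, huY⟩
  · exact Complex.measurable_re.comp (hm.comp
      ((AddCircle.measurable_mk'.comp measurable_fst).prodMk
        (AddCircle.measurable_mk'.comp measurable_snd)))
  · simp only [hg, AddCircle.coe_add_period]
  · simp only [hg, AddCircle.coe_add_period]
  · rw [Lp2Norm_eq_enorm hp hgu huY]
    exact enorm_ne_top
  · filter_upwards [ae_coe_addCircle (ae_integral_fst_eq_zero ENNReal.ofReal_ne_top huY h1)]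
      with y hy
    have e := AddCircle.intervalIntegral_preimage (2 * π) 0 fun x => u (x, (y : AddCircle (2 * π)))
    rw [hy, zero_add] at e
    simp_rw [hgu _ y] at e
    rw [intervalIntegral.integral_ofReal] at e
    exact_mod_cast e
  · filter_upwards [ae_coe_addCircle (ae_integral_snd_eq_zero ENNReal.ofReal_ne_top huY h2)]
      with x hx
    have e := AddCircle.intervalIntegral_preimage (2 * π) 0 fun y => u ((x : AddCircle (2 * π)), y)
    rw [hx, zero_add] at e
    simp_rw [hgu x] at e
    rw [intervalIntegral.integral_ofReal] at e
    exact_mod_cast e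

end

/-- The Fourier multiplier of the mixed Weyl derivative. -/
def weylSymbol (ρ₁ ρ₂ : ℝ) (m n : ℤ) : ℂ :=
  (Complex.I * (m : ℂ)) ^ (ρ₁ : ℂ) * (Complex.I * (n : ℂ)) ^ (ρ₂ : ℂ)

lemma weylSymbol_zero_left {ρ₁ : ℝ} (hρ₁ : 0 < ρ₁) (ρ₂ : ℝ) (n : ℤ) :
    weylSymbol ρ₁ ρ₂ 0 n = 0 := by
  rw [weylSymbol, Int.cast_zero, mul_zero, Complex.zero_cpow (by exact_mod_cast hρ₁.ne'), zero_mul]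

lemma weylSymbol_zero_right (ρ₁ : ℝ) {ρ₂ : ℝ} (hρ₂ : 0 < ρ₂) (m : ℤ) :
    weylSymbol ρ₁ ρ₂ m 0 = 0 := by
  rw [weylSymbol, Int.cast_zero, mul_zero, Complex.zero_cpow (by exact_mod_cast hρ₂.ne'), mul_zero]

lemma conj_weylSymbol (ρ₁ ρ₂ : ℝ) (m n : ℤ) :
    (starRingEnd ℂ) (weylSymbol ρ₁ ρ₂ (-m) (-n)) = weylSymbol ρ₁ ρ₂ m n := by
  rw [weylSymbol, map_mul, conj_I_mul_int_cpow, conj_I_mul_int_cpow, weylSymbol]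

lemma proj_proj_eq_smul_iff {p : ℝ≥0∞} [Fact (1 ≤ p)] (hp : p ≠ ⊤) (m n : ℤ) (c : ℂ)
    (F Y : LpTorus p) :
    (translationFst hp).proj m ((translationSnd hp).proj n Y) =
      c • (translationFst hp).proj m ((translationSnd hp).proj n F) ↔
    torusCoef p m n Y = c * torusCoef p m n F := by
  rw [← sub_eq_zero, ← map_smul, ← map_smul, ← map_sub, ← map_sub, proj_proj_eq_zero_iff, map_sub,
    map_smul, smul_eq_mul, sub_eq_zero]

lemma lintegral_rpow_eq_dyadicKernel (ρ₁ ρ₂ s : ℝ) (ω : ℝ → ℝ → ℝ≥0∞) :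
    ∫⁻ t₁ in Set.Ioo (0 : ℝ) 1, ∫⁻ t₂ in Set.Ioo (0 : ℝ) 1,
      ENNReal.ofReal (t₁ ^ (-ρ₁ * s - 1) * t₂ ^ (-ρ₂ * s - 1)) * ω t₁ t₂ =
    ∫⁻ t₁ in Set.Ioo (0 : ℝ) 1, ∫⁻ t₂ in Set.Ioo (0 : ℝ) 1,
      ENNReal.ofReal (dyadicKernel ρ₁ 0 1 s t₁ * dyadicKernel ρ₂ 0 1 s t₂) * ω t₁ t₂ := by
  have e : ∀ {ρ t : ℝ}, 0 < t → t ^ (-ρ * s - 1) = dyadicKernel ρ 0 1 s t := fun ht => by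
    rw [dyadicKernel, zero_mul, rpow_zero, mul_one, rpow_sub_one ht.ne']
  refine setLIntegral_congr_fun measurableSet_Ioo fun t₁ h₁ =>
    setLIntegral_congr_fun measurableSet_Ioo fun t₂ h₂ => ?_
  simp only [e h₁.1, e h₂.1]

lemma exists_weylDeriv_mixedMod_le {p β₁ β₂ ρ₁ ρ₂ γ₁ γ₂ : ℝ} (hp : 1 < p)
    (hβ₁ : 0 < β₁) (hβ₂ : 0 < β₂) (hρ₁ : 0 < ρ₁) (hρ₂ : 0 < ρ₂) (hγ₁ : 0 < γ₁) (hγ₂ : 0 < γ₂) :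
    ∃ C : ℝ≥0∞, C ≠ ⊤ ∧ ∀ (f : ℝ → ℝ → ℝ) (δ₁ δ₂ : ℝ), MemLp0 p f → 0 < δ₁ → 0 < δ₂ →
      ∫⁻ t₁ in Set.Ioo (0 : ℝ) 1, ∫⁻ t₂ in Set.Ioo (0 : ℝ) 1,
        ENNReal.ofReal (t₁ ^ (-ρ₁ * min 2 p - 1) * t₂ ^ (-ρ₂ * min 2 p - 1)) *
          mixedMod p γ₁ γ₂ t₁ t₂ f ^ min 2 p ≠ ⊤ →
      ∃ g : ℝ → ℝ → ℝ, HasWeylDeriv p ρ₁ ρ₂ f g ∧ mixedMod p β₁ β₂ δ₁ δ₂ g ≤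
        C * (∫⁻ t₁ in Set.Ioo (0 : ℝ) 1, ∫⁻ t₂ in Set.Ioo (0 : ℝ) 1,
          ENNReal.ofReal (dyadicKernel ρ₁ β₁ δ₁ (min 2 p) t₁ *
            dyadicKernel ρ₂ β₂ δ₂ (min 2 p) t₂) *
              mixedMod p γ₁ γ₂ t₁ t₂ f ^ min 2 p) ^ (1 / min 2 p) := by
  have : Fact (1 ≤ ENNReal.ofReal p) := ⟨by simpa using hp.le⟩
  have hθ : 1 ≤ min 2 p := le_min (by norm_num) hp.le
  set θ := min 2 p with hθ_def
  have hθ0 : 0 < θ := by linarith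
  obtain ⟨C, hC⟩ := PeriodicGroup.exists_deriv_mixedModulus_le hθ
    (isotropicSmooth_Lp (μ := (volume : Measure Torus)) hp) hρ₁ hρ₂ hγ₁ hγ₂ hβ₁ hβ₂
  refine ⟨(C * 4) ^ (1 / θ), ENNReal.rpow_ne_top_of_nonneg (by positivity)
    (ENNReal.mul_ne_top ENNReal.coe_ne_top (by norm_num)), fun f δ₁ δ₂ hf hδ₁ hδ₂ hfin => ?_⟩
  obtain ⟨u, F, hu, huF, hstar, -, -⟩ := hf.exists_Lp hp
  have hω : ∀ t₁ t₂, mixedMod p γ₁ γ₂ t₁ t₂ f = PeriodicGroup.mixedModulus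
      (translationFst ENNReal.ofReal_ne_top) (translationSnd ENNReal.ofReal_ne_top)
        γ₁ γ₂ t₁ t₂ F := fun t₁ t₂ => mixedMod_eq_mixedModulus hp hγ₁ hγ₂ t₁ t₂ hu huF
  set ω : ℝ → ℝ → ℝ≥0∞ := fun t₁ t₂ => PeriodicGroup.mixedModulus
      (translationFst ENNReal.ofReal_ne_top) (translationSnd ENNReal.ofReal_ne_top)
        γ₁ γ₂ t₁ t₂ F with hω_def
  have hmono : ∀ t₁ t₂ u₁ u₂, t₁ ≤ u₁ → t₂ ≤ u₂ → ω t₁ t₂ ≤ ω u₁ u₂ :=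
    fun _ _ _ _ h₁ h₂ => PeriodicGroup.mixedModulus_mono h₁ h₂ F
  simp only [hω] at hfin ⊢
  rw [lintegral_rpow_eq_dyadicKernel ρ₁ ρ₂ θ fun t₁ t₂ => ω t₁ t₂ ^ θ] at hfin
  obtain ⟨Y, hYF, hY⟩ := hC _ _ (commuting_translation ENNReal.ofReal_ne_top) F (by
    refine ne_top_of_le_ne_top (ENNReal.mul_ne_top (by norm_num) hfin)
      (le_trans (le_of_eq ?_) (tsum_prod_dyadicWeight_le hρ₁.le hρ₂.le le_rfl le_rfl hθ0
        one_pos one_pos hmono))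
    simp only [dyadicWeight, rpow_zero, mul_one, hω_def])
  have hcoef : ∀ m n, torusCoef _ m n Y = weylSymbol ρ₁ ρ₂ m n * torusCoef _ m n F :=
    fun m n => (proj_proj_eq_smul_iff ENNReal.ofReal_ne_top m n _ F Y).1 (hYF m n)
  obtain ⟨g, v, hg, hv, hvY⟩ := exists_memLp0 hp (Y := Y)
    (torusCoef_ext ENNReal.ofReal_ne_top fun m n => by
      rw [torusCoef_star, hcoef, hcoef, map_mul, conj_weylSymbol, ← torusCoef_star, hstar])
    (fun n => by rw [hcoef, weylSymbol_zero_left hρ₁, zero_mul])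
    (fun m => by rw [hcoef, weylSymbol_zero_right _ hρ₂, zero_mul])
  refine ⟨g, ⟨hg, fun m n => ?_⟩, ?_⟩
  · rw [fourierCoefZ_eq_torusCoef hv hvY, fourierCoefZ_eq_torusCoef hu huF, hcoef, weylSymbol]
    ring
  · rw [mixedMod_eq_mixedModulus hp hβ₁ hβ₂ δ₁ δ₂ hv hvY,
      ← ENNReal.mul_rpow_of_nonneg _ _ (by positivity), one_div, ENNReal.le_rpow_inv_iff hθ0,
      mul_assoc]
    exact (hY δ₁ δ₂ hδ₁ hδ₂).trans (mul_le_mul_right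
      (tsum_prod_dyadicWeight_le hρ₁.le hρ₂.le hβ₁.le hβ₂.le hθ0 hδ₁ hδ₂ hmono) _)

lemma exists_le_mixedMod_weylDeriv {p β₁ β₂ ρ₁ ρ₂ α₁ α₂ : ℝ} (hp : 1 < p)
    (hβ₁ : 0 < β₁) (hβ₂ : 0 < β₂) (hρ₁ : 0 < ρ₁) (hρ₂ : 0 < ρ₂) (hα₁ : 0 < α₁) (hα₂ : 0 < α₂) :
    ∃ C : ℝ≥0∞, C ≠ ⊤ ∧ ∀ (f g : ℝ → ℝ → ℝ) (δ₁ δ₂ : ℝ), MemLp0 p f → 0 < δ₁ → 0 < δ₂ →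
      HasWeylDeriv p ρ₁ ρ₂ f g →
        (∫⁻ t₁ in Set.Ioo (0 : ℝ) 1, ∫⁻ t₂ in Set.Ioo (0 : ℝ) 1,
          ENNReal.ofReal (dyadicKernel ρ₁ β₁ δ₁ (max 2 p) t₁ *
            dyadicKernel ρ₂ β₂ δ₂ (max 2 p) t₂) *
              mixedMod p (ρ₁ + α₁ + β₁) (ρ₂ + α₂ + β₂) t₁ t₂ f ^ max 2 p) ^ (1 / max 2 p) ≤
        C * mixedMod p β₁ β₂ δ₁ δ₂ g := by
  have : Fact (1 ≤ ENNReal.ofReal p) := ⟨by simpa using hp.le⟩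
  have hτ : 1 ≤ max 2 p := le_max_of_le_right hp.le
  set τ := max 2 p with hτ_def
  have hτ0 : 0 < τ := by linarith
  obtain ⟨C, hC⟩ := PeriodicGroup.exists_tsum_dyadicWeight_mul_mixedModulus_le hτ
    (isotropicConvex_Lp (μ := (volume : Measure Torus)) hp) hρ₁ hρ₂ hα₁ hα₂ hβ₁ hβ₂
  set K := ENNReal.ofReal (2 ^ (ρ₁ + β₁)) * ENNReal.ofReal (2 ^ (ρ₂ + β₂)) with hK
  have hKt : K ≠ ⊤ := ENNReal.mul_ne_top ENNReal.ofReal_ne_top ENNReal.ofReal_ne_top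
  refine ⟨(K ^ τ * C) ^ (1 / τ), ENNReal.rpow_ne_top_of_nonneg (by positivity)
    (ENNReal.mul_ne_top (ENNReal.rpow_ne_top_of_nonneg hτ0.le hKt) ENNReal.coe_ne_top),
    fun f g δ₁ δ₂ hf hδ₁ hδ₂ hg => ?_⟩
  obtain ⟨u, F, hu, huF, -, hF₁, hF₂⟩ := hf.exists_Lp hp
  obtain ⟨v, Y, hv, hvY, -, -, -⟩ := hg.1.exists_Lp hp
  set ω : ℝ → ℝ → ℝ≥0∞ := fun t₁ t₂ => PeriodicGroup.mixedModulus
      (translationFst ENNReal.ofReal_ne_top) (translationSnd ENNReal.ofReal_ne_top)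
        (ρ₁ + α₁ + β₁) (ρ₂ + α₂ + β₂) t₁ t₂ F with hω_def
  have hω : ∀ t₁ t₂, mixedMod p (ρ₁ + α₁ + β₁) (ρ₂ + α₂ + β₂) t₁ t₂ f = ω t₁ t₂ :=
    fun t₁ t₂ => mixedMod_eq_mixedModulus hp (by positivity) (by positivity) t₁ t₂ hu huF
  have hmono : ∀ t₁ t₂ u₁ u₂, t₁ ≤ u₁ → t₂ ≤ u₂ → ω t₁ t₂ ≤ ω u₁ u₂ :=
    fun _ _ _ _ h₁ h₂ => PeriodicGroup.mixedModulus_mono h₁ h₂ F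
  simp only [hω]
  rw [mixedMod_eq_mixedModulus hp hβ₁ hβ₂ δ₁ δ₂ hv hvY, one_div, ENNReal.rpow_inv_le_iff hτ0,
    ENNReal.mul_rpow_of_nonneg _ _ hτ0.le, ENNReal.rpow_inv_rpow hτ0.ne', mul_assoc]
  refine (lintegral_dyadicKernel_prod_le hρ₁.le hρ₂.le hβ₁.le hβ₂.le hτ0 hδ₁ hδ₂ hmono).trans
    (mul_le_mul_right ?_ _)
  refine hC _ _ (commuting_translation ENNReal.ofReal_ne_top) F Y δ₁ δ₂ hδ₁ hδ₂
    (fun n => (proj_proj_eq_zero_iff _ 0 n F).2 (hF₁ n))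
    (fun m => (proj_proj_eq_zero_iff _ m 0 F).2 (hF₂ m))
    fun m n => (proj_proj_eq_smul_iff _ m n _ F Y).2 ?_
  have h := hg.2 m n
  have hπ : ((((2 * π) ^ 2)⁻¹ : ℝ) : ℂ) ≠ 0 := by
    exact_mod_cast (by positivity : ((2 * π) ^ 2)⁻¹ ≠ 0)
  rw [fourierCoefZ_eq_torusCoef hv hvY, fourierCoefZ_eq_torusCoef hu huF, mul_left_comm] at h
  exact mul_left_cancel₀ hπ h

/-- Theorem 8.4 (i): two-sided estimates of `ω_{β₁,β₂}(f^{(r₁-α₁,r₂-α₂)},δ₁,δ₂)_p`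
via the quantity `J(s)`. -/
theorem modulus_of_lower_order_derivative (p β₁ β₂ r₁ r₂ α₁ α₂ : ℝ) (hp : 1 < p)
    (hβ₁ : 0 < β₁) (hβ₂ : 0 < β₂) (hα₁ : 0 < α₁) (hα₂ : 0 < α₂)
    (hαr₁ : α₁ < r₁) (hαr₂ : α₂ < r₂) :
    ∃ C : ℝ, 0 < C ∧ ∀ (f : ℝ → ℝ → ℝ) (δ₁ δ₂ : ℝ), MemLp0 p f →
      δ₁ ∈ Set.Ioo (0:ℝ) (1/2) → δ₂ ∈ Set.Ioo (0:ℝ) (1/2) →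
      ((∫⁻ t₁ in Set.Ioo (0:ℝ) 1, ∫⁻ t₂ in Set.Ioo (0:ℝ) 1,
          ENNReal.ofReal (t₁ ^ (-(r₁-α₁)*(min 2 p)-1) * t₂ ^ (-(r₂-α₂)*(min 2 p)-1)) *
            mixedMod p (r₁+β₁) (r₂+β₂) t₁ t₂ f ^ (min 2 p)) ≠ ⊤ →
        ∃ g : ℝ → ℝ → ℝ, HasWeylDeriv p (r₁-α₁) (r₂-α₂) f g ∧
          mixedMod p β₁ β₂ δ₁ δ₂ g ≤
            ENNReal.ofReal C * Jfun p β₁ β₂ r₁ r₂ α₁ α₂ δ₁ δ₂ (min 2 p) f) ∧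
      (∀ g : ℝ → ℝ → ℝ, HasWeylDeriv p (r₁-α₁) (r₂-α₂) f g →
        Jfun p β₁ β₂ r₁ r₂ α₁ α₂ δ₁ δ₂ (max 2 p) f ≤
          ENNReal.ofReal C * mixedMod p β₁ β₂ δ₁ δ₂ g) := by
  have hρ₁ : 0 < r₁ - α₁ := sub_pos.2 hαr₁
  have hρ₂ : 0 < r₂ - α₂ := sub_pos.2 hαr₂
  obtain ⟨A, hA, hA'⟩ := exists_weylDeriv_mixedMod_le hp hβ₁ hβ₂ hρ₁ hρ₂
    (by linarith : 0 < r₁ + β₁) (by linarith : 0 < r₂ + β₂)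
  obtain ⟨B, hB, hB'⟩ := exists_le_mixedMod_weylDeriv hp hβ₁ hβ₂ hρ₁ hρ₂ hα₁ hα₂
  rw [sub_add_cancel, sub_add_cancel] at hB'
  have hC : ENNReal.ofReal (A.toReal + B.toReal + 1) = A + B + 1 := by
    rw [ENNReal.ofReal_add (by positivity) zero_le_one, ENNReal.ofReal_add (by positivity)
      (by positivity), ENNReal.ofReal_toReal hA, ENNReal.ofReal_toReal hB, ENNReal.ofReal_one]
  refine ⟨A.toReal + B.toReal + 1, by positivity, fun f δ₁ δ₂ hf hδ₁ hδ₂ =>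
    ⟨fun hfin => ?_, fun g hg => ?_⟩⟩
  · obtain ⟨g, hg, hle⟩ := hA' f δ₁ δ₂ hf hδ₁.1 hδ₂.1 hfin
    refine ⟨g, hg, hle.trans ?_⟩
    rw [hC, add_assoc]
    exact mul_le_mul_left le_self_add _
  · refine (hB' f g δ₁ δ₂ hf hδ₁.1 hδ₂.1 hg).trans ?_
    rw [hC, add_right_comm]
    exact mul_le_mul_left le_add_self _

end
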